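/- Suppose the initial relative entropies satisfy H_N(0) = o(N^{d−2α}), i.e. N^{2α−d} H_N(0) → 0 as N → ∞. Then: (i) if d = 1, α ∈ (0, 1/2), and 0 < κ ≤ α with κ < 1 − 2α, then for every t ∈ [0,T] one has N^{2α−1} H_N(t) → 0 as N → ∞; (ii) if d ≥ 2, α > 0, and 0 < κ ≤ α with κ < 1, then for every t ∈ [0,T] one has N^{2α−d} H_N(t) → 0 as N → ∞. -/

import Mathlib

open Real Filter

noncomputable section

/-- The discrete torus `𝕋_N^d`, realized as `d`-tuples of residues mod `N`. -/
abbrev Site (N d : ℕ) := Fin d → Fin N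

/-- Configurations of the generalized exclusion process: at most `K` particles per site. -/
abbrev GCfg (N d K : ℕ) := Site N d → Fin (K + 1)

/-- Cyclic successor on `Fin N`. -/
def finCycAdd {N : ℕ} (a : Fin N) : Fin N :=
  ⟨(a.val + 1) % N, Nat.mod_lt _ (Nat.lt_of_le_of_lt (Nat.zero_le _) a.isLt)⟩

/-- Cyclic predecessor on `Fin N`. -/
def finCycSub {N : ℕ} (a : Fin N) : Fin N :=
  ⟨(a.val + (N - 1)) % N, Nat.mod_lt _ (Nat.lt_of_le_of_lt (Nat.zero_le _) a.isLt)⟩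

/-- The neighbour `x + e_i` (if `b = true`) resp. `x − e_i` (if `b = false`) of a site. -/
def siteMove {N d : ℕ} (x : Site N d) (i : Fin d) (b : Bool) : Site N d :=
  Function.update x i (if b then finCycAdd (x i) else finCycSub (x i))

/-- The configuration `η^{x,y}` obtained from `η` when one particle jumps from `x` to `y`. -/
def cfgJump {N d K : ℕ} (η : GCfg N d K) (x y : Site N d) : GCfg N d K := fun z =>
  if z = x then ⟨(η x).val - 1, lt_of_le_of_lt (Nat.sub_le _ _) (η x).isLt⟩
  else if z = y then ⟨min ((η y).val + 1) K, Nat.lt_succ_of_le (min_le_right _ _)⟩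
  else η z

/-- The jump rate `c_{x,i}(η) = p_i η_x (K − η_{x+e_i})`, with directions indexed by
`(i,b) ∈ Fin d × Bool`: `(i,true)` is `e_i` and `(i,false)` is `−e_i = e_{i+d}`. -/
def jumpRate {N d K : ℕ} (p : Fin d → Bool → ℝ) (η : GCfg N d K)
    (x : Site N d) (i : Fin d) (b : Bool) : ℝ :=
  p i b * ((η x).val : ℝ) * ((K : ℝ) - ((η (siteMove x i b)).val : ℝ))

/-- The generator `L_N` of the asymmetric generalized exclusion process. -/
def genL {N d K : ℕ} (p : Fin d → Bool → ℝ) (f : GCfg N d K → ℝ) (η : GCfg N d K) : ℝ :=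
  ∑ i : Fin d, ∑ b : Bool, ∑ x : Site N d,
    jumpRate p η x i b * (f (cfgJump η x (siteMove x i b)) - f η)

/-- The `Binomial (K, ϱ/K)` weight of the occupation number `k`. -/
def binomW (K : ℕ) (ϱ : ℝ) (k : ℕ) : ℝ :=
  (K.choose k : ℝ) * (ϱ / K) ^ k * (1 - ϱ / K) ^ (K - k)

/-- The product measure on configurations with `Binomial (K, ϱ_x/K)` marginals. -/
def prodBinom {N d K : ℕ} (ϱ : Site N d → ℝ) (η : GCfg N d K) : ℝ :=
  ∏ x : Site N d, binomW K (ϱ x) (η x).val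

/-- The relative entropy `H(μ|ν) = Σ_η f(η) log f(η) ν(η)` with `f = μ/ν`. -/
def relEnt {Ω : Type*} [Fintype Ω] (μ ν : Ω → ℝ) : ℝ :=
  ∑ η : Ω, (μ η / ν η) * Real.log (μ η / ν η) * ν η

/-- The Dirichlet form `D_N(f;ν)`. -/
def dirichletForm {N d K : ℕ} (p : Fin d → Bool → ℝ) (f ν : GCfg N d K → ℝ) : ℝ :=
  ∑ i : Fin d, ∑ b : Bool, ∑ x : Site N d, ∑ η : GCfg N d K,
    jumpRate p η x i b *
      (Real.sqrt (f (cfgJump η x (siteMove x i b))) - Real.sqrt (f η)) ^ 2 * ν η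

/-- The macroscopic coordinates `x/N ∈ 𝕋^d` of a site. -/
def siteCoord {N d : ℕ} (x : Site N d) : Fin d → ℝ := fun j => (x j : ℝ) / N

/-- The slowly varying density profile
`ϱ_N(t,u) = ϱ* + N^{−α} ρ(N^{κ−α} t, u − N^κ λ t m)`, with `λ = K − 2ϱ*`. -/
def profileGE (d K : ℕ) (ϱs α κ : ℝ) (m : Fin d → ℝ) (ρ : ℝ → (Fin d → ℝ) → ℝ)
    (N : ℕ) (t : ℝ) (u : Fin d → ℝ) : ℝ :=
  ϱs + (N : ℝ) ^ (-α) * ρ ((N : ℝ) ^ (κ - α) * t)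
    (fun j => u j - (N : ℝ) ^ κ * ((K : ℝ) - 2 * ϱs) * t * m j)

end

/-- Pinsker-type bound: a bounded centred observable is controlled by the relative entropy. -/
theorem sq_sum_le_entropy {S : Type*} [Fintype S] (q p w : S → ℝ) (B : ℝ)
    (hq : ∀ s, 0 < q s) (hqs : ∑ s, q s = 1) (hw0 : ∑ s, q s * w s = 0)
    (hwB : ∀ s, |w s| ≤ B) (hp : ∀ s, 0 < p s) (hps : ∑ s, p s = 1) :
    (∑ s, p s * w s) ^ 2 ≤ 4 * B ^ 2 * ∑ s, p s * log (p s / q s) := by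
  have key : ∀ s, (√(p s) - √(q s)) ^ 2 + (p s - q s) ≤ p s * log (p s / q s) := by
    intro s
    have hp' := Real.sqrt_pos.2 (hp s)
    have hq' := Real.sqrt_pos.2 (hq s)
    have h1 : log (p s / q s) = - (2 * log (√(q s) / √(p s))) := by
      rw [Real.log_div (hp s).ne' (hq s).ne', Real.log_div hq'.ne' hp'.ne', Real.log_sqrt (hq s).le,
        Real.log_sqrt (hp s).le]
      ring
    have h2 := Real.log_le_sub_one_of_pos (div_pos hq' hp')
    have h3 : p s * (√(q s) / √(p s)) = √(p s) * √(q s) := by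
      rw [mul_div_assoc', div_eq_iff hp'.ne']
      linear_combination (-√(q s)) * Real.mul_self_sqrt (hp s).le
    have h4 := Real.mul_self_sqrt (hp s).le
    have h5 := Real.mul_self_sqrt (hq s).le
    rw [h1]
    nlinarith [mul_le_mul_of_nonneg_left h2 (hp s).le]
  have hent : ∑ s, (√(p s) - √(q s)) ^ 2 ≤ ∑ s, p s * log (p s / q s) := by
    have := Finset.sum_le_sum fun s (_ : s ∈ Finset.univ) => key s
    simp only [Finset.sum_add_distrib, Finset.sum_sub_distrib, hqs, hps] at this
    linarith
  have hplus : ∑ s, (√(p s) + √(q s)) ^ 2 ≤ 4 := by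
    calc ∑ s, (√(p s) + √(q s)) ^ 2 ≤ ∑ s, (2 * p s + 2 * q s) := by
          refine Finset.sum_le_sum fun s _ => ?_
          nlinarith [Real.mul_self_sqrt (hp s).le, Real.mul_self_sqrt (hq s).le,
            sq_nonneg (√(p s) - √(q s))]
      _ = 4 := by
          rw [Finset.sum_add_distrib, ← Finset.mul_sum, ← Finset.mul_sum, hqs, hps]; norm_num
  have hrep : ∑ s, p s * w s = ∑ s, (√(p s) - √(q s)) * ((√(p s) + √(q s)) * w s) := by
    rw [← sub_zero (∑ s, p s * w s), ← hw0, ← Finset.sum_sub_distrib]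
    refine Finset.sum_congr rfl fun s _ => ?_
    have h4 := Real.mul_self_sqrt (hp s).le
    have h5 := Real.mul_self_sqrt (hq s).le
    linear_combination (-w s) * h4 + w s * h5
  have hB : ∑ s, ((√(p s) + √(q s)) * w s) ^ 2 ≤ 4 * B ^ 2 := by
    calc ∑ s, ((√(p s) + √(q s)) * w s) ^ 2 ≤ ∑ s, (√(p s) + √(q s)) ^ 2 * B ^ 2 := by
          refine Finset.sum_le_sum fun s _ => ?_
          rw [mul_pow]
          exact mul_le_mul_of_nonneg_left (sq_le_sq.2 ((hwB s).trans (le_abs_self B)))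
            (sq_nonneg _)
      _ ≤ 4 * B ^ 2 := by
          rw [← Finset.sum_mul]
          exact mul_le_mul_of_nonneg_right hplus (sq_nonneg _)
  rw [hrep]
  calc _ ≤ (∑ s, (√(p s) - √(q s)) ^ 2) * ∑ s, ((√(p s) + √(q s)) * w s) ^ 2 :=
        Finset.sum_mul_sq_le_sq_mul_sq _ _ _
    _ ≤ (∑ s, p s * log (p s / q s)) * (4 * B ^ 2) :=
        mul_le_mul hent hB (Finset.sum_nonneg fun s _ => sq_nonneg _)
          ((Finset.sum_nonneg fun s _ => sq_nonneg _).trans hent)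
    _ = _ := by ring

theorem relEnt_eq_sum_log {Ω : Type*} [Fintype Ω] (μ ν : Ω → ℝ) (hν : ∀ η, 0 < ν η) :
    relEnt μ ν = ∑ η, μ η * log (μ η / ν η) := by
  unfold relEnt
  refine Finset.sum_congr rfl fun η _ => ?_
  have := (hν η).ne'
  field_simp

theorem sum_fin_cons {S : Type*} [Fintype S] {n : ℕ} (F : (Fin (n + 1) → S) → ℝ) :
    ∑ η, F η = ∑ η : Fin n → S, ∑ s, F (Fin.cons s η) := by
  rw [← (Fin.consEquiv (fun _ : Fin (n + 1) => S)).sum_comp, Fintype.sum_prod_type,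
    Finset.sum_comm]
  rfl

/-- Doob decomposition of a field of bounded centred single-site observables under a law `μ`:
the predictable part is controlled by the relative entropy with respect to a product measure,
and the remainder consists of orthogonal bounded increments. -/
theorem exists_doob_fin {S : Type*} [Fintype S] (B : ℝ) (n : ℕ) (ν w : Fin n → S → ℝ)
    (hν : ∀ i s, 0 < ν i s) (hνs : ∀ i, ∑ s, ν i s = 1) (hw0 : ∀ i, ∑ s, ν i s * w i s = 0)
    (hwB : ∀ i s, |w i s| ≤ B) (μ : (Fin n → S) → ℝ) (hμ : ∀ η, 0 < μ η) (hμs : ∑ η, μ η = 1) :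
    ∃ m : (Fin n → S) → Fin n → ℝ,
      (∑ η, μ η * ∑ i, m η i ^ 2 ≤ 4 * B ^ 2 * relEnt μ fun η => ∏ i, ν i (η i)) ∧
      (∀ i, ∑ η, μ η * (w i (η i) - m η i) = 0) ∧
      (∀ i j, i ≠ j → ∑ η, μ η * ((w i (η i) - m η i) * (w j (η j) - m η j)) = 0) ∧
      ∀ i, ∑ η, μ η * (w i (η i) - m η i) ^ 2 ≤ B ^ 2 := by
  induction n with
  | zero =>
    refine ⟨fun _ _ => 0, ?_, fun i => i.elim0, fun i => i.elim0, fun i => i.elim0⟩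
    have h1 : ∀ η, μ η = 1 := by
      intro η
      rw [← hμs, Fintype.sum_subsingleton _ η]
    simp [relEnt, h1]
  | succ n ih =>
    have hne : Nonempty S := by
      by_contra h
      rw [not_nonempty_iff] at h
      have := hνs 0
      simp at this
    set μ' : (Fin n → S) → ℝ := fun η => ∑ s, μ (Fin.cons s η) with hμ'
    have hμ'pos : ∀ η, 0 < μ' η := fun η =>
      Finset.sum_pos (fun s _ => hμ _) Finset.univ_nonempty
    have hμ's : ∑ η, μ' η = 1 := by rw [← hμs, sum_fin_cons]
    obtain ⟨m, hm1, hm2, hm3, hm4⟩ := ih (fun i => ν i.succ) (fun i => w i.succ)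
      (fun i => hν _) (fun i => hνs _) (fun i => hw0 _) (fun i => hwB _) μ' hμ'pos hμ's
    set m0 : (Fin n → S) → ℝ := fun η => ∑ s, μ (Fin.cons s η) / μ' η * w 0 s with hm0
    have hcond : ∀ η, ∑ s, μ (Fin.cons s η) * (w 0 s - m0 η) = 0 := by
      intro η
      have h1 : ∑ s, μ (Fin.cons s η) * w 0 s = μ' η * m0 η := by
        simp only [hm0, Finset.mul_sum]
        refine Finset.sum_congr rfl fun s _ => ?_
        have := (hμ'pos η).ne'
        field_simp
      simp only [mul_sub, Finset.sum_sub_distrib, ← Finset.sum_mul]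
      rw [h1]; simp [hμ']
    refine ⟨fun η => Fin.cons (m0 (Fin.tail η)) (m (Fin.tail η)), ?_, ?_, ?_, ?_⟩
    · have hchain : (relEnt μ fun η => ∏ i, ν i (η i)) =
          (relEnt μ' fun η => ∏ i, ν (Fin.succ i) (η i)) +
          ∑ η, μ' η * ∑ s, μ (Fin.cons s η) / μ' η * log (μ (Fin.cons s η) / μ' η / ν 0 s) := by
        rw [relEnt_eq_sum_log _ _ (fun η => Finset.prod_pos fun i _ => hν _ _),
          relEnt_eq_sum_log _ _ (fun η => Finset.prod_pos fun i _ => hν _ _), sum_fin_cons,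
          ← Finset.sum_add_distrib]
        refine Finset.sum_congr rfl fun η _ => ?_
        rw [Finset.mul_sum]
        have h1 : μ' η * log (μ' η / ∏ i, ν (Fin.succ i) (η i)) =
            ∑ s, μ (Fin.cons s η) * log (μ' η / ∏ i, ν (Fin.succ i) (η i)) := by
          rw [← Finset.sum_mul]
        rw [h1, ← Finset.sum_add_distrib]
        refine Finset.sum_congr rfl fun s _ => ?_
        have hP : 0 < ∏ i, ν (Fin.succ i) (η i) := Finset.prod_pos fun i _ => hν _ _
        have ha := hμ'pos η
        have hb := hμ (Fin.cons s η)
        rw [Fin.prod_univ_succ]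
        simp only [Fin.cons_zero, Fin.cons_succ]
        rw [Real.log_div hb.ne' (mul_pos (hν _ _) hP).ne', Real.log_mul (hν _ _).ne' hP.ne',
          Real.log_div ha.ne' hP.ne', Real.log_div (div_pos hb ha).ne' (hν _ _).ne',
          Real.log_div hb.ne' ha.ne']
        field_simp
        ring
      rw [hchain, mul_add, sum_fin_cons]
      have hpin : ∀ η, m0 η ^ 2 ≤ 4 * B ^ 2 *
          ∑ s, μ (Fin.cons s η) / μ' η * log (μ (Fin.cons s η) / μ' η / ν 0 s) := by
        intro η
        refine sq_sum_le_entropy (ν 0) _ (w 0) B (hν 0) (hνs 0) (hw0 0) (hwB 0)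
          (fun s => div_pos (hμ _) (hμ'pos η)) ?_
        rw [← Finset.sum_div]
        exact div_self (hμ'pos η).ne'
      have hsplit : ∀ η, ∑ s, μ (Fin.cons s η) * ∑ i, (Fin.cons
          (m0 (Fin.tail (Fin.cons s η : Fin (n + 1) → S)))
          (m (Fin.tail (Fin.cons s η : Fin (n + 1) → S))) : Fin (n + 1) → ℝ) i ^ 2
          = μ' η * ∑ i, m η i ^ 2 + μ' η * m0 η ^ 2 := by
        intro η
        simp only [Fin.tail_cons, Fin.sum_univ_succ, Fin.cons_zero, Fin.cons_succ]
        rw [← Finset.sum_mul]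
        simp only [hμ']
        ring
      simp only [hsplit, Finset.sum_add_distrib]
      refine add_le_add hm1 ?_
      rw [Finset.mul_sum]
      refine Finset.sum_le_sum fun η _ => ?_
      nlinarith [mul_le_mul_of_nonneg_left (hpin η) (hμ'pos η).le]
    · intro i
      rw [sum_fin_cons]
      refine Fin.cases ?_ (fun i => ?_) i
      · simp only [Fin.tail_cons, Fin.cons_zero, hcond, Finset.sum_const_zero]
      · simp only [Fin.tail_cons, Fin.cons_succ, ← Finset.sum_mul]
        exact hm2 i
    · have h0 : ∀ j : Fin n, ∑ η : Fin n → S, ∑ s, μ (Fin.cons s η) *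
          ((w 0 s - m0 η) * (w j.succ (η j) - m η j)) = 0 := by
        intro j
        refine Finset.sum_eq_zero fun η _ => ?_
        simp only [← mul_assoc, ← Finset.sum_mul, hcond, zero_mul]
      intro i j hij
      rw [sum_fin_cons]
      induction i using Fin.cases with
      | zero =>
        induction j using Fin.cases with
        | zero => exact absurd rfl hij
        | succ j =>
          simp only [Fin.tail_cons, Fin.cons_zero, Fin.cons_succ]
          exact h0 j
      | succ i =>
        induction j using Fin.cases with
        | zero =>
          simp only [Fin.tail_cons, Fin.cons_zero, Fin.cons_succ]
          rw [← h0 i]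
          refine Finset.sum_congr rfl fun η _ => Finset.sum_congr rfl fun s _ => ?_
          ring
        | succ j =>
          simp only [Fin.tail_cons, Fin.cons_succ, ← Finset.sum_mul]
          exact hm3 i j (fun h => hij (by rw [h]))
    · intro i
      rw [sum_fin_cons]
      refine Fin.cases ?_ (fun i => ?_) i
      · simp only [Fin.tail_cons, Fin.cons_zero]
        calc ∑ η : Fin n → S, ∑ s, μ (Fin.cons s η) * (w 0 s - m0 η) ^ 2
            ≤ ∑ η : Fin n → S, ∑ s, μ (Fin.cons s η) * B ^ 2 := by
              refine Finset.sum_le_sum fun η _ => ?_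
              have e : ∑ s, μ (Fin.cons s η) * (w 0 s - m0 η) ^ 2 =
                  ∑ s, μ (Fin.cons s η) * w 0 s ^ 2 - μ' η * m0 η ^ 2 := by
                have e1 : ∑ s, μ (Fin.cons s η) * (w 0 s - m0 η) ^ 2 =
                  ∑ s, μ (Fin.cons s η) * w 0 s ^ 2 - μ' η * m0 η ^ 2
                    - 2 * m0 η * ∑ s, μ (Fin.cons s η) * (w 0 s - m0 η) := by
                  simp only [hμ', Finset.sum_mul, Finset.mul_sum, ← Finset.sum_sub_distrib]
                  refine Finset.sum_congr rfl fun s _ => ?_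
                  ring
                rw [e1, hcond]; ring
              rw [e]
              have : ∑ s, μ (Fin.cons s η) * w 0 s ^ 2 ≤ ∑ s, μ (Fin.cons s η) * B ^ 2 :=
                Finset.sum_le_sum fun s _ => mul_le_mul_of_nonneg_left
                  (sq_le_sq.2 ((hwB 0 s).trans (le_abs_self B))) (hμ _).le
              nlinarith [mul_nonneg (hμ'pos η).le (sq_nonneg (m0 η))]
          _ = B ^ 2 := by
              simp only [← Finset.sum_mul]
              rw [← sum_fin_cons, hμs, one_mul]
      · simp only [Fin.tail_cons, Fin.cons_succ, ← Finset.sum_mul]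
        exact hm4 i

/-- `exists_doob_fin` for an arbitrary finite index set. -/
theorem exists_doob {ι S : Type*} [Fintype ι] [DecidableEq ι] [Fintype S] (B : ℝ) (ν w : ι → S → ℝ)
    (hν : ∀ i s, 0 < ν i s) (hνs : ∀ i, ∑ s, ν i s = 1) (hw0 : ∀ i, ∑ s, ν i s * w i s = 0)
    (hwB : ∀ i s, |w i s| ≤ B) (μ : (ι → S) → ℝ) (hμ : ∀ η, 0 < μ η) (hμs : ∑ η, μ η = 1) :
    ∃ m : (ι → S) → ι → ℝ,
      (∑ η, μ η * ∑ i, m η i ^ 2 ≤ 4 * B ^ 2 * relEnt μ fun η => ∏ i, ν i (η i)) ∧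
      (∀ i, ∑ η, μ η * (w i (η i) - m η i) = 0) ∧
      (∀ i j, i ≠ j → ∑ η, μ η * ((w i (η i) - m η i) * (w j (η j) - m η j)) = 0) ∧
      ∀ i, ∑ η, μ η * (w i (η i) - m η i) ^ 2 ≤ B ^ 2 := by
  set e := Fintype.equivFin ι
  set E : (ι → S) ≃ (Fin (Fintype.card ι) → S) := Equiv.arrowCongr e (Equiv.refl S) with hE
  have hEs : ∀ η i, E.symm η i = η (e i) := fun η i => rfl
  obtain ⟨m, hm1, hm2, hm3, hm4⟩ := exists_doob_fin B _ (fun i => ν (e.symm i))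
    (fun i => w (e.symm i)) (fun i => hν _) (fun i => hνs _) (fun i => hw0 _) (fun i => hwB _)
    (fun η => μ (E.symm η)) (fun η => hμ _) (by rw [E.symm.sum_comp]; exact hμs)
  refine ⟨fun η i => m (E η) (e i), ?_, ?_, ?_, ?_⟩
  · rw [← E.symm.sum_comp]
    simp only [Equiv.apply_symm_apply]
    have h1 : ∀ η, ∑ i, m η (e i) ^ 2 = ∑ i, m η i ^ 2 := fun η => e.sum_comp (fun i => m η i ^ 2)
    simp only [h1]
    refine hm1.trans (le_of_eq ?_)
    unfold relEnt
    rw [← E.symm.sum_comp (fun η => μ η / (∏ i, ν i (η i)) * log (μ η / ∏ i, ν i (η i)) *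
      ∏ i, ν i (η i))]
    have h2 : ∀ η : Fin (Fintype.card ι) → S, ∏ i, ν i (E.symm η i)
        = ∏ i, ν (e.symm i) (η i) := by
      intro η
      rw [← e.symm.prod_comp]
      simp [hEs]
    simp only [h2]
  · intro i
    rw [← E.symm.sum_comp]
    simpa [hEs] using hm2 (e i)
  · intro i j hij
    rw [← E.symm.sum_comp]
    simpa [hEs] using hm3 (e i) (e j) (fun h => hij (e.injective h))
  · intro i
    rw [← E.symm.sum_comp]
    simpa [hEs] using hm4 (e i)

/-- Schur test for the square of a linear image. -/
theorem schur_sq {ι κ : Type*} [Fintype ι] [Fintype κ] (A : κ → ι → ℝ) (r c : ℝ) (v : ι → ℝ)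
    (hr : ∀ y, ∑ x, |A y x| ≤ r) (hc : ∀ x, ∑ y, |A y x| ≤ c) (hr0 : 0 ≤ r) :
    ∑ y, (∑ x, A y x * v x) ^ 2 ≤ r * c * ∑ x, v x ^ 2 := by
  have h1 : ∀ y, (∑ x, A y x * v x) ^ 2 ≤ r * ∑ x, |A y x| * v x ^ 2 := by
    intro y
    calc (∑ x, A y x * v x) ^ 2 ≤ (∑ x, |A y x|) * ∑ x, |A y x| * v x ^ 2 := by
          refine Finset.sum_sq_le_sum_mul_sum_of_sq_le_mul _ (fun x _ => abs_nonneg _)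
            (fun x _ => by positivity) (fun x _ => le_of_eq ?_)
          rw [mul_pow, ← sq_abs (A y x)]; ring
      _ ≤ _ := mul_le_mul_of_nonneg_right (hr y) (Finset.sum_nonneg fun x _ => by positivity)
  calc _ ≤ ∑ y, r * ∑ x, |A y x| * v x ^ 2 := Finset.sum_le_sum fun y _ => h1 y
    _ = r * ∑ x, (∑ y, |A y x|) * v x ^ 2 := by
        rw [← Finset.mul_sum, Finset.sum_comm]
        simp only [Finset.sum_mul]
    _ ≤ r * ∑ x, c * v x ^ 2 := by
        refine mul_le_mul_of_nonneg_left (Finset.sum_le_sum fun x _ => ?_) hr0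
        exact mul_le_mul_of_nonneg_right (hc x) (sq_nonneg _)
    _ = _ := by rw [← Finset.mul_sum]; ring

/-- Schur test for a bilinear form. -/
theorem schur_form {ι : Type*} [Fintype ι] (q : ι → ι → ℝ) (r c : ℝ) (v : ι → ℝ)
    (hr : ∀ x, ∑ y, |q x y| ≤ r) (hc : ∀ y, ∑ x, |q x y| ≤ c) :
    ∑ x, ∑ y, q x y * (v x * v y) ≤ (r + c) / 2 * ∑ x, v x ^ 2 := by
  calc ∑ x, ∑ y, q x y * (v x * v y)
      ≤ ∑ x, ∑ y, (|q x y| * v x ^ 2 / 2 + |q x y| * v y ^ 2 / 2) := by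
        refine Finset.sum_le_sum fun x _ => Finset.sum_le_sum fun y _ => ?_
        have h1 : q x y * (v x * v y) ≤ |q x y| * (|v x| * |v y|) := by
          rw [← abs_mul, ← abs_mul]; exact le_abs_self _
        have h2 : |v x| * |v y| ≤ (v x ^ 2 + v y ^ 2) / 2 := by
          rw [← sq_abs (v x), ← sq_abs (v y)]
          nlinarith [sq_nonneg (|v x| - |v y|)]
        nlinarith [mul_le_mul_of_nonneg_left h2 (abs_nonneg (q x y))]
    _ = (∑ x, (∑ y, |q x y|) * v x ^ 2) / 2 + (∑ y, (∑ x, |q x y|) * v y ^ 2) / 2 := by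
        simp only [Finset.sum_add_distrib]
        congr 1
        · simp only [Finset.sum_mul, Finset.sum_div]
        · rw [Finset.sum_comm]
          simp only [Finset.sum_mul, Finset.sum_div]
    _ ≤ (∑ x, r * v x ^ 2) / 2 + (∑ y, c * v y ^ 2) / 2 := by
        gcongr with x _ y _
        · exact hr x
        · exact hc y
    _ = _ := by rw [← Finset.mul_sum, ← Finset.mul_sum]; ring

/-- Second moment of a linear form with orthogonal bounded increments. -/
theorem sum_sq_orthogonal {ι Ω : Type*} [Fintype ι] [Fintype Ω] {B : ℝ} (P : Ω → ℝ) (M : Ω → ι → ℝ)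
    (hM : ∀ i j, i ≠ j → ∑ η, P η * (M η i * M η j) = 0)
    (hM2 : ∀ i, ∑ η, P η * M η i ^ 2 ≤ B ^ 2) (b : ι → ℝ) :
    ∑ η, P η * (∑ x, b x * M η x) ^ 2 ≤ B ^ 2 * ∑ x, b x ^ 2 := by
  have h1 : ∑ η, P η * (∑ x, b x * M η x) ^ 2
      = ∑ x, ∑ y, b x * b y * ∑ η, P η * (M η x * M η y) := by
    have h2 : ∀ η, P η * (∑ x, b x * M η x) ^ 2
        = ∑ x, ∑ y, b x * b y * (P η * (M η x * M η y)) := by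
      intro η
      rw [sq, Finset.sum_mul_sum]
      simp only [Finset.mul_sum]
      exact Finset.sum_congr rfl fun x _ => Finset.sum_congr rfl fun y _ => by ring
    simp only [h2]
    rw [Finset.sum_comm]
    refine Finset.sum_congr rfl fun x _ => ?_
    rw [Finset.sum_comm]
    simp only [Finset.mul_sum]
  rw [h1, Finset.mul_sum]
  refine Finset.sum_le_sum fun x _ => ?_
  rw [Finset.sum_eq_single x]
  · have := hM2 x
    simp only [sq] at this ⊢
    nlinarith [mul_self_nonneg (b x)]
  · intro y _ hy
    rw [hM x y hy.symm, mul_zero]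
  · simp

section EntropyBounds

variable {ι S : Type*} [Fintype ι] [DecidableEq ι] [Fintype S] {B : ℝ} {ν w : ι → S → ℝ}
  {μ : (ι → S) → ℝ}

theorem relEnt_prod_nonneg (hν : ∀ i s, 0 < ν i s) (hνs : ∀ i, ∑ s, ν i s = 1)
    (hμ : ∀ η, 0 < μ η) (hμs : ∑ η, μ η = 1) : 0 ≤ relEnt μ fun η => ∏ i, ν i (η i) := by
  obtain ⟨m, h, -⟩ := exists_doob 1 ν (fun _ _ => 0) hν hνs (by simp) (by simp) μ hμ hμs
  have : 0 ≤ ∑ η, μ η * ∑ i, m η i ^ 2 := Finset.sum_nonneg fun η _ =>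
    mul_nonneg (hμ η).le (Finset.sum_nonneg fun i _ => sq_nonneg _)
  linarith

/-- Entropy bound for linear statistics. -/
theorem entropy_linear (hν : ∀ i s, 0 < ν i s) (hνs : ∀ i, ∑ s, ν i s = 1)
    (hw0 : ∀ i, ∑ s, ν i s * w i s = 0) (hwB : ∀ i s, |w i s| ≤ B)
    (hμ : ∀ η, 0 < μ η) (hμs : ∑ η, μ η = 1) (e : ι → ℝ) :
    ∑ η, μ η * ∑ x, e x * w x (η x) ≤
      4 * B ^ 2 * (relEnt μ fun η => ∏ i, ν i (η i)) + ∑ x, e x ^ 2 := by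
  obtain ⟨m, h1, h2, -, -⟩ := exists_doob B ν w hν hνs hw0 hwB μ hμ hμs
  have h3 : ∑ η, μ η * ∑ x, e x * w x (η x) = ∑ η, μ η * ∑ x, e x * m η x := by
    rw [← sub_eq_zero, ← Finset.sum_sub_distrib]
    have : ∀ η, μ η * ∑ x, e x * w x (η x) - μ η * ∑ x, e x * m η x
        = ∑ x, e x * (μ η * (w x (η x) - m η x)) := by
      intro η
      rw [← mul_sub, ← Finset.sum_sub_distrib, Finset.mul_sum]
      exact Finset.sum_congr rfl fun x _ => by ring
    simp only [this]
    rw [Finset.sum_comm]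
    simp only [← Finset.mul_sum, h2, mul_zero, Finset.sum_const_zero]
  rw [h3]
  calc ∑ η, μ η * ∑ x, e x * m η x ≤ ∑ η, μ η * (∑ x, m η x ^ 2 + ∑ x, e x ^ 2) := by
        refine Finset.sum_le_sum fun η _ => mul_le_mul_of_nonneg_left ?_ (hμ η).le
        rw [← Finset.sum_add_distrib]
        refine Finset.sum_le_sum fun x _ => ?_
        nlinarith [sq_nonneg (e x - m η x), sq_nonneg (e x), sq_nonneg (m η x)]
    _ = ∑ η, μ η * ∑ x, m η x ^ 2 + ∑ x, e x ^ 2 := by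
        simp only [mul_add, Finset.sum_add_distrib]
        rw [← Finset.sum_mul, hμs, one_mul]
    _ ≤ _ := by linarith

/-- Entropy bound for sums of squares of linear statistics. -/
theorem entropy_squares {κ : Type*} [Fintype κ]
    (hν : ∀ i s, 0 < ν i s) (hνs : ∀ i, ∑ s, ν i s = 1)
    (hw0 : ∀ i, ∑ s, ν i s * w i s = 0) (hwB : ∀ i s, |w i s| ≤ B)
    (hμ : ∀ η, 0 < μ η) (hμs : ∑ η, μ η = 1) (A : κ → ι → ℝ) (r c : ℝ)
    (hr : ∀ y, ∑ x, |A y x| ≤ r) (hc : ∀ x, ∑ y, |A y x| ≤ c) (hr0 : 0 ≤ r) (hc0 : 0 ≤ c) :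
    ∑ η, μ η * ∑ y, (∑ x, A y x * w x (η x)) ^ 2 ≤
      8 * B ^ 2 * (r * c * relEnt μ fun η => ∏ i, ν i (η i)) +
      2 * B ^ 2 * ∑ y, ∑ x, A y x ^ 2 := by
  obtain ⟨m, h1, -, h3, h4⟩ := exists_doob B ν w hν hνs hw0 hwB μ hμ hμs
  have hsplit : ∀ η, ∑ y, (∑ x, A y x * w x (η x)) ^ 2 ≤
      2 * (r * c * ∑ x, m η x ^ 2) + 2 * ∑ y, (∑ x, A y x * (w x (η x) - m η x)) ^ 2 := by
    intro η
    have e1 := schur_sq A r c (m η) hr hc hr0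
    have e2 : ∑ y, (∑ x, A y x * w x (η x)) ^ 2 ≤
        ∑ y, (2 * (∑ x, A y x * m η x) ^ 2 + 2 * (∑ x, A y x * (w x (η x) - m η x)) ^ 2) := by
      refine Finset.sum_le_sum fun y _ => ?_
      have : ∑ x, A y x * w x (η x) =
          ∑ x, A y x * m η x + ∑ x, A y x * (w x (η x) - m η x) := by
        rw [← Finset.sum_add_distrib]; exact Finset.sum_congr rfl fun x _ => by ring
      rw [this]
      nlinarith [sq_nonneg (∑ x, A y x * m η x - ∑ x, A y x * (w x (η x) - m η x))]
    rw [Finset.sum_add_distrib, ← Finset.mul_sum, ← Finset.mul_sum] at e2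
    linarith
  have hM : ∑ η, μ η * ∑ y, (∑ x, A y x * (w x (η x) - m η x)) ^ 2 ≤
      B ^ 2 * ∑ y, ∑ x, A y x ^ 2 := by
    simp only [Finset.mul_sum _ _ (μ _)]
    rw [Finset.sum_comm, Finset.mul_sum]
    exact Finset.sum_le_sum fun y _ =>
      sum_sq_orthogonal μ (fun η x => w x (η x) - m η x) h3 h4 (A y)
  calc _ ≤ ∑ η, μ η * (2 * (r * c * ∑ x, m η x ^ 2) +
        2 * ∑ y, (∑ x, A y x * (w x (η x) - m η x)) ^ 2) :=
        Finset.sum_le_sum fun η _ => mul_le_mul_of_nonneg_left (hsplit η) (hμ η).le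
    _ = 2 * (r * c) * (∑ η, μ η * ∑ x, m η x ^ 2) +
        2 * ∑ η, μ η * ∑ y, (∑ x, A y x * (w x (η x) - m η x)) ^ 2 := by
        rw [Finset.mul_sum, Finset.mul_sum, ← Finset.sum_add_distrib]
        exact Finset.sum_congr rfl fun η _ => by ring
    _ ≤ 2 * (r * c) * (4 * B ^ 2 * relEnt μ fun η => ∏ i, ν i (η i)) +
        2 * (B ^ 2 * ∑ y, ∑ x, A y x ^ 2) := by gcongr
    _ = _ := by ring

/-- Entropy bound for quadratic forms vanishing on the diagonal. -/
theorem entropy_offDiag (hν : ∀ i s, 0 < ν i s) (hνs : ∀ i, ∑ s, ν i s = 1)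
    (hw0 : ∀ i, ∑ s, ν i s * w i s = 0) (hwB : ∀ i s, |w i s| ≤ B)
    (hμ : ∀ η, 0 < μ η) (hμs : ∑ η, μ η = 1) (q : ι → ι → ℝ) (r : ℝ) (hq : ∀ x, q x x = 0)
    (hr : ∀ x, ∑ y, |q x y| ≤ r) (hc : ∀ y, ∑ x, |q x y| ≤ r) (hr0 : 0 ≤ r) :
    ∑ η, μ η * ∑ x, ∑ y, q x y * (w x (η x) * w y (η y)) ≤
      4 * B ^ 2 * ((r + 1) * relEnt μ fun η => ∏ i, ν i (η i)) +
      B ^ 2 * ∑ x, ∑ y, q x y ^ 2 := by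
  obtain ⟨m, h1, -, h3, h4⟩ := exists_doob B ν w hν hνs hw0 hwB μ hμ hμs
  set M : (ι → S) → ι → ℝ := fun η x => w x (η x) - m η x with hMdef
  have hexp : ∀ η, ∑ x, ∑ y, q x y * (w x (η x) * w y (η y)) =
      ∑ x, ∑ y, q x y * (m η x * m η y) + ∑ x, m η x * ∑ y, q x y * M η y
      + ∑ y, m η y * ∑ x, q x y * M η x + ∑ x, ∑ y, q x y * (M η x * M η y) := by
    intro η
    have : ∑ y, m η y * ∑ x, q x y * M η x = ∑ x, ∑ y, m η y * (q x y * M η x) := by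
      rw [Finset.sum_comm]; simp only [Finset.mul_sum]
    rw [this]
    simp only [Finset.mul_sum, ← Finset.sum_add_distrib]
    refine Finset.sum_congr rfl fun x _ => Finset.sum_congr rfl fun y _ => ?_
    simp only [hMdef]; ring
  have hcross : ∑ η, μ η * ∑ x, ∑ y, q x y * (M η x * M η y) = 0 := by
    have : ∀ η, μ η * ∑ x, ∑ y, q x y * (M η x * M η y) =
        ∑ x, ∑ y, q x y * (μ η * (M η x * M η y)) := by
      intro η
      simp only [Finset.mul_sum]
      exact Finset.sum_congr rfl fun x _ => Finset.sum_congr rfl fun y _ => by ring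
    simp only [this]
    rw [Finset.sum_comm]
    refine Finset.sum_eq_zero fun x _ => ?_
    rw [Finset.sum_comm]
    refine Finset.sum_eq_zero fun y _ => ?_
    rw [← Finset.mul_sum]
    by_cases hxy : x = y
    · rw [hxy, hq, zero_mul]
    · rw [h3 x y hxy, mul_zero]
  have hsq1 : ∑ η, μ η * ∑ x, (∑ y, q x y * M η y) ^ 2 ≤ B ^ 2 * ∑ x, ∑ y, q x y ^ 2 := by
    simp only [Finset.mul_sum _ _ (μ _)]
    rw [Finset.sum_comm, Finset.mul_sum]
    exact Finset.sum_le_sum fun x _ => sum_sq_orthogonal μ M h3 h4 (q x)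
  have hsq2 : ∑ η, μ η * ∑ y, (∑ x, q x y * M η x) ^ 2 ≤ B ^ 2 * ∑ x, ∑ y, q x y ^ 2 := by
    simp only [Finset.mul_sum _ _ (μ _)]
    rw [Finset.sum_comm, Finset.sum_comm (f := fun x y => q x y ^ 2), Finset.mul_sum]
    exact Finset.sum_le_sum fun y _ => sum_sq_orthogonal μ M h3 h4 (fun x => q x y)
  have hyoung : ∀ a b : ℝ, a * b ≤ a ^ 2 / 2 + b ^ 2 / 2 := fun a b => by
    nlinarith [sq_nonneg (a - b)]
  have hpt : ∀ η, ∑ x, ∑ y, q x y * (w x (η x) * w y (η y)) ≤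
      (r + 1) * ∑ x, m η x ^ 2 + (∑ x, (∑ y, q x y * M η y) ^ 2) / 2 +
      (∑ y, (∑ x, q x y * M η x) ^ 2) / 2 + ∑ x, ∑ y, q x y * (M η x * M η y) := by
    intro η
    rw [hexp]
    have e1 := schur_form q r r (m η) hr hc
    have e2 := Finset.sum_le_sum fun x (_ : x ∈ Finset.univ) =>
      hyoung (m η x) (∑ y, q x y * M η y)
    have e3 := Finset.sum_le_sum fun y (_ : y ∈ Finset.univ) =>
      hyoung (m η y) (∑ x, q x y * M η x)
    rw [Finset.sum_add_distrib, ← Finset.sum_div, ← Finset.sum_div] at e2 e3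
    linarith
  calc _ ≤ ∑ η, μ η * ((r + 1) * ∑ x, m η x ^ 2 + (∑ x, (∑ y, q x y * M η y) ^ 2) / 2 +
      (∑ y, (∑ x, q x y * M η x) ^ 2) / 2 + ∑ x, ∑ y, q x y * (M η x * M η y)) :=
        Finset.sum_le_sum fun η _ => mul_le_mul_of_nonneg_left (hpt η) (hμ η).le
    _ = (r + 1) * (∑ η, μ η * ∑ x, m η x ^ 2)
        + (∑ η, μ η * ∑ x, (∑ y, q x y * M η y) ^ 2) / 2
        + (∑ η, μ η * ∑ y, (∑ x, q x y * M η x) ^ 2) / 2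
        + ∑ η, μ η * ∑ x, ∑ y, q x y * (M η x * M η y) := by
        rw [Finset.mul_sum, Finset.sum_div, Finset.sum_div, ← Finset.sum_add_distrib,
          ← Finset.sum_add_distrib, ← Finset.sum_add_distrib]
        exact Finset.sum_congr rfl fun η _ => by ring
    _ ≤ (r + 1) * (4 * B ^ 2 * relEnt μ fun η => ∏ i, ν i (η i))
        + (B ^ 2 * ∑ x, ∑ y, q x y ^ 2) / 2 + (B ^ 2 * ∑ x, ∑ y, q x y ^ 2) / 2 + 0 := by
        rw [hcross]; gcongr
    _ = _ := by ring

end EntropyBounds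

noncomputable section

/-- The unit vector `e_j` of the discrete torus. -/
def unitSite {N d : ℕ} [NeZero N] (j : Fin d) : Site N d := Pi.single j 1

/-- The uniform probability kernel on the box `∏ [0, ℓ_j)`. -/
def boxKer {N d : ℕ} (ℓ : Fin d → ℕ) (z : Site N d) : ℝ :=
  ∏ j, if (z j).val < ℓ j then ((ℓ j : ℝ))⁻¹ else 0

/-- The kernel transporting `boxKer ℓ` to the box doubled in direction `j`. -/
def flowKer {N d : ℕ} [NeZero N] (ℓ : Fin d → ℕ) (j : Fin d) (z : Site N d) : ℝ :=
  2⁻¹ * ∑ i ∈ Finset.range (ℓ j), boxKer ℓ (z - i • unitSite j)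

/-- Side lengths of the box of side `2^k` doubled in the first `t` directions. -/
def boxSide (d k t : ℕ) (i : Fin d) : ℕ := if i.val < t then 2 ^ (k + 1) else 2 ^ k

end

theorem siteMove_true {N d : ℕ} [NeZero N] (x : Site N d) (i : Fin d) :
    siteMove x i true = x + unitSite i := by
  funext j
  unfold siteMove unitSite
  by_cases h : j = i
  · subst h
    simp only [Function.update_self, if_true, Pi.add_apply, Pi.single_eq_same, finCycAdd]
    ext
    simp [Fin.val_add, Nat.add_mod]
  · simp [h]

theorem siteMove_false {N d : ℕ} [NeZero N] (x : Site N d) (i : Fin d) :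
    siteMove x i false = x - unitSite i := by
  rw [eq_sub_iff_add_eq]
  funext j
  unfold siteMove unitSite
  by_cases h : j = i
  · subst h
    have hN := Nat.pos_of_ne_zero (NeZero.ne N)
    simp only [Function.update_self, if_false, Pi.add_apply, Pi.single_eq_same, finCycSub,
      Bool.false_eq_true]
    ext
    have h1 : (x j).val + (N - 1) + 1 = (x j).val + N := by omega
    simp only [Fin.val_add, Fin.val_one', Nat.mod_add_mod, Nat.add_mod_mod]
    rw [h1, Nat.add_mod_right, Nat.mod_eq_of_lt (x j).isLt]
  · simp [h]

section Box

variable {N d : ℕ} {ℓ : Fin d → ℕ}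

theorem boxKer_nonneg (z : Site N d) : 0 ≤ boxKer ℓ z :=
  Finset.prod_nonneg fun j _ => by split_ifs <;> positivity

theorem boxKer_le (z : Site N d) : boxKer ℓ z ≤ ∏ j, ((ℓ j : ℝ))⁻¹ :=
  Finset.prod_le_prod (fun j _ => by split_ifs <;> positivity)
    (fun j _ => by split_ifs <;> first | exact le_rfl | positivity)

theorem val_lt_of_boxKer_ne_zero {z : Site N d} (h : boxKer ℓ z ≠ 0) (j : Fin d) :
    (z j).val < ℓ j := by
  by_contra hj
  exact h (Finset.prod_eq_zero (Finset.mem_univ j) (by simp [hj]))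

theorem sum_boxKer (h0 : ∀ j, 0 < ℓ j) (hN : ∀ j, ℓ j ≤ N) : ∑ z : Site N d, boxKer ℓ z = 1 := by
  unfold boxKer
  have h := Finset.prod_univ_sum (fun _ : Fin d => (Finset.univ : Finset (Fin N)))
    (fun j c => if c.val < ℓ j then ((ℓ j : ℝ))⁻¹ else 0)
  rw [Fintype.piFinset_univ] at h
  rw [← h]
  refine Finset.prod_eq_one fun j _ => ?_
  rw [← Finset.sum_filter, Finset.sum_const, Fin.card_filter_val_lt, min_eq_right (hN j),
    nsmul_eq_mul]
  exact mul_inv_cancel₀ (by exact_mod_cast (h0 j).ne')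

theorem boxKer_one [NeZero N] (z : Site N d) :
    boxKer (fun _ => 1) z = if z = 0 then 1 else 0 := by
  unfold boxKer
  split_ifs with h
  · subst h; simp
  · obtain ⟨j, hj⟩ := Function.ne_iff.1 h
    refine Finset.prod_eq_zero (Finset.mem_univ j) ?_
    have : ¬ (z j).val < 1 := by
      intro hlt
      apply hj
      ext
      simpa using hlt
    simp [this]

theorem nsmul_unitSite_apply [NeZero N] (n : ℕ) (j i : Fin d) :
    (n • (unitSite j : Site N d)) i = if i = j then Fin.ofNat N n else 0 := by
  unfold unitSite
  by_cases h : i = j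
  · subst h
    simp only [Pi.smul_apply, Pi.single_eq_same, if_true]
    induction n with
    | zero => simp
    | succ n ih =>
      rw [succ_nsmul, ih]
      ext
      simp [Fin.val_add, Fin.ofNat]
  · simp [h]

theorem fin_sub_val_lt_iff [NeZero N] (n : ℕ) (hn : 2 * n ≤ N) (c : Fin N) (h : n ≤ c.val) :
    (c - Fin.ofNat N n).val < n ↔ c.val < 2 * n := by
  have hc := c.isLt
  rcases Nat.eq_zero_or_pos n with rfl | hn0
  · simp
  have hv : (Fin.ofNat N n).val = n := Nat.mod_eq_of_lt (by omega)
  have : (c - Fin.ofNat N n).val = c.val - n := by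
    rw [Fin.sub_val_of_le (by rw [Fin.le_def, hv]; exact h), hv]
  omega

theorem fin_sub_val_not_lt [NeZero N] (n : ℕ) (hn : 2 * n ≤ N) (c : Fin N) (h : c.val < n) :
    ¬ (c - Fin.ofNat N n).val < n := by
  have hv : (Fin.ofNat N n).val = n := Nat.mod_eq_of_lt (by omega)
  rw [Fin.sub_def]
  simp only [hv]
  rw [Nat.mod_eq_of_lt (by omega)]
  omega

theorem boxKer_double [NeZero N] (j : Fin d) (h0 : 0 < ℓ j) (hN : 2 * ℓ j ≤ N) (z : Site N d) :
    boxKer (Function.update ℓ j (2 * ℓ j)) z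
      = 2⁻¹ * (boxKer ℓ z + boxKer ℓ (z - ℓ j • unitSite j)) := by
  unfold boxKer
  rw [← Finset.mul_prod_erase _ _ (Finset.mem_univ j),
    ← Finset.mul_prod_erase _ (fun i => if (z i).val < ℓ i then ((ℓ i : ℝ))⁻¹ else 0)
      (Finset.mem_univ j),
    ← Finset.mul_prod_erase _ (fun i => if ((z - ℓ j • (unitSite j : Site N d)) i).val < ℓ i then
      ((ℓ i : ℝ))⁻¹ else 0) (Finset.mem_univ j)]
  have e1 : ∏ i ∈ Finset.univ.erase j, (if (z i).val < Function.update ℓ j (2 * ℓ j) i then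
      ((Function.update ℓ j (2 * ℓ j) i : ℕ) : ℝ)⁻¹ else 0) =
      ∏ i ∈ Finset.univ.erase j, (if (z i).val < ℓ i then ((ℓ i : ℝ))⁻¹ else 0) := by
    refine Finset.prod_congr rfl fun i hi => ?_
    rw [Function.update_of_ne (Finset.ne_of_mem_erase hi)]
  have e2 : ∏ i ∈ Finset.univ.erase j, (if ((z - ℓ j • (unitSite j : Site N d)) i).val < ℓ i then
      ((ℓ i : ℝ))⁻¹ else 0) =
      ∏ i ∈ Finset.univ.erase j, (if (z i).val < ℓ i then ((ℓ i : ℝ))⁻¹ else 0) := by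
    refine Finset.prod_congr rfl fun i hi => ?_
    rw [Pi.sub_apply, nsmul_unitSite_apply, if_neg (Finset.ne_of_mem_erase hi), sub_zero]
  rw [e1, e2, ← add_mul, ← mul_assoc]
  congr 1
  rw [Function.update_self, Pi.sub_apply, nsmul_unitSite_apply, if_pos rfl]
  have h0' : (ℓ j : ℝ) ≠ 0 := by exact_mod_cast h0.ne'
  by_cases h : (z j).val < ℓ j
  · rw [if_pos (by omega), if_pos h, if_neg (fin_sub_val_not_lt _ hN _ h)]
    push_cast; field_simp; ring
  · rw [if_neg h]
    have := fin_sub_val_lt_iff _ hN (z j) (not_lt.1 h)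
    by_cases h2 : (z j).val < 2 * ℓ j
    · rw [if_pos h2, if_pos (this.2 h2)]
      push_cast; field_simp; ring
    · rw [if_neg h2, if_neg (fun h3 => h2 (this.1 h3))]; simp

variable [NeZero N]

theorem flowKer_nonneg (j : Fin d) (z : Site N d) : 0 ≤ flowKer ℓ j z :=
  mul_nonneg (by norm_num) (Finset.sum_nonneg fun _ _ => boxKer_nonneg _)

theorem sum_flowKer (h0 : ∀ j, 0 < ℓ j) (hN : ∀ j, ℓ j ≤ N) (j : Fin d) :
    ∑ z : Site N d, flowKer ℓ j z = ℓ j / 2 := by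
  unfold flowKer
  rw [← Finset.mul_sum, Finset.sum_comm]
  have : ∀ i ∈ Finset.range (ℓ j), ∑ z : Site N d, boxKer ℓ (z - i • unitSite j) = 1 := by
    intro i _
    rw [← sum_boxKer (N := N) h0 hN]
    exact (Equiv.subRight (i • unitSite j)).sum_comp (boxKer ℓ)
  rw [Finset.sum_congr rfl this]
  simp; ring

theorem flowKer_le (j : Fin d) (z : Site N d) :
    flowKer ℓ j z ≤ ℓ j / 2 * ∏ i, ((ℓ i : ℝ))⁻¹ := by
  unfold flowKer
  have : ∑ i ∈ Finset.range (ℓ j), boxKer ℓ (z - i • unitSite j) ≤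
      ∑ i ∈ Finset.range (ℓ j), ∏ i, ((ℓ i : ℝ))⁻¹ := Finset.sum_le_sum fun i _ => boxKer_le _
  rw [Finset.sum_const, Finset.card_range, nsmul_eq_mul] at this
  linarith

theorem val_lt_of_flowKer_ne_zero {j : Fin d} {z : Site N d} (h : flowKer ℓ j z ≠ 0) (i : Fin d) :
    (z i).val < 2 * ℓ i := by
  have h1 := right_ne_zero_of_mul h
  obtain ⟨a, ha, hb⟩ := Finset.exists_ne_zero_of_sum_ne_zero h1
  have h2 := val_lt_of_boxKer_ne_zero hb i
  rw [Pi.sub_apply, nsmul_unitSite_apply] at h2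
  split_ifs at h2 with hij
  · subst hij
    have h3 : (z i).val = ((z i - Fin.ofNat N a).val + (Fin.ofNat N a).val) % N := by
      rw [← Fin.val_add, sub_add_cancel]
    have h4 : (Fin.ofNat N a).val ≤ a := Nat.mod_le _ _
    have h5 := Nat.mod_le ((z i - Fin.ofNat N a).val + (Fin.ofNat N a).val) N
    have := Finset.mem_range.1 ha
    omega
  · rw [sub_zero] at h2; omega

theorem boxKer_sub_double (j : Fin d) (h0 : 0 < ℓ j) (hN : 2 * ℓ j ≤ N) (ω : Site N d → ℝ) :
    ∑ z, boxKer ℓ z * ω z = ∑ z, boxKer (Function.update ℓ j (2 * ℓ j)) z * ω z +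
      ∑ z, flowKer ℓ j z * (ω z - ω (z + unitSite j)) := by
  have hk : ∀ z : Site N d, boxKer ℓ z - boxKer (Function.update ℓ j (2 * ℓ j)) z =
      flowKer ℓ j z - flowKer ℓ j (z - unitSite j) := by
    intro z
    rw [boxKer_double j h0 hN]
    unfold flowKer
    have h1 : ∀ i : ℕ, z - unitSite j - i • unitSite j = z - (i + 1) • (unitSite j : Site N d) := by
      intro i; rw [add_smul, one_smul]; abel
    simp only [h1]
    rw [← mul_sub, ← Finset.sum_sub_distrib,
      Finset.sum_range_sub' (fun i => boxKer ℓ (z - i • (unitSite j : Site N d)))]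
    simp; ring
  have h2 : ∑ z, flowKer ℓ j z * ω (z + unitSite j) = ∑ z, flowKer ℓ j (z - unitSite j) * ω z := by
    rw [← Equiv.sum_comp (Equiv.addRight (unitSite j : Site N d))
      (fun z => flowKer ℓ j (z - unitSite j) * ω z)]
    simp
  simp only [mul_sub, Finset.sum_sub_distrib]
  rw [h2, ← sub_eq_iff_eq_add', ← Finset.sum_sub_distrib, ← Finset.sum_sub_distrib]
  exact Finset.sum_congr rfl fun z _ => by rw [← sub_mul, ← sub_mul, hk]

end Box

section Scales

variable {N d : ℕ}

theorem boxSide_pos (k t : ℕ) (i : Fin d) : 0 < boxSide d k t i := by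
  unfold boxSide; split_ifs <;> positivity

theorem boxSide_le (k t : ℕ) (i : Fin d) : boxSide d k t i ≤ 2 ^ (k + 1) := by
  unfold boxSide; split_ifs
  · exact le_rfl
  · exact Nat.pow_le_pow_right (by norm_num) (by omega)

theorem le_boxSide (k t : ℕ) (i : Fin d) : 2 ^ k ≤ boxSide d k t i := by
  unfold boxSide; split_ifs
  · exact Nat.pow_le_pow_right (by norm_num) (by omega)
  · exact le_rfl

theorem boxSide_self (k : ℕ) (j : Fin d) : boxSide d k j j = 2 ^ k := by
  simp [boxSide]

theorem update_boxSide (k : ℕ) (j : Fin d) :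
    Function.update (boxSide d k j) j (2 * boxSide d k j j) = boxSide d k (j + 1) := by
  funext i
  by_cases h : i = j
  · subst h; simp [boxSide, pow_succ, mul_comm]
  · rw [Function.update_of_ne h]
    have : i.val ≠ j.val := fun h' => h (Fin.ext h')
    unfold boxSide
    congr 1
    simp only [eq_iff_iff]; omega

variable [NeZero N]

theorem boxKer_scale (k : ℕ) (hN : 2 ^ (k + 1) ≤ N) (ω : Site N d → ℝ) :
    ∑ z, boxKer (fun _ => 2 ^ k) z * ω z = ∑ z, boxKer (fun _ => 2 ^ (k + 1)) z * ω z +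
      ∑ j : Fin d, ∑ z, flowKer (boxSide d k j) j z * (ω z - ω (z + unitSite j)) := by
  set g : ℕ → ℝ := fun t => ∑ z : Site N d, boxKer (boxSide d k t) z * ω z with hg
  have h0 : g 0 = ∑ z, boxKer (fun _ => 2 ^ k) z * ω z := by
    simp only [hg]; congr!
  have h1 : g d = ∑ z, boxKer (fun _ => 2 ^ (k + 1)) z * ω z := by
    simp only [hg]; congr! with z _ i; simp [boxSide]
  have hstep : ∀ j : Fin d, ∑ z, flowKer (boxSide d k j) j z * (ω z - ω (z + unitSite j)) =
      g j - g (j + 1) := by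
    intro j
    have := boxKer_sub_double (N := N) (ℓ := boxSide d k j) j (boxSide_pos _ _ _)
      (by rw [boxSide_self, ← pow_succ']; exact hN) ω
    rw [update_boxSide] at this
    simp only [hg]; linarith
  rw [← h0, ← h1]
  simp only [hstep]
  rw [Fin.sum_univ_eq_sum_range (fun t => g t - g (t + 1)) d, Finset.sum_range_sub']
  ring

/-- Multiscale decomposition of the evaluation at the origin as a box average plus gradients. -/
theorem box_chain (L : ℕ) (hN : 2 ^ L ≤ N) (ω : Site N d → ℝ) :
    ω 0 = ∑ z, boxKer (fun _ => 2 ^ L) z * ω z + ∑ k ∈ Finset.range L,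
      ∑ j : Fin d, ∑ z, flowKer (boxSide d k j) j z * (ω z - ω (z + unitSite j)) := by
  induction L with
  | zero => simp [boxKer_one]
  | succ L ih =>
    rw [Finset.sum_range_succ,
      ih (le_trans (Nat.pow_le_pow_right (by norm_num) (Nat.le_succ L)) hN), boxKer_scale L hN]
    ring

theorem scaleFlow_le (k : ℕ) (j : Fin d) (z : Site N d) :
    flowKer (boxSide d k j) j z ≤ 2 ^ k / 2 * ((2 : ℝ) ^ (k * d))⁻¹ := by
  refine (flowKer_le j z).trans ?_
  rw [boxSide_self]
  push_cast
  refine mul_le_mul_of_nonneg_left ?_ (by positivity)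
  calc ∏ i, ((boxSide d k j i : ℝ))⁻¹ ≤ ∏ _i : Fin d, ((2 : ℝ) ^ k)⁻¹ := by
        refine Finset.prod_le_prod (fun i _ => by positivity) fun i _ => ?_
        refine inv_anti₀ (by positivity) ?_
        exact_mod_cast le_boxSide k j i
    _ = _ := by simp [pow_mul]

theorem sum_scaleFlow (k : ℕ) (hN : 2 ^ (k + 1) ≤ N) (j : Fin d) :
    ∑ z : Site N d, flowKer (boxSide d k j) j z = 2 ^ k / 2 := by
  rw [sum_flowKer (boxSide_pos k j) (fun i => (boxSide_le k j i).trans hN), boxSide_self]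
  push_cast; ring

theorem add_unitSite_ne_zero {z : Site N d} (i : Fin d) (h : (z i).val + 1 < N) :
    z + unitSite i ≠ 0 := by
  intro h0
  have h1 := congrArg (fun y => (y i).val) h0
  simp only [unitSite, Pi.add_apply, Pi.single_eq_same, Pi.zero_apply, Fin.val_add, Fin.val_one',
    Nat.add_mod_mod, Fin.val_zero] at h1
  rw [Nat.mod_eq_of_lt h] at h1
  omega

theorem add_unitSite_val_le (z : Site N d) (i j : Fin d) :
    ((z + unitSite j : Site N d) i).val ≤ (z i).val + 1 := by
  by_cases h : i = j
  · subst h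
    simp only [unitSite, Pi.add_apply, Pi.single_eq_same, Fin.val_add, Fin.val_one',
      Nat.add_mod_mod]
    exact Nat.mod_le _ _
  · simp [unitSite, h]

end Scales

noncomputable section

/-- The normalized fluctuation `(k − ϱ) / (ϱ (K − ϱ))` of an occupation number. -/
def fluct (K : ℕ) (ϱ : ℝ) (k : Fin (K + 1)) : ℝ := ((k.val : ℝ) - ϱ) / (ϱ * (K - ϱ))

/-- The exchange rate `η_x (K − η_y)` of an ordered pair of sites. -/
def pairRate {N d K : ℕ} (η : GCfg N d K) (x y : Site N d) : ℝ :=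
  ((η x).val : ℝ) * ((K : ℝ) - ((η y).val : ℝ))

end

section Binomial

variable {K : ℕ} {ϱ : ℝ}

theorem binomW_pos (h0 : 0 < ϱ) (h1 : ϱ < K) {k : ℕ} (hk : k ≤ K) : 0 < binomW K ϱ k := by
  unfold binomW
  have hK : (0 : ℝ) < K := h0.trans h1
  have h2 : 0 < 1 - ϱ / K := by rw [sub_pos, div_lt_one hK]; exact h1
  have h3 : (0 : ℝ) < (K.choose k : ℝ) := by exact_mod_cast Nat.choose_pos hk
  positivity

theorem binomW_succ (h1 : ϱ < K) (h0 : 0 < ϱ) {k : ℕ} (hk : k < K) :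
    binomW K ϱ (k + 1) * (k + 1) * (K - ϱ) = binomW K ϱ k * (K - k) * ϱ := by
  unfold binomW
  have hK : (K : ℝ) ≠ 0 := (h0.trans h1).ne'
  have h2 : ((K.choose (k + 1) : ℕ) : ℝ) * (k + 1) = K.choose k * (K - k) := by
    have := Nat.choose_succ_right_eq K k
    have h3 : ((K.choose (k + 1) * (k + 1) : ℕ) : ℝ) = (K.choose k * (K - k) : ℕ) := by rw [this]
    push_cast [Nat.cast_sub hk.le] at h3
    exact h3
  have h4 : K - k = (K - (k + 1)) + 1 := by omega
  rw [h4, pow_succ, pow_succ]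
  have h5 : (K : ℝ) - ϱ = K * (1 - ϱ / K) := by field_simp
  have h6 : ϱ / K * K = ϱ := by field_simp
  rw [h5]
  generalize (1 - ϱ / (K : ℝ)) ^ (K - (k + 1)) = P
  linear_combination ((ϱ / K) ^ k * (ϱ / K) * P * K * (1 - ϱ / K)) * h2 +
    ((ϱ / K) ^ k * P * (1 - ϱ / K) * (K.choose k) * (K - k)) * h6

theorem sum_binomW : ∑ k : Fin (K + 1), binomW K ϱ k.val = 1 := by
  rw [Fin.sum_univ_eq_sum_range (fun k => binomW K ϱ k) (K + 1)]
  have h := add_pow (ϱ / K) (1 - ϱ / K) K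
  rw [add_sub_cancel, one_pow] at h
  rw [h]
  refine Finset.sum_congr rfl fun k _ => ?_
  unfold binomW; ring

theorem sum_binomW_fluct (h0 : 0 < ϱ) (h1 : ϱ < K) :
    ∑ k : Fin (K + 1), binomW K ϱ k.val * fluct K ϱ k = 0 := by
  have hK : (0 : ℝ) < K := h0.trans h1
  have hs := sum_binomW (K := K) (ϱ := ϱ)
  set M := ∑ k ∈ Finset.range (K + 1), binomW K ϱ k * k with hM
  rw [Fin.sum_univ_eq_sum_range (fun k => binomW K ϱ k) (K + 1)] at hs
  have hrec : M * (K - ϱ) = (K - M) * ϱ := by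
    have e1 : M * (K - ϱ) = ∑ k ∈ Finset.range K, binomW K ϱ k * (K - k) * ϱ := by
      rw [hM, Finset.sum_range_succ']
      simp only [Nat.cast_zero, mul_zero, add_zero, Finset.sum_mul]
      refine Finset.sum_congr rfl fun k hk => ?_
      rw [← binomW_succ h1 h0 (Finset.mem_range.1 hk)]
      push_cast; ring
    have e2 : (K - M) * ϱ = ∑ k ∈ Finset.range (K + 1), binomW K ϱ k * (K - k) * ϱ := by
      rw [← Finset.sum_mul]
      congr 1
      simp only [mul_sub, Finset.sum_sub_distrib, ← Finset.sum_mul]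
      rw [hs, one_mul]
    rw [e1, e2, Finset.sum_range_succ]
    simp
  have hMϱ : M = ϱ := by
    have : K * (M - ϱ) = 0 := by linear_combination hrec
    rcases mul_eq_zero.1 this with h | h
    · exact absurd h hK.ne'
    · linarith
  have : ∀ k : Fin (K + 1), binomW K ϱ k.val * fluct K ϱ k =
      (binomW K ϱ k.val * k.val - binomW K ϱ k.val * ϱ) / (ϱ * (K - ϱ)) := fun k => by
    unfold fluct; ring
  simp only [this]
  rw [← Finset.sum_div, Fin.sum_univ_eq_sum_range
    (fun k => binomW K ϱ k * (k : ℝ) - binomW K ϱ k * ϱ) (K + 1), Finset.sum_sub_distrib,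
    ← Finset.sum_mul, hs, ← hM, hMϱ]
  simp

theorem abs_fluct_le {r : ℝ} (hr : 0 < r) (h0 : r ≤ ϱ) (h1 : ϱ ≤ K - r) (k : Fin (K + 1)) :
    |fluct K ϱ k| ≤ K / r ^ 2 := by
  unfold fluct
  have hk : (k.val : ℝ) ≤ K := by exact_mod_cast Nat.lt_succ_iff.1 k.isLt
  have hk0 : (0 : ℝ) ≤ k.val := Nat.cast_nonneg _
  have h2 : r ^ 2 ≤ ϱ * (K - ϱ) := by nlinarith
  rw [abs_div, abs_of_pos (a := ϱ * (K - ϱ)) (by nlinarith [sq_pos_of_pos hr])]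
  refine div_le_div₀ (by linarith) ?_ (by positivity) h2
  rw [abs_le]; constructor <;> linarith

end Binomial

section Bond

variable {N d K : ℕ} {ϱ : Site N d → ℝ} {x y : Site N d}

theorem prodBinom_pos (h0 : ∀ x, 0 < ϱ x) (h1 : ∀ x, ϱ x < K) (η : GCfg N d K) :
    0 < prodBinom ϱ η :=
  Finset.prod_pos fun x _ => binomW_pos (h0 x) (h1 x) (Nat.lt_succ_iff.1 (η x).isLt)

theorem prodBinom_pair (hxy : x ≠ y) (η : GCfg N d K) :
    prodBinom ϱ η = binomW K (ϱ x) (η x).val * (binomW K (ϱ y) (η y).val *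
      ∏ z ∈ (Finset.univ.erase x).erase y, binomW K (ϱ z) (η z).val) := by
  unfold prodBinom
  rw [← Finset.mul_prod_erase _ _ (Finset.mem_univ x),
    ← Finset.mul_prod_erase (Finset.univ.erase x) _
      (Finset.mem_erase.2 ⟨hxy.symm, Finset.mem_univ y⟩)]

theorem cfgJump_of_ne {η : GCfg N d K} {z : Site N d} (hx : z ≠ x) (hy : z ≠ y) :
    cfgJump η x y z = η z := by simp [cfgJump, hx, hy]

theorem cfgJump_val_left (η : GCfg N d K) : (cfgJump η x y x).val = (η x).val - 1 := by
  simp [cfgJump]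

theorem cfgJump_val_right (hxy : x ≠ y) {η : GCfg N d K} (h : (η y).val < K) :
    (cfgJump η x y y).val = (η y).val + 1 := by
  simp [cfgJump, hxy.symm]; omega

theorem cfgJump_cfgJump (hxy : x ≠ y) {η : GCfg N d K} (hx : 0 < (η x).val)
    (hy : (η y).val < K) : cfgJump (cfgJump η x y) y x = η := by
  funext z
  ext
  by_cases hzx : z = x
  · subst hzx
    have h1 : (cfgJump η z y z).val < K := by
      rw [cfgJump_val_left]; have := (η z).isLt; omega
    rw [cfgJump_val_right hxy.symm h1, cfgJump_val_left]; omega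
  · by_cases hzy : z = y
    · subst hzy
      rw [cfgJump_val_left, cfgJump_val_right hxy hy]; omega
    · rw [cfgJump_of_ne hzy hzx, cfgJump_of_ne hzx hzy]

theorem prodBinom_cfgJump (h0 : ∀ x, 0 < ϱ x) (h1 : ∀ x, ϱ x < K) (hxy : x ≠ y)
    {η : GCfg N d K} (hx : 0 < (η x).val) (hy : (η y).val < K) :
    prodBinom ϱ η * pairRate η x y = prodBinom ϱ (cfgJump η x y) * pairRate (cfgJump η x y) y x *
      (ϱ x * (K - ϱ y) / (ϱ y * (K - ϱ x))) := by
  rw [prodBinom_pair hxy, prodBinom_pair hxy (cfgJump η x y)]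
  have hP : ∏ z ∈ (Finset.univ.erase x).erase y, binomW K (ϱ z) (cfgJump η x y z).val =
      ∏ z ∈ (Finset.univ.erase x).erase y, binomW K (ϱ z) (η z).val := by
    refine Finset.prod_congr rfl fun z hz => ?_
    simp only [Finset.mem_erase] at hz
    rw [cfgJump_of_ne hz.2.1 hz.1]
  rw [hP]
  unfold pairRate
  rw [cfgJump_val_left, cfgJump_val_right hxy hy]
  obtain ⟨a, ha⟩ : ∃ a, (η x).val = a + 1 := ⟨(η x).val - 1, by omega⟩
  have haK : a < K := by have := (η x).isLt; omega
  rw [ha, Nat.add_sub_cancel]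
  have e1 := binomW_succ (h1 x) (h0 x) haK
  have e2 := binomW_succ (h1 y) (h0 y) hy
  have p1 : ϱ y ≠ 0 := (h0 y).ne'
  have p2 : (K : ℝ) - ϱ x ≠ 0 := (sub_pos.2 (h1 x)).ne'
  generalize ∏ z ∈ (Finset.univ.erase x).erase y, binomW K (ϱ z) (η z).val = P
  push_cast
  rw [mul_div_assoc', eq_div_iff (mul_ne_zero p1 p2)]
  linear_combination (binomW K (ϱ y) (η y).val * P * (K - (η y).val) * ϱ y) * e1
    - (binomW K (ϱ x) a * (K - a) * ϱ x * P) * e2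

/-- Change of variables along a bond for a product of binomial measures. -/
theorem sum_prodBinom_cfgJump (h0 : ∀ x, 0 < ϱ x) (h1 : ∀ x, ϱ x < K) (hxy : x ≠ y)
    (F : GCfg N d K → GCfg N d K → ℝ) :
    ∑ η, prodBinom ϱ η * pairRate η x y * F η (cfgJump η x y) =
      ∑ η, prodBinom ϱ η * pairRate η y x * (ϱ x * (K - ϱ y) / (ϱ y * (K - ϱ x))) *
        F (cfgJump η y x) η := by
  have hne : ∀ (a b : Site N d) (η : GCfg N d K), pairRate η a b ≠ 0 →
      0 < (η a).val ∧ (η b).val < K := by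
    intro a b η h
    unfold pairRate at h
    constructor
    · by_contra h'
      apply h
      have : (η a).val = 0 := by omega
      simp [this]
    · by_contra h'
      apply h
      have : (η b).val = K := by have := (η b).isLt; omega
      simp [this]
  refine Finset.sum_bij_ne_zero (fun η _ _ => cfgJump η x y) (fun _ _ _ => Finset.mem_univ _)
    ?_ ?_ ?_
  · intro a _ ha b _ hb hab
    obtain ⟨a1, a2⟩ := hne _ _ _ (right_ne_zero_of_mul (left_ne_zero_of_mul ha))
    obtain ⟨b1, b2⟩ := hne _ _ _ (right_ne_zero_of_mul (left_ne_zero_of_mul hb))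
    rw [← cfgJump_cfgJump hxy a1 a2, hab, cfgJump_cfgJump hxy b1 b2]
  · intro b _ hb
    obtain ⟨b1, b2⟩ := hne _ _ _
      (right_ne_zero_of_mul (left_ne_zero_of_mul (left_ne_zero_of_mul hb)))
    have hj := cfgJump_cfgJump hxy.symm b1 b2
    have c1 : 0 < (cfgJump b y x x).val := by rw [cfgJump_val_right hxy.symm b2]; omega
    have c2 : (cfgJump b y x y).val < K := by
      rw [cfgJump_val_left]; have := (b y).isLt; omega
    refine ⟨cfgJump b y x, Finset.mem_univ _, ?_, hj⟩
    rw [prodBinom_cfgJump h0 h1 hxy c1 c2, hj]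
    exact hb
  · intro a _ ha
    obtain ⟨a1, a2⟩ := hne _ _ _ (right_ne_zero_of_mul (left_ne_zero_of_mul ha))
    rw [prodBinom_cfgJump h0 h1 hxy a1 a2, cfgJump_cfgJump hxy a1 a2]

theorem pairRate_sub (h0 : ∀ x, 0 < ϱ x) (h1 : ∀ x, ϱ x < K) (η : GCfg N d K) :
    pairRate η y x * (ϱ x * (K - ϱ y) / (ϱ y * (K - ϱ x))) - pairRate η x y =
      K * ϱ x * (K - ϱ y) * ((fluct K (ϱ y) (η y) - fluct K (ϱ x) (η x)) +
        (ϱ y - ϱ x) * (fluct K (ϱ x) (η x) * fluct K (ϱ y) (η y))) := by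
  unfold pairRate fluct
  have a1 := (h0 x).ne'
  have a2 := (h0 y).ne'
  have a3 := (sub_pos.2 (h1 x)).ne'
  have a4 := (sub_pos.2 (h1 y)).ne'
  field_simp
  ring

/-- The adjoint of a single exchange, applied to the constant function, is a first order term
plus a second order term in the normalized fluctuations. -/
theorem sum_exchange (h0 : ∀ x, 0 < ϱ x) (h1 : ∀ x, ϱ x < K) (hxy : x ≠ y) (g : GCfg N d K → ℝ) :
    ∑ η, prodBinom ϱ η * (pairRate η x y * (g (cfgJump η x y) - g η)) =
      ∑ η, prodBinom ϱ η * g η * (K * ϱ x * (K - ϱ y) *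
        ((fluct K (ϱ y) (η y) - fluct K (ϱ x) (η x)) +
        (ϱ y - ϱ x) * (fluct K (ϱ x) (η x) * fluct K (ϱ y) (η y)))) := by
  have h := sum_prodBinom_cfgJump h0 h1 hxy (fun _ η' => g η')
  have e1 : ∑ η, prodBinom ϱ η * (pairRate η x y * (g (cfgJump η x y) - g η)) =
      ∑ η, prodBinom ϱ η * pairRate η x y * g (cfgJump η x y) -
      ∑ η, prodBinom ϱ η * pairRate η x y * g η := by
    rw [← Finset.sum_sub_distrib]
    exact Finset.sum_congr rfl fun η _ => by ring
  rw [e1, h, ← Finset.sum_sub_distrib]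
  refine Finset.sum_congr rfl fun η _ => ?_
  rw [← pairRate_sub h0 h1]
  ring

theorem pairRate_nonneg (η : GCfg N d K) : 0 ≤ pairRate η x y := by
  unfold pairRate
  have : ((η y).val : ℝ) ≤ K := by exact_mod_cast Nat.lt_succ_iff.1 (η y).isLt
  exact mul_nonneg (Nat.cast_nonneg _) (by linarith)

theorem pairRate_le (η : GCfg N d K) : pairRate η x y ≤ (K : ℝ) ^ 2 := by
  unfold pairRate
  have h1 : ((η x).val : ℝ) ≤ K := by exact_mod_cast Nat.lt_succ_iff.1 (η x).isLt
  have h2 : ((η y).val : ℝ) ≤ K := by exact_mod_cast Nat.lt_succ_iff.1 (η y).isLt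
  have h3 : (0 : ℝ) ≤ (η x).val := Nat.cast_nonneg _
  have h4 : (0 : ℝ) ≤ (η y).val := Nat.cast_nonneg _
  nlinarith

end Bond

noncomputable section

/-- The contribution of the ordered bond `(x, y)` to the Dirichlet form of `μ / ν`. -/
def bondForm {N d K : ℕ} (ϱ : Site N d → ℝ) (μ : GCfg N d K → ℝ) (x y : Site N d) : ℝ :=
  ∑ η, prodBinom ϱ η * (pairRate η x y *
    (√(μ (cfgJump η x y) / prodBinom ϱ (cfgJump η x y)) - √(μ η / prodBinom ϱ η)) ^ 2)

/-- The constant in the integration by parts formula along a bond. -/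
def bondConst (K : ℕ) (r : ℝ) : ℝ := (1 + K ^ 2 / r ^ 2) / (2 * r ^ 4) + (K / r ^ 2) ^ 4

end

section IntegrationByParts

variable {N d K : ℕ} {ϱ : Site N d → ℝ} {x y : Site N d} {r : ℝ} {μ : GCfg N d K → ℝ}

theorem bondConst_nonneg : 0 ≤ bondConst K r := by unfold bondConst; positivity

theorem bondForm_nonneg (h0 : ∀ x, 0 < ϱ x) (h1 : ∀ x, ϱ x < K) : 0 ≤ bondForm ϱ μ x y :=
  Finset.sum_nonneg fun η _ =>
    mul_nonneg (prodBinom_pos h0 h1 η).le (mul_nonneg (pairRate_nonneg η) (sq_nonneg _))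

theorem mul_sub_le_sqrt {a b h ε : ℝ} (ha : 0 ≤ a) (hb : 0 ≤ b) (hε : 0 < ε) :
    h * (b - a) ≤ ε * (√b - √a) ^ 2 + h ^ 2 * (b + a) / (2 * ε) := by
  obtain ⟨s, hs, rfl⟩ : ∃ s, 0 ≤ s ∧ a = s ^ 2 := ⟨√a, Real.sqrt_nonneg a, (Real.sq_sqrt ha).symm⟩
  obtain ⟨t, ht, rfl⟩ : ∃ t, 0 ≤ t ∧ b = t ^ 2 := ⟨√b, Real.sqrt_nonneg b, (Real.sq_sqrt hb).symm⟩
  rw [Real.sqrt_sq hs, Real.sqrt_sq ht]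
  have e : ε * (t - s) ^ 2 + h ^ 2 * (t ^ 2 + s ^ 2) / (2 * ε) - h * (t ^ 2 - s ^ 2) =
      ((2 * ε * (t - s) - h * (t + s)) ^ 2 + h ^ 2 * (t - s) ^ 2) / (4 * ε) := by
    field_simp; ring
  have : 0 ≤ ((2 * ε * (t - s) - h * (t + s)) ^ 2 + h ^ 2 * (t - s) ^ 2) / (4 * ε) := by positivity
  linarith

/-- Integration by parts along a bond. -/
theorem sum_mul_fluct_sub_le (hr : 0 < r) (h0 : ∀ x, r ≤ ϱ x) (h1 : ∀ x, ϱ x ≤ K - r)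
    (hxy : x ≠ y) (hμ : ∀ η, 0 ≤ μ η) (hμs : ∑ η, μ η = 1) {h : GCfg N d K → ℝ}
    (hh : ∀ η, h (cfgJump η x y) = h η) (hh' : ∀ η, h (cfgJump η y x) = h η)
    {ε : ℝ} (hε : 0 < ε) :
    ∑ η, μ η * (h η * (fluct K (ϱ y) (η y) - fluct K (ϱ x) (η x))) ≤
      ε * bondForm ϱ μ x y + bondConst K r / ε * ∑ η, μ η * h η ^ 2 + ε * (ϱ y - ϱ x) ^ 2 := by
  have h0' : ∀ x, 0 < ϱ x := fun x => hr.trans_le (h0 x)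
  have h1' : ∀ x, ϱ x < K := fun x => (h1 x).trans_lt (by linarith)
  have hν := prodBinom_pos (K := K) h0' h1'
  have hK : (0 : ℝ) < K := (h0' x).trans (h1' x)
  have hK1 : (1 : ℝ) ≤ K := by
    have : 0 < K := by exact_mod_cast hK
    exact_mod_cast this
  set f : GCfg N d K → ℝ := fun η => μ η / prodBinom ϱ η with hf
  have hf0 : ∀ η, 0 ≤ f η := fun η => div_nonneg (hμ η) (hν η).le
  have hνf : ∀ η, prodBinom ϱ η * f η = μ η := fun η => mul_div_cancel₀ _ (hν η).ne'
  set J : ℝ := K * ϱ x * (K - ϱ y) with hJ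
  have hJr : K * r ^ 2 ≤ J := by
    have := mul_le_mul (h0 x) (show r ≤ K - ϱ y by linarith [h1 y]) hr.le (h0' x).le
    nlinarith
  have hJ0 : 0 < J := lt_of_lt_of_le (by positivity) hJr
  set q : ℝ := ϱ x * (K - ϱ y) / (ϱ y * (K - ϱ x)) with hq
  have hqle : q ≤ K ^ 2 / r ^ 2 := by
    have a1 : r * r ≤ ϱ y * (K - ϱ x) :=
      mul_le_mul (h0 y) (by linarith [h1 x]) hr.le (h0' y).le
    have a2 : ϱ x * (K - ϱ y) ≤ K * K :=
      mul_le_mul (h1' x).le (by linarith [h0' y]) (by linarith [h1' y]) hK.le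
    exact div_le_div₀ (by positivity) (by linarith) (by positivity) (by linarith)
  have hq0 : 0 ≤ q := div_nonneg (mul_nonneg (h0' x).le (by linarith [h1' y]))
    (mul_nonneg (h0' y).le (by linarith [h1' x]))
  set S := ∑ η, μ η * h η ^ 2 with hS
  -- the exchange identity
  have key := sum_exchange h0' h1' hxy fun η => h η * f η
  simp only [hh] at key
  have eR : ∑ η, prodBinom ϱ η * (h η * f η) * (J *
        ((fluct K (ϱ y) (η y) - fluct K (ϱ x) (η x)) +
        (ϱ y - ϱ x) * (fluct K (ϱ x) (η x) * fluct K (ϱ y) (η y)))) =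
      J * ∑ η, μ η * (h η * (fluct K (ϱ y) (η y) - fluct K (ϱ x) (η x))) +
      J * ∑ η, μ η * (h η * ((ϱ y - ϱ x) * (fluct K (ϱ x) (η x) * fluct K (ϱ y) (η y)))) := by
    rw [Finset.mul_sum, Finset.mul_sum, ← Finset.sum_add_distrib]
    refine Finset.sum_congr rfl fun η _ => ?_
    rw [← hνf η]; ring
  rw [eR] at key
  -- bounds of the left hand side
  have hL : ∑ η, prodBinom ϱ η * (pairRate η x y * (h η * f (cfgJump η x y) - h η * f η)) ≤
      J * ε * bondForm ϱ μ x y + (K ^ 2 * (1 + K ^ 2 / r ^ 2)) / (2 * (J * ε)) * S := by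
    have hc1 : ∑ η, prodBinom ϱ η * pairRate η x y * (h η ^ 2 * f η) ≤ K ^ 2 * S := by
      rw [hS, Finset.mul_sum]
      refine Finset.sum_le_sum fun η _ => ?_
      have : prodBinom ϱ η * pairRate η x y * (h η ^ 2 * f η) =
        pairRate η x y * (μ η * h η ^ 2) := by rw [← hνf η]; ring
      rw [this]
      exact mul_le_mul_of_nonneg_right (pairRate_le η) (mul_nonneg (hμ η) (sq_nonneg _))
    have hc2 : ∑ η, prodBinom ϱ η * pairRate η x y * (h η ^ 2 * f (cfgJump η x y)) ≤
        K ^ 2 * (K ^ 2 / r ^ 2) * S := by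
      rw [sum_prodBinom_cfgJump h0' h1' hxy fun η η' => h η ^ 2 * f η', hS, Finset.mul_sum]
      refine Finset.sum_le_sum fun η _ => ?_
      rw [hh']
      have : prodBinom ϱ η * pairRate η y x * q * (h η ^ 2 * f η) =
        (pairRate η y x * q) * (μ η * h η ^ 2) := by rw [← hνf η]; ring
      rw [this]
      exact mul_le_mul_of_nonneg_right
        (mul_le_mul (pairRate_le η) hqle hq0 (by positivity)) (mul_nonneg (hμ η) (sq_nonneg _))
    calc _ ≤ ∑ η, (J * ε * (prodBinom ϱ η * (pairRate η x y *
            (√(f (cfgJump η x y)) - √(f η)) ^ 2)) +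
          (1 / (2 * (J * ε))) * (prodBinom ϱ η * pairRate η x y * (h η ^ 2 * f (cfgJump η x y)) +
            prodBinom ϱ η * pairRate η x y * (h η ^ 2 * f η))) := by
          refine Finset.sum_le_sum fun η _ => ?_
          have := mul_sub_le_sqrt (h := h η) (hf0 η) (hf0 (cfgJump η x y)) (mul_pos hJ0 hε)
          have hw : 0 ≤ prodBinom ϱ η * pairRate η x y :=
            mul_nonneg (hν η).le (pairRate_nonneg η)
          have := mul_le_mul_of_nonneg_left this hw
          calc _ = prodBinom ϱ η * pairRate η x y * (h η * (f (cfgJump η x y) - f η)) := by ring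
            _ ≤ _ := this
            _ = _ := by ring
      _ = J * ε * bondForm ϱ μ x y + (1 / (2 * (J * ε))) *
          (∑ η, prodBinom ϱ η * pairRate η x y * (h η ^ 2 * f (cfgJump η x y)) +
            ∑ η, prodBinom ϱ η * pairRate η x y * (h η ^ 2 * f η)) := by
          rw [Finset.sum_add_distrib, ← Finset.mul_sum, ← Finset.mul_sum, Finset.sum_add_distrib]
          rfl
      _ ≤ J * ε * bondForm ϱ μ x y + (1 / (2 * (J * ε))) *
          (K ^ 2 * (K ^ 2 / r ^ 2) * S + K ^ 2 * S) := by gcongr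
      _ = _ := by ring
  have hQ : -(∑ η, μ η * (h η * ((ϱ y - ϱ x) * (fluct K (ϱ x) (η x) * fluct K (ϱ y) (η y))))) ≤
      ε * (ϱ y - ϱ x) ^ 2 + (K / r ^ 2) ^ 4 / ε * S := by
    calc _ = ∑ η, μ η * (-(h η * ((ϱ y - ϱ x) * (fluct K (ϱ x) (η x) * fluct K (ϱ y) (η y))))) := by
          rw [← Finset.sum_neg_distrib]; exact Finset.sum_congr rfl fun η _ => by ring
      _ ≤ ∑ η, (μ η * (ε * (ϱ y - ϱ x) ^ 2) + (K / r ^ 2) ^ 4 / ε * (μ η * h η ^ 2)) := by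
          refine Finset.sum_le_sum fun η _ => ?_
          have hω : (fluct K (ϱ x) (η x) * fluct K (ϱ y) (η y)) ^ 2 ≤ (K / r ^ 2) ^ 4 := by
            have b1 := sq_le_sq' (abs_le.1 (abs_fluct_le hr (h0 x) (h1 x) (η x))).1
              (abs_le.1 (abs_fluct_le hr (h0 x) (h1 x) (η x))).2
            have b2 := sq_le_sq' (abs_le.1 (abs_fluct_le hr (h0 y) (h1 y) (η y))).1
              (abs_le.1 (abs_fluct_le hr (h0 y) (h1 y) (η y))).2
            rw [mul_pow]
            calc _ ≤ ((K : ℝ) / r ^ 2) ^ 2 * (K / r ^ 2) ^ 2 :=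
                  mul_le_mul b1 b2 (sq_nonneg _) (sq_nonneg _)
              _ = _ := by ring
          generalize fluct K (ϱ x) (η x) * fluct K (ϱ y) (η y) = W at *
          generalize ϱ y - ϱ x = g
          have : -(h η * (g * W)) ≤ ε * g ^ 2 + (K / r ^ 2) ^ 4 / ε * h η ^ 2 := by
            have e1 : ε * g ^ 2 + W ^ 2 / ε * h η ^ 2 + h η * (g * W) =
                ((ε * g + h η * W / 2) ^ 2 + 3 / 4 * (h η * W) ^ 2) / ε := by
              field_simp; ring
            have e2 : 0 ≤ ((ε * g + h η * W / 2) ^ 2 + 3 / 4 * (h η * W) ^ 2) / ε := by positivity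
            have e3 : W ^ 2 / ε * h η ^ 2 ≤ (K / r ^ 2) ^ 4 / ε * h η ^ 2 := by gcongr
            linarith
          have := mul_le_mul_of_nonneg_left this (hμ η)
          linarith
      _ = _ := by
          rw [Finset.sum_add_distrib, ← Finset.sum_mul, hμs, one_mul, ← Finset.mul_sum]
  have hS0 : 0 ≤ S := Finset.sum_nonneg fun η _ => mul_nonneg (hμ η) (sq_nonneg _)
  have hfin : (K ^ 2 * (1 + K ^ 2 / r ^ 2)) / (2 * (J * ε)) * S ≤
      J * ((1 + K ^ 2 / r ^ 2) / (2 * r ^ 4) / ε * S) := by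
    have : ((K : ℝ) ^ 2 * (1 + K ^ 2 / r ^ 2)) / (2 * (J * ε)) ≤
        J * ((1 + K ^ 2 / r ^ 2) / (2 * r ^ 4) / ε) := by
      have hJ2 : (K * r ^ 2) ^ 2 ≤ J ^ 2 := pow_le_pow_left₀ (by positivity) hJr 2
      have h2 : (K : ℝ) ^ 2 / J ≤ J / r ^ 4 := by
        rw [div_le_div_iff₀ hJ0 (by positivity)]; nlinarith
      have hM : (0 : ℝ) ≤ (1 + K ^ 2 / r ^ 2) / (2 * ε) := by positivity
      calc _ = (1 + (K : ℝ) ^ 2 / r ^ 2) / (2 * ε) * (K ^ 2 / J) := by field_simp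
        _ ≤ (1 + (K : ℝ) ^ 2 / r ^ 2) / (2 * ε) * (J / r ^ 4) :=
            mul_le_mul_of_nonneg_left h2 hM
        _ = _ := by field_simp
    calc _ ≤ _ := mul_le_mul_of_nonneg_right this hS0
      _ = _ := by ring
  refine le_of_mul_le_mul_left ?_ hJ0
  have e : J * (ε * bondForm ϱ μ x y + bondConst K r / ε * S + ε * (ϱ y - ϱ x) ^ 2) =
      J * ε * bondForm ϱ μ x y + J * ((1 + K ^ 2 / r ^ 2) / (2 * r ^ 4) / ε * S) +
      J * (ε * (ϱ y - ϱ x) ^ 2 + (K / r ^ 2) ^ 4 / ε * S) := by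
    unfold bondConst; ring
  rw [e]
  have := mul_le_mul_of_nonneg_left hQ hJ0.le
  linarith

/-- The Dirichlet form is a sum over ordered bonds. -/
theorem dirichletForm_eq (p : Fin d → Bool → ℝ) :
    dirichletForm p (fun η => μ η / prodBinom ϱ η) (prodBinom ϱ) =
      ∑ i, ∑ b, ∑ x, p i b * bondForm ϱ μ x (siteMove x i b) := by
  unfold dirichletForm bondForm jumpRate pairRate
  refine Finset.sum_congr rfl fun i _ => Finset.sum_congr rfl fun b _ =>
    Finset.sum_congr rfl fun x _ => ?_
  rw [Finset.mul_sum]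
  exact Finset.sum_congr rfl fun η _ => by ring

/-- Integration by parts along all bonds in a given direction. -/
theorem sum_sum_mul_fluct_sub_le [NeZero N] (hN : 2 ≤ N) (hr : 0 < r) (h0 : ∀ x, r ≤ ϱ x)
    (h1 : ∀ x, ϱ x ≤ K - r) (hμ : ∀ η, 0 ≤ μ η) (hμs : ∑ η, μ η = 1)
    {p : Fin d → Bool → ℝ} (hp : ∀ i b, 0 ≤ p i b) {p₀ : ℝ} (hp₀ : 0 < p₀) (j : Fin d)
    (hpj : ∃ b, p₀ ≤ p j b) {h : Site N d → GCfg N d K → ℝ}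
    (hh : ∀ y η, h y (cfgJump η y (y + unitSite j)) = h y η)
    (hh' : ∀ y η, h y (cfgJump η (y + unitSite j) y) = h y η) {ε : ℝ} (hε : 0 < ε) :
    ∑ η, μ η * ∑ y, h y η * (fluct K (ϱ y) (η y) -
        fluct K (ϱ (y + unitSite j)) (η (y + unitSite j))) ≤
      ε * ∑ b, ∑ x, p j b * bondForm ϱ μ x (siteMove x j b) +
      bondConst K r / (ε * p₀) * ∑ η, μ η * ∑ y, h y η ^ 2 +
      ε * p₀ * ∑ y, (ϱ (y + unitSite j) - ϱ y) ^ 2 := by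
  have h0' : ∀ x, 0 < ϱ x := fun x => hr.trans_le (h0 x)
  have h1' : ∀ x, ϱ x < K := fun x => (h1 x).trans_lt (by linarith)
  have hne : ∀ y : Site N d, y ≠ y + unitSite j := fun y hy => by
    have h2 : unitSite (N := N) j = 0 := by simpa using hy.symm
    have := add_unitSite_ne_zero (N := N) (z := 0) j (by simp; omega)
    simp [h2] at this
  have hbf : ∀ x y, 0 ≤ bondForm ϱ μ x y := fun x y => bondForm_nonneg h0' h1'
  have hpos : ∀ b, 0 ≤ ∑ x, p j b * bondForm ϱ μ x (siteMove x j b) := fun b =>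
    Finset.sum_nonneg fun x _ => mul_nonneg (hp j b) (hbf _ _)
  have swap : ∀ F : Site N d → GCfg N d K → ℝ,
      ∑ η, μ η * ∑ y, F y η = ∑ y, ∑ η, μ η * F y η := fun F => by
    simp only [Finset.mul_sum]; exact Finset.sum_comm
  obtain ⟨b, hb⟩ := hpj
  have main : ∑ η, μ η * ∑ y, h y η * (fluct K (ϱ y) (η y) -
        fluct K (ϱ (y + unitSite j)) (η (y + unitSite j))) ≤
      ε * ∑ x, p j b * bondForm ϱ μ x (siteMove x j b) +
      bondConst K r / (ε * p₀) * ∑ η, μ η * ∑ y, h y η ^ 2 +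
      ε * p₀ * ∑ y, (ϱ (y + unitSite j) - ϱ y) ^ 2 := by
    rw [swap, swap, Finset.mul_sum, Finset.mul_sum, Finset.mul_sum]
    have hεp := mul_pos hε hp₀
    cases b with
    | true =>
      rw [← Finset.sum_add_distrib, ← Finset.sum_add_distrib]
      refine Finset.sum_le_sum fun y _ => ?_
      have := sum_mul_fluct_sub_le hr h0 h1 (hne y) hμ hμs (h := fun η => -h y η)
        (fun η => by rw [hh]) (fun η => by rw [hh']) hεp
      simp only [neg_sq] at this
      rw [siteMove_true]
      have hb' : ε * p₀ * bondForm ϱ μ y (y + unitSite j) ≤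
          ε * (p j true * bondForm ϱ μ y (y + unitSite j)) := by
        rw [mul_assoc]
        have := hbf y (y + unitSite j)
        gcongr
      calc _ = ∑ η, μ η * (-h y η * (fluct K (ϱ (y + unitSite j)) (η (y + unitSite j)) -
            fluct K (ϱ y) (η y))) := Finset.sum_congr rfl fun η _ => by ring
        _ ≤ _ := this
        _ ≤ _ := by linarith
    | false =>
      rw [← Equiv.sum_comp (Equiv.addRight (unitSite (N := N) j))
        (fun x => ε * (p j false * bondForm ϱ μ x (siteMove x j false))),
        ← Finset.sum_add_distrib, ← Finset.sum_add_distrib]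
      refine Finset.sum_le_sum fun y _ => ?_
      have := sum_mul_fluct_sub_le hr h0 h1 (hne y).symm hμ hμs (h := h y)
        (hh' y) (hh y) hεp
      rw [siteMove_false, Equiv.coe_addRight, add_sub_cancel_right]
      have hb' : ε * p₀ * bondForm ϱ μ (y + unitSite j) y ≤
          ε * (p j false * bondForm ϱ μ (y + unitSite j) y) := by
        rw [mul_assoc]
        have := hbf (y + unitSite j) y
        gcongr
      have e : (ϱ y - ϱ (y + unitSite j)) ^ 2 = (ϱ (y + unitSite j) - ϱ y) ^ 2 := by ring
      rw [e] at this
      linarith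
  refine main.trans ?_
  have hsingle : ∑ x, p j b * bondForm ϱ μ x (siteMove x j b) ≤
      ∑ b, ∑ x, p j b * bondForm ϱ μ x (siteMove x j b) :=
    Finset.single_le_sum (f := fun b => ∑ x, p j b * bondForm ϱ μ x (siteMove x j b))
      (fun b _ => hpos b) (Finset.mem_univ b)
  gcongr

end IntegrationByParts

section ConvolutionMatrix

variable {G : Type*} [AddCommGroup G] [Fintype G] {φ a : G → ℝ} {A s : ℝ}

theorem sum_abs_conv_right_le (hφ : ∀ z, 0 ≤ φ z) (hs : ∑ z, φ z = s) (ha : ∀ x, |a x| ≤ A)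
    (v y : G) : ∑ x, |φ (y - v - x) * a x| ≤ A * s := by
  calc _ ≤ ∑ x, A * φ (y - v - x) := Finset.sum_le_sum fun x _ => by
        rw [abs_mul, abs_of_nonneg (hφ _), mul_comm]
        exact mul_le_mul_of_nonneg_right (ha x) (hφ _)
    _ = _ := by
        rw [← Finset.mul_sum, ← hs]
        exact congrArg _ (Equiv.sum_comp (Equiv.subLeft (y - v)) φ)

theorem sum_abs_conv_left_le (hφ : ∀ z, 0 ≤ φ z) (hs : ∑ z, φ z = s) (ha : ∀ x, |a x| ≤ A)
    (v x : G) : ∑ y, |φ (y - v - x) * a x| ≤ A * s := by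
  calc _ ≤ ∑ y, A * φ (y - (v + x)) := Finset.sum_le_sum fun y _ => by
        rw [abs_mul, abs_of_nonneg (hφ _), mul_comm, sub_sub]
        exact mul_le_mul_of_nonneg_right (ha x) (hφ _)
    _ = _ := by
        rw [← Finset.mul_sum, ← hs]
        exact congrArg _ (Equiv.sum_comp (Equiv.subRight (v + x)) φ)

theorem sum_sq_conv_le (hφ : ∀ z, 0 ≤ φ z) (hs : ∑ z, φ z = s) (ha : ∀ x, |a x| ≤ A)
    {M : ℝ} (hM : ∀ z, φ z ≤ M) (v : G) :
    ∑ y, ∑ x, (φ (y - v - x) * a x) ^ 2 ≤ Fintype.card G * (A ^ 2 * (M * s)) := by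
  have : ∀ y, ∑ x, (φ (y - v - x) * a x) ^ 2 ≤ A ^ 2 * (M * s) := fun y => by
    calc _ ≤ ∑ x, A ^ 2 * (M * φ (y - v - x)) := Finset.sum_le_sum fun x _ => by
          have h1 : a x ^ 2 ≤ A ^ 2 := sq_le_sq' (abs_le.1 (ha x)).1 (abs_le.1 (ha x)).2
          have h2 : φ (y - v - x) ^ 2 ≤ M * φ (y - v - x) := by
            rw [sq]; exact mul_le_mul_of_nonneg_right (hM _) (hφ _)
          rw [mul_pow, mul_comm]
          exact mul_le_mul h1 h2 (sq_nonneg _) (sq_nonneg _)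
      _ = _ := by
          rw [← Finset.mul_sum, ← Finset.mul_sum, ← hs]
          exact congrArg (fun w => A ^ 2 * (M * w)) (Equiv.sum_comp (Equiv.subLeft (y - v)) φ)
  calc _ ≤ ∑ _y : G, A ^ 2 * (M * s) := Finset.sum_le_sum fun y _ => this y
    _ = _ := by simp

end ConvolutionMatrix

section QuadraticTerm

variable {N d K : ℕ} [NeZero N] {ϱ : Site N d → ℝ} {r : ℝ} {μ : GCfg N d K → ℝ}

theorem flow_term_le (hr : 0 < r) (h0 : ∀ x, r ≤ ϱ x) (h1 : ∀ x, ϱ x ≤ K - r)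
    (hμ : ∀ η, 0 < μ η) (hμs : ∑ η, μ η = 1)
    {p : Fin d → Bool → ℝ} (hp : ∀ i b, 0 ≤ p i b) {p₀ : ℝ} (hp₀ : 0 < p₀) (i j : Fin d)
    (hpj : ∃ b, p₀ ≤ p j b) {k : ℕ} (hN : 2 ^ (k + 2) + 2 ≤ N) {G A : ℝ} {a : Site N d → ℝ}
    (hG : ∀ x, |ϱ (x + unitSite j) - ϱ x| ≤ G)
    (ha : ∀ x, |a x| ≤ A) {ε : ℝ} (hε : 0 < ε) :
    ∑ η, μ η * ∑ x, a x * fluct K (ϱ x) (η x) * ∑ z, flowKer (boxSide d k j) j z *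
        (fluct K (ϱ (x + unitSite i + z)) (η (x + unitSite i + z)) -
          fluct K (ϱ (x + unitSite i + z + unitSite j)) (η (x + unitSite i + z + unitSite j))) ≤
      ε * ∑ b, ∑ x, p j b * bondForm ϱ μ x (siteMove x j b) +
      bondConst K r / (ε * p₀) * (2 * (K / r ^ 2) ^ 2 * A ^ 2 * 4 ^ k * relEnt μ (prodBinom ϱ) +
        (K / r ^ 2) ^ 2 * A ^ 2 * (Fintype.card (Site N d) * (4 ^ k * ((2 : ℝ) ^ (k * d))⁻¹))) +
      ε * p₀ * (Fintype.card (Site N d) * G ^ 2) := by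
  have h0' : ∀ x, 0 < ϱ x := fun x => hr.trans_le (h0 x)
  have h1' : ∀ x, ϱ x < K := fun x => (h1 x).trans_lt (by linarith)
  have hA : 0 ≤ A := (abs_nonneg _).trans (ha 0)
  have hpow : 2 ^ (k + 2) = 4 * 2 ^ k := by ring
  have hpow1 : 2 ^ (k + 1) = 2 * 2 ^ k := by ring
  have hN2 : 2 ≤ N := by omega
  set φ : Site N d → ℝ := flowKer (boxSide d k j) j with hφdef
  have hφ : ∀ z, 0 ≤ φ z := fun z => flowKer_nonneg j z
  have hφs : ∑ z, φ z = 2 ^ k / 2 := sum_scaleFlow k (by omega) j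
  have hφM : ∀ z, φ z ≤ 2 ^ k / 2 * ((2 : ℝ) ^ (k * d))⁻¹ := fun z => scaleFlow_le k j z
  set h : Site N d → GCfg N d K → ℝ := fun y η =>
    ∑ x, φ (y - unitSite i - x) * a x * fluct K (ϱ x) (η x) with hh
  have hval : ∀ z, φ z ≠ 0 → (z i).val < 2 ^ (k + 2) := fun z hz => by
    have := val_lt_of_flowKer_ne_zero hz i
    have := boxSide_le (d := d) k j i
    omega
  have hsupp1 : ∀ y, φ (y - unitSite i - y) = 0 := fun y => by
    by_contra hz
    have h2 := hval _ hz
    refine add_unitSite_ne_zero i (by omega) ?_ (z := y - unitSite i - y)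
    abel
  have hsupp2 : ∀ y, φ (y - unitSite i - (y + unitSite j)) = 0 := fun y => by
    by_contra hz
    have h2 := hval _ hz
    have h3 := add_unitSite_val_le (y - unitSite i - (y + unitSite j)) i j
    refine add_unitSite_ne_zero i (by omega) ?_
      (z := y - unitSite i - (y + unitSite j) + unitSite j)
    abel
  have hinv : ∀ (y : Site N d) (η : GCfg N d K) (u v : Site N d),
      (u = y ∧ v = y + unitSite j) ∨ (v = y ∧ u = y + unitSite j) →
      h y (cfgJump η u v) = h y η := by
    intro y η u v huv
    refine Finset.sum_congr rfl fun x _ => ?_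
    by_cases hx1 : x = y
    · subst hx1; rw [hsupp1]; ring
    · by_cases hx2 : x = y + unitSite j
      · subst hx2; rw [hsupp2]; ring
      · rw [cfgJump_of_ne]
        · rcases huv with ⟨rfl, rfl⟩ | ⟨rfl, rfl⟩ <;> assumption
        · rcases huv with ⟨rfl, rfl⟩ | ⟨rfl, rfl⟩ <;> assumption
  have hre : ∀ η : GCfg N d K, ∑ x, a x * fluct K (ϱ x) (η x) * ∑ z, φ z *
        (fluct K (ϱ (x + unitSite i + z)) (η (x + unitSite i + z)) -
          fluct K (ϱ (x + unitSite i + z + unitSite j)) (η (x + unitSite i + z + unitSite j))) =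
      ∑ y, h y η * (fluct K (ϱ y) (η y) -
        fluct K (ϱ (y + unitSite j)) (η (y + unitSite j))) := fun η => by
    simp only [hh, Finset.sum_mul]
    rw [Finset.sum_comm]
    refine Finset.sum_congr rfl fun x _ => ?_
    rw [Finset.mul_sum, ← Equiv.sum_comp (Equiv.addLeft (x + unitSite i))
      (fun y => φ (y - unitSite i - x) * a x * fluct K (ϱ x) (η x) *
        (fluct K (ϱ y) (η y) - fluct K (ϱ (y + unitSite j)) (η (y + unitSite j))))]
    refine Finset.sum_congr rfl fun z _ => ?_
    have : x + unitSite i + z - unitSite i - x = z := by abel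
    rw [Equiv.coe_addLeft, this]
    ring
  simp only [hre]
  have hent := entropy_squares (B := K / r ^ 2) (μ := μ)
    (ν := fun x (s : Fin (K + 1)) => binomW K (ϱ x) s.val) (w := fun x => fluct K (ϱ x))
    (fun x s => binomW_pos (h0' x) (h1' x) (Nat.lt_succ_iff.1 s.isLt)) (fun x => sum_binomW)
    (fun x => sum_binomW_fluct (h0' x) (h1' x)) (fun x s => abs_fluct_le hr (h0 x) (h1 x) s)
    hμ hμs (fun y x => φ (y - unitSite i - x) * a x) _ _
    (fun y => sum_abs_conv_right_le hφ hφs ha _ y) (fun x => sum_abs_conv_left_le hφ hφs ha _ x)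
    (by positivity) (by positivity)
  have hHS := sum_sq_conv_le hφ hφs ha hφM (unitSite i)
  have hGs : ∑ y, (ϱ (y + unitSite j) - ϱ y) ^ 2 ≤ Fintype.card (Site N d) * G ^ 2 := by
    calc _ ≤ ∑ _y : Site N d, G ^ 2 := Finset.sum_le_sum fun y _ =>
          sq_le_sq' (abs_le.1 (hG y)).1 (abs_le.1 (hG y)).2
      _ = _ := by simp
  refine (sum_sum_mul_fluct_sub_le hN2 hr h0 h1 (fun η => (hμ η).le) hμs hp hp₀ j hpj
    (fun y η => hinv y η _ _ (Or.inl ⟨rfl, rfl⟩)) (fun y η => hinv y η _ _ (Or.inr ⟨rfl, rfl⟩))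
    hε).trans ?_
  have hC : 0 ≤ bondConst K r / (ε * p₀) := div_nonneg bondConst_nonneg (by positivity)
  have h4 : (4 : ℝ) ^ k = 2 ^ k * 2 ^ k := by rw [← mul_pow]; norm_num
  have hsq : ∑ η, μ η * ∑ y, h y η ^ 2 ≤
      2 * (K / r ^ 2) ^ 2 * A ^ 2 * 4 ^ k * relEnt μ (prodBinom ϱ) +
        (K / r ^ 2) ^ 2 * A ^ 2 * (Fintype.card (Site N d) * (4 ^ k * ((2 : ℝ) ^ (k * d))⁻¹)) := by
    have hB : 0 ≤ 2 * ((K : ℝ) / r ^ 2) ^ 2 := by positivity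
    have := mul_le_mul_of_nonneg_left hHS hB
    have hnn : 0 ≤ (K / r ^ 2) ^ 2 * A ^ 2 *
        (Fintype.card (Site N d) * (4 ^ k * ((2 : ℝ) ^ (k * d))⁻¹)) := by positivity
    refine (hent.trans (add_le_add_right this _)).trans ?_
    have e : relEnt μ (prodBinom ϱ) =
      relEnt μ fun η => ∏ i, binomW K (ϱ i) (η i).val := rfl
    rw [e]
    have : 8 * (K / r ^ 2) ^ 2 * (A * (2 ^ k / 2) * (A * (2 ^ k / 2)) *
          relEnt μ fun η => ∏ i, binomW K (ϱ i) (η i).val) +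
        2 * (K / r ^ 2) ^ 2 * (Fintype.card (Site N d) *
          (A ^ 2 * (2 ^ k / 2 * ((2 : ℝ) ^ (k * d))⁻¹ * (2 ^ k / 2)))) =
        2 * (K / r ^ 2) ^ 2 * A ^ 2 * 4 ^ k * (relEnt μ fun η => ∏ i, binomW K (ϱ i) (η i).val) +
        1 / 2 * ((K / r ^ 2) ^ 2 * A ^ 2 *
          (Fintype.card (Site N d) * (4 ^ k * ((2 : ℝ) ^ (k * d))⁻¹))) := by
      rw [h4]; ring
    rw [this]
    linarith
  gcongr

theorem box_term_le (hr : 0 < r) (h0 : ∀ x, r ≤ ϱ x) (h1 : ∀ x, ϱ x ≤ K - r)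
    (hμ : ∀ η, 0 < μ η) (hμs : ∑ η, μ η = 1) (i : Fin d) {L : ℕ} (hN : 2 ^ L + 1 ≤ N)
    {A : ℝ} {a : Site N d → ℝ} (ha : ∀ x, |a x| ≤ A) :
    ∑ η, μ η * ∑ x, a x * fluct K (ϱ x) (η x) * ∑ z, boxKer (fun _ => 2 ^ L) z *
        fluct K (ϱ (x + unitSite i + z)) (η (x + unitSite i + z)) ≤
      4 * (K / r ^ 2) ^ 2 * (A + 1) * relEnt μ (prodBinom ϱ) +
      (K / r ^ 2) ^ 2 * (Fintype.card (Site N d) * (A ^ 2 * ((2 : ℝ) ^ (L * d))⁻¹)) := by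
  have h0' : ∀ x, 0 < ϱ x := fun x => hr.trans_le (h0 x)
  have h1' : ∀ x, ϱ x < K := fun x => (h1 x).trans_lt (by linarith)
  have hA : 0 ≤ A := (abs_nonneg _).trans (ha 0)
  set φ : Site N d → ℝ := boxKer (fun _ => 2 ^ L) with hφdef
  have hφ : ∀ z, 0 ≤ φ z := fun z => boxKer_nonneg z
  have hφs : ∑ z, φ z = 1 := sum_boxKer (fun _ => by positivity) (fun _ => by omega)
  have hφM : ∀ z, φ z ≤ ((2 : ℝ) ^ (L * d))⁻¹ := fun z =>
    (boxKer_le z).trans (by simp [pow_mul])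
  have hsupp : ∀ y, φ (y - unitSite i - y) = 0 := fun y => by
    by_contra hz
    have h2 := val_lt_of_boxKer_ne_zero hz i
    refine add_unitSite_ne_zero i (by omega) ?_ (z := y - unitSite i - y)
    abel
  have hre : ∀ η : GCfg N d K, ∑ x, a x * fluct K (ϱ x) (η x) * ∑ z, φ z *
        fluct K (ϱ (x + unitSite i + z)) (η (x + unitSite i + z)) =
      ∑ y, ∑ x, (φ (y - unitSite i - x) * a x) *
        (fluct K (ϱ y) (η y) * fluct K (ϱ x) (η x)) := fun η => by
    rw [Finset.sum_comm]
    refine Finset.sum_congr rfl fun x _ => ?_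
    rw [Finset.mul_sum, ← Equiv.sum_comp (Equiv.addLeft (x + unitSite i))
      (fun y => (φ (y - unitSite i - x) * a x) * (fluct K (ϱ y) (η y) * fluct K (ϱ x) (η x)))]
    refine Finset.sum_congr rfl fun z _ => ?_
    have : x + unitSite i + z - unitSite i - x = z := by abel
    rw [Equiv.coe_addLeft, this]
    ring
  simp only [hre]
  have hent := entropy_offDiag (B := K / r ^ 2) (μ := μ)
    (ν := fun x (s : Fin (K + 1)) => binomW K (ϱ x) s.val) (w := fun x => fluct K (ϱ x))
    (fun x s => binomW_pos (h0' x) (h1' x) (Nat.lt_succ_iff.1 s.isLt)) (fun x => sum_binomW)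
    (fun x => sum_binomW_fluct (h0' x) (h1' x)) (fun x s => abs_fluct_le hr (h0 x) (h1 x) s)
    hμ hμs (fun y x => φ (y - unitSite i - x) * a x) (A * 1) (fun y => by rw [hsupp, zero_mul])
    (fun y => sum_abs_conv_right_le hφ hφs ha _ y) (fun x => sum_abs_conv_left_le hφ hφs ha _ x)
    (by positivity)
  have hHS := sum_sq_conv_le hφ hφs ha hφM (unitSite i)
  have hB : 0 ≤ ((K : ℝ) / r ^ 2) ^ 2 := by positivity
  have := mul_le_mul_of_nonneg_left hHS hB
  refine (hent.trans (add_le_add_right this _)).trans (le_of_eq ?_)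
  have e : relEnt μ (prodBinom ϱ) = relEnt μ fun η => ∏ i, binomW K (ϱ i) (η i).val := rfl
  rw [e]; ring

end QuadraticTerm

section StaticEstimate

variable {N d K : ℕ} {ϱ : Site N d → ℝ} {r : ℝ} {μ : GCfg N d K → ℝ}

theorem relEnt_prodBinom_nonneg (h0 : ∀ x, 0 < ϱ x) (h1 : ∀ x, ϱ x < K)
    (hμ : ∀ η, 0 < μ η) (hμs : ∑ η, μ η = 1) : 0 ≤ relEnt μ (prodBinom ϱ) :=
  relEnt_prod_nonneg (ν := fun x (s : Fin (K + 1)) => binomW K (ϱ x) s.val)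
    (fun x s => binomW_pos (h0 x) (h1 x) (Nat.lt_succ_iff.1 s.isLt)) (fun _ => sum_binomW) hμ hμs

/-- The second order term in a given direction is controlled by the Dirichlet form and the
relative entropy. -/
theorem quadratic_term_le [NeZero N] (hr : 0 < r) (h0 : ∀ x, r ≤ ϱ x) (h1 : ∀ x, ϱ x ≤ K - r)
    (hμ : ∀ η, 0 < μ η) (hμs : ∑ η, μ η = 1)
    {p : Fin d → Bool → ℝ} (hp : ∀ i b, 0 ≤ p i b) {p₀ : ℝ} (hp₀ : 0 < p₀) (i : Fin d)
    (hpj : ∀ j, ∃ b, p₀ ≤ p j b) {L : ℕ} (hL : 1 ≤ L) (hN : 2 ^ (L + 1) + 2 ≤ N)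
    {G A Q Γ : ℝ} {a : Site N d → ℝ} (hG : ∀ j x, |ϱ (x + unitSite j) - ϱ x| ≤ G)
    (ha : ∀ x, |a x| ≤ A) (hΓ : 0 < Γ) (hQ : ∀ k < L, (4 : ℝ) ^ k * ((2 : ℝ) ^ (k * d))⁻¹ ≤ Q) :
    ∑ η, μ η * ∑ x, a x * (fluct K (ϱ x) (η x) *
        fluct K (ϱ (x + unitSite i)) (η (x + unitSite i))) ≤
      Γ / d * ∑ j, ∑ b, ∑ x, p j b * bondForm ϱ μ x (siteMove x j b) +
      (4 * (K / r ^ 2) ^ 2 * (A + 1) * relEnt μ (prodBinom ϱ) +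
      (K / r ^ 2) ^ 2 * (Fintype.card (Site N d) * (A ^ 2 * ((2 : ℝ) ^ (L * d))⁻¹))) +
      (bondConst K r * d ^ 2 / p₀ * (L ^ 2 / Γ) *
        (2 * (K / r ^ 2) ^ 2 * A ^ 2 * 4 ^ L * relEnt μ (prodBinom ϱ) +
          (K / r ^ 2) ^ 2 * A ^ 2 * (Fintype.card (Site N d) * Q)) +
      Γ * p₀ * (Fintype.card (Site N d) * G ^ 2)) := by
  have h0' : ∀ x, 0 < ϱ x := fun x => hr.trans_le (h0 x)
  have h1' : ∀ x, ϱ x < K := fun x => (h1 x).trans_lt (by linarith)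
  have hd : (0 : ℝ) < d := by exact_mod_cast (Nat.zero_le _).trans_lt i.isLt
  have hL0 : (0 : ℝ) < L := by exact_mod_cast hL
  have hH := relEnt_prodBinom_nonneg h0' h1' hμ hμs
  have hpow : 2 ^ (L + 1) = 2 * 2 ^ L := by ring
  have hLpos : 0 < 2 ^ L := by positivity
  set ε : ℝ := Γ / (d * L) with hε
  have hε0 : 0 < ε := by positivity
  set D : Fin d → ℝ := fun j => ∑ b, ∑ x, p j b * bondForm ϱ μ x (siteMove x j b) with hD
  set E : ℝ := bondConst K r / (ε * p₀) *
    (2 * (K / r ^ 2) ^ 2 * A ^ 2 * 4 ^ L * relEnt μ (prodBinom ϱ) +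
      (K / r ^ 2) ^ 2 * A ^ 2 * (Fintype.card (Site N d) * Q)) +
    ε * p₀ * (Fintype.card (Site N d) * G ^ 2) with hE
  have hbox := box_term_le hr h0 h1 hμ hμs i (L := L) (by omega) ha
  have hflow : ∀ k ∈ Finset.range L, ∀ j : Fin d,
      ∑ η, μ η * ∑ x, a x * fluct K (ϱ x) (η x) * ∑ z, flowKer (boxSide d k j) j z *
        (fluct K (ϱ (x + unitSite i + z)) (η (x + unitSite i + z)) -
          fluct K (ϱ (x + unitSite i + z + unitSite j)) (η (x + unitSite i + z + unitSite j))) ≤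
      ε * D j + E := by
    intro k hk j
    have hkL := Finset.mem_range.1 hk
    have h2 : 2 ^ (k + 2) ≤ 2 ^ (L + 1) := Nat.pow_le_pow_right (by norm_num) (by omega)
    refine (flow_term_le hr h0 h1 hμ hμs hp hp₀ i j (hpj j) (by omega) (hG j) ha hε0).trans ?_
    rw [hE, add_assoc]
    have hC : 0 ≤ bondConst K r / (ε * p₀) := div_nonneg bondConst_nonneg (by positivity)
    have h4 : (4 : ℝ) ^ k ≤ 4 ^ L := pow_le_pow_right₀ (by norm_num) hkL.le
    have hQk := hQ k hkL
    gcongr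
  have hdecomp : ∀ η : GCfg N d K, ∑ x, a x * (fluct K (ϱ x) (η x) *
        fluct K (ϱ (x + unitSite i)) (η (x + unitSite i))) =
      ∑ x, a x * fluct K (ϱ x) (η x) * ∑ z, boxKer (fun _ => 2 ^ L) z *
        fluct K (ϱ (x + unitSite i + z)) (η (x + unitSite i + z)) +
      ∑ k ∈ Finset.range L, ∑ j : Fin d, ∑ x, a x * fluct K (ϱ x) (η x) *
        ∑ z, flowKer (boxSide d k j) j z *
        (fluct K (ϱ (x + unitSite i + z)) (η (x + unitSite i + z)) -
          fluct K (ϱ (x + unitSite i + z + unitSite j))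
            (η (x + unitSite i + z + unitSite j))) := fun η => by
    have hc : ∀ x : Site N d, _ := fun x => box_chain L (by omega) (fun z : Site N d =>
      fluct K (ϱ (x + unitSite i + z)) (η (x + unitSite i + z)))
    simp only [add_zero, ← add_assoc] at hc
    rw [Finset.sum_congr rfl fun x _ => by rw [← mul_assoc, hc x, mul_add],
      Finset.sum_add_distrib]
    congr 1
    simp only [Finset.mul_sum (s := Finset.range L), Finset.mul_sum (s := Finset.univ (α := Fin d))]
    rw [Finset.sum_comm]
    exact Finset.sum_congr rfl fun k _ => Finset.sum_comm
  have hsum : ∑ η, μ η * ∑ x, a x * (fluct K (ϱ x) (η x) *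
        fluct K (ϱ (x + unitSite i)) (η (x + unitSite i))) =
      ∑ η, μ η * ∑ x, a x * fluct K (ϱ x) (η x) * ∑ z, boxKer (fun _ => 2 ^ L) z *
        fluct K (ϱ (x + unitSite i + z)) (η (x + unitSite i + z)) +
      ∑ k ∈ Finset.range L, ∑ j : Fin d, ∑ η, μ η * ∑ x, a x * fluct K (ϱ x) (η x) *
        ∑ z, flowKer (boxSide d k j) j z *
        (fluct K (ϱ (x + unitSite i + z)) (η (x + unitSite i + z)) -
          fluct K (ϱ (x + unitSite i + z + unitSite j))
            (η (x + unitSite i + z + unitSite j))) := by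
    rw [Finset.sum_congr rfl fun η _ => by rw [hdecomp η, mul_add], Finset.sum_add_distrib]
    congr 1
    rw [Finset.sum_congr rfl fun η _ => by rw [Finset.mul_sum], Finset.sum_comm]
    refine Finset.sum_congr rfl fun k _ => ?_
    rw [Finset.sum_congr rfl fun η _ => by rw [Finset.mul_sum], Finset.sum_comm]
  rw [hsum]
  have hfl := Finset.sum_le_sum fun k hk => Finset.sum_le_sum fun j (_ : j ∈ Finset.univ) =>
    hflow k hk j
  refine (add_le_add hbox hfl).trans (le_of_eq ?_)
  rw [Finset.sum_const, Finset.card_range, Finset.sum_add_distrib, Finset.sum_const,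
    Finset.card_univ, Fintype.card_fin, ← Finset.mul_sum, nsmul_eq_mul, nsmul_eq_mul, hE, hε]
  field_simp
  ring

end StaticEstimate

noncomputable section

/-- The mean current through the bond `(x, x + e_i)` under the product measure. -/
def meanCurrent {N d : ℕ} [NeZero N] (K : ℕ) (p : Fin d → Bool → ℝ) (ϱ : Site N d → ℝ) (i : Fin d)
    (x : Site N d) : ℝ :=
  p i true * (K * ϱ x * (K - ϱ (x + unitSite i))) - p i false * (K * ϱ (x + unitSite i) * (K - ϱ x))

end

section Static

variable {N d K : ℕ} [NeZero N] {ϱ : Site N d → ℝ} {μ : GCfg N d K → ℝ} {p : Fin d → Bool → ℝ}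

theorem ne_add_unitSite (hN : 2 ≤ N) (x : Site N d) (i : Fin d) : x ≠ x + unitSite i := fun hy => by
  have h2 : unitSite (N := N) i = 0 := by simpa using hy.symm
  have := add_unitSite_ne_zero (N := N) (z := 0) i (by simp; omega)
  simp [h2] at this

theorem ne_siteMove (hN : 2 ≤ N) (x : Site N d) (i : Fin d) (b : Bool) : x ≠ siteMove x i b := by
  cases b with
  | true => rw [siteMove_true]; exact ne_add_unitSite hN x i
  | false =>
    rw [siteMove_false]
    intro h
    exact ne_add_unitSite hN x i (by rw [eq_sub_iff_add_eq] at h; exact h.symm)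

theorem abs_meanCurrent_le (h0 : ∀ x, 0 < ϱ x) (h1 : ∀ x, ϱ x < K) (hp : ∀ i b, 0 ≤ p i b)
    {P : ℝ} (hP : ∀ i b, p i b ≤ P) (i : Fin d) (x : Site N d) :
    |meanCurrent K p ϱ i x| ≤ P * K ^ 3 := by
  have hb : ∀ (b : Bool) (y z : Site N d), 0 ≤ p i b * (K * ϱ y * (K - ϱ z)) ∧
      p i b * (K * ϱ y * (K - ϱ z)) ≤ P * K ^ 3 := fun b y z => by
    have a1 := h0 y
    have a2 := h1 y
    have a3 := h0 z
    have a4 := sub_pos.2 (h1 z)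
    have hK : (0 : ℝ) < K := a1.trans a2
    refine ⟨mul_nonneg (hp i b) (by positivity), mul_le_mul (hP i b) ?_ (by positivity)
      ((hp i b).trans (hP i b))⟩
    have : ϱ y * (K - ϱ z) ≤ K * K := mul_le_mul a2.le (by linarith) a4.le hK.le
    nlinarith
  unfold meanCurrent
  have b1 := hb true x (x + unitSite i)
  have b2 := hb false (x + unitSite i) x
  rw [abs_le]
  constructor <;> linarith [b1.1, b1.2, b2.1, b2.2]

/-- The adjoint of the generator applied to the constant function. -/
theorem sum_prodBinom_genL (hN : 2 ≤ N) (h0 : ∀ x, 0 < ϱ x) (h1 : ∀ x, ϱ x < K) :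
    ∑ η, prodBinom ϱ η * genL p (fun η => μ η / prodBinom ϱ η) η =
      ∑ η, μ η * ∑ i, ∑ x, meanCurrent K p ϱ i x *
        ((fluct K (ϱ (x + unitSite i)) (η (x + unitSite i)) - fluct K (ϱ x) (η x)) +
          (ϱ (x + unitSite i) - ϱ x) *
          (fluct K (ϱ x) (η x) * fluct K (ϱ (x + unitSite i)) (η (x + unitSite i)))) := by
  have hν := prodBinom_pos (K := K) h0 h1
  have hex : ∀ i b (x : Site N d), ∑ η, prodBinom ϱ η * (jumpRate p η x i b *
      (μ (cfgJump η x (siteMove x i b)) / prodBinom ϱ (cfgJump η x (siteMove x i b)) -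
        μ η / prodBinom ϱ η)) = p i b * ∑ η, μ η * (K * ϱ x * (K - ϱ (siteMove x i b)) *
        ((fluct K (ϱ (siteMove x i b)) (η (siteMove x i b)) - fluct K (ϱ x) (η x)) +
        (ϱ (siteMove x i b) - ϱ x) *
          (fluct K (ϱ x) (η x) * fluct K (ϱ (siteMove x i b)) (η (siteMove x i b))))) := by
    intro i b x
    have := sum_exchange h0 h1 (ne_siteMove hN x i b) (fun η => μ η / prodBinom ϱ η)
    simp only [mul_div_cancel₀ _ (hν _).ne'] at this
    rw [← this, Finset.mul_sum]
    refine Finset.sum_congr rfl fun η _ => ?_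
    unfold jumpRate pairRate
    ring
  have e1 : ∑ η, prodBinom ϱ η * genL p (fun η => μ η / prodBinom ϱ η) η =
      ∑ i, ∑ b, ∑ x, ∑ η, prodBinom ϱ η * (jumpRate p η x i b *
      (μ (cfgJump η x (siteMove x i b)) / prodBinom ϱ (cfgJump η x (siteMove x i b)) -
        μ η / prodBinom ϱ η)) := by
    unfold genL
    simp only [Finset.mul_sum]
    rw [Finset.sum_comm]
    refine Finset.sum_congr rfl fun i _ => ?_
    rw [Finset.sum_comm]
    refine Finset.sum_congr rfl fun b _ => ?_
    rw [Finset.sum_comm]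
  have e2 : ∀ F : Fin d → Site N d → GCfg N d K → ℝ,
      ∑ η, μ η * ∑ i, ∑ x, F i x η = ∑ i, ∑ x, ∑ η, μ η * F i x η := fun F => by
    simp only [Finset.mul_sum]
    rw [Finset.sum_comm]
    exact Finset.sum_congr rfl fun i _ => Finset.sum_comm
  rw [e1, e2]
  refine Finset.sum_congr rfl fun i _ => ?_
  simp only [hex, Fintype.sum_bool, siteMove_true]
  rw [← Equiv.sum_comp (Equiv.addRight (unitSite (N := N) i)) (fun x => p i false * _),
    ← Finset.sum_add_distrib]
  refine Finset.sum_congr rfl fun x _ => ?_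
  simp only [Equiv.coe_addRight, siteMove_false, add_sub_cancel_right]
  rw [Finset.mul_sum, Finset.mul_sum, ← Finset.sum_add_distrib]
  refine Finset.sum_congr rfl fun η _ => ?_
  unfold meanCurrent
  ring

/-- The static estimate: the generator, the Dirichlet form and a linear perturbation. -/
theorem static_estimate {r : ℝ} (hr : 0 < r) (h0 : ∀ x, r ≤ ϱ x) (h1 : ∀ x, ϱ x ≤ K - r)
    (hμ : ∀ η, 0 < μ η) (hμs : ∑ η, μ η = 1) (hd : 1 ≤ d)
    (hp : ∀ i b, 0 ≤ p i b) {p₀ P : ℝ} (hp₀ : 0 < p₀) (hP : ∀ i b, p i b ≤ P)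
    (hpj : ∀ j, ∃ b, p₀ ≤ p j b) {L : ℕ} (hL : 1 ≤ L) (hN : 2 ^ (L + 1) + 2 ≤ N)
    {G A Q Γ : ℝ} (hG : ∀ j x, |ϱ (x + unitSite j) - ϱ x| ≤ G)
    (hA : A = Γ * (P * K ^ 3) * G) (hΓ : 0 < Γ)
    (hQ : ∀ k < L, (4 : ℝ) ^ k * ((2 : ℝ) ^ (k * d))⁻¹ ≤ Q) (c : Site N d → ℝ) :
    Γ * (∑ η, prodBinom ϱ η * genL p (fun η => μ η / prodBinom ϱ η) η -
        dirichletForm p (fun η => μ η / prodBinom ϱ η) (prodBinom ϱ)) +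
      ∑ η, μ η * ∑ x, c x * fluct K (ϱ x) (η x) ≤
    4 * (K / r ^ 2) ^ 2 * relEnt μ (prodBinom ϱ) +
      ∑ x, (c x + Γ * ∑ i, (meanCurrent K p ϱ i (x - unitSite i) - meanCurrent K p ϱ i x)) ^ 2 +
      d * ((4 * (K / r ^ 2) ^ 2 * (A + 1) * relEnt μ (prodBinom ϱ) +
      (K / r ^ 2) ^ 2 * (Fintype.card (Site N d) * (A ^ 2 * ((2 : ℝ) ^ (L * d))⁻¹))) +
      (bondConst K r * d ^ 2 / p₀ * (L ^ 2 / Γ) *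
        (2 * (K / r ^ 2) ^ 2 * A ^ 2 * 4 ^ L * relEnt μ (prodBinom ϱ) +
          (K / r ^ 2) ^ 2 * A ^ 2 * (Fintype.card (Site N d) * Q)) +
      Γ * p₀ * (Fintype.card (Site N d) * G ^ 2))) := by
  have h0' : ∀ x, 0 < ϱ x := fun x => hr.trans_le (h0 x)
  have h1' : ∀ x, ϱ x < K := fun x => (h1 x).trans_lt (by linarith)
  have hd0 : (0 : ℝ) < d := by exact_mod_cast hd
  have hN2 : 2 ≤ N := by have : 0 < 2 ^ (L + 1) := by positivity
                         omega
  set e : Site N d → ℝ := fun x =>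
    c x + Γ * ∑ i, (meanCurrent K p ϱ i (x - unitSite i) - meanCurrent K p ϱ i x) with he
  set a : Fin d → Site N d → ℝ := fun i x =>
    Γ * meanCurrent K p ϱ i x * (ϱ (x + unitSite i) - ϱ x) with ha
  have haA : ∀ i x, |a i x| ≤ A := fun i x => by
    rw [ha, hA, abs_mul, abs_mul, abs_of_pos hΓ]
    have := abs_meanCurrent_le h0' h1' hp hP i x
    have hP0 := (abs_nonneg _).trans this
    exact mul_le_mul (mul_le_mul_of_nonneg_left this hΓ.le) (hG i x) (abs_nonneg _)
      (mul_nonneg hΓ.le hP0)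
  have hlin := entropy_linear (B := K / r ^ 2) (μ := μ)
    (ν := fun x (s : Fin (K + 1)) => binomW K (ϱ x) s.val) (w := fun x => fluct K (ϱ x))
    (fun x s => binomW_pos (h0' x) (h1' x) (Nat.lt_succ_iff.1 s.isLt)) (fun x => sum_binomW)
    (fun x => sum_binomW_fluct (h0' x) (h1' x)) (fun x s => abs_fluct_le hr (h0 x) (h1 x) s)
    hμ hμs e
  have hquad := Finset.sum_le_sum fun i (_ : i ∈ Finset.univ) =>
    quadratic_term_le hr h0 h1 hμ hμs hp hp₀ i hpj hL hN hG (haA i) hΓ hQ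
  have hdecomp : ∀ η : GCfg N d K, Γ * (∑ i, ∑ x, meanCurrent K p ϱ i x *
        ((fluct K (ϱ (x + unitSite i)) (η (x + unitSite i)) - fluct K (ϱ x) (η x)) +
          (ϱ (x + unitSite i) - ϱ x) *
          (fluct K (ϱ x) (η x) * fluct K (ϱ (x + unitSite i)) (η (x + unitSite i))))) +
      ∑ x, c x * fluct K (ϱ x) (η x) = ∑ x, e x * fluct K (ϱ x) (η x) +
      ∑ i, ∑ x, a i x * (fluct K (ϱ x) (η x) *
        fluct K (ϱ (x + unitSite i)) (η (x + unitSite i))) := fun η => by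
    have s1 : ∀ i, ∑ x, meanCurrent K p ϱ i x * fluct K (ϱ (x + unitSite i)) (η (x + unitSite i)) =
        ∑ x, meanCurrent K p ϱ i (x - unitSite i) * fluct K (ϱ x) (η x) := fun i => by
      rw [← Equiv.sum_comp (Equiv.addRight (unitSite (N := N) i))
        (fun x => meanCurrent K p ϱ i (x - unitSite i) * fluct K (ϱ x) (η x))]
      simp only [Equiv.coe_addRight, add_sub_cancel_right]
    have s2 : ∀ i, Γ * ∑ x, meanCurrent K p ϱ i x *
        ((fluct K (ϱ (x + unitSite i)) (η (x + unitSite i)) - fluct K (ϱ x) (η x)) +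
          (ϱ (x + unitSite i) - ϱ x) *
          (fluct K (ϱ x) (η x) * fluct K (ϱ (x + unitSite i)) (η (x + unitSite i)))) =
        ∑ x, Γ * (meanCurrent K p ϱ i (x - unitSite i) - meanCurrent K p ϱ i x) *
          fluct K (ϱ x) (η x) + ∑ x, a i x * (fluct K (ϱ x) (η x) *
        fluct K (ϱ (x + unitSite i)) (η (x + unitSite i))) := fun i => by
      simp only [mul_add, mul_sub, sub_mul, Finset.sum_add_distrib, Finset.sum_sub_distrib, s1,
        mul_assoc, ← Finset.mul_sum, ha]
    rw [Finset.mul_sum, Finset.sum_congr rfl fun i _ => s2 i, Finset.sum_add_distrib,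
      Finset.sum_comm]
    simp only [he, add_mul, Finset.sum_add_distrib, ← Finset.sum_mul, ← Finset.mul_sum]
    ring
  have hLHS : Γ * ∑ η, prodBinom ϱ η * genL p (fun η => μ η / prodBinom ϱ η) η +
      ∑ η, μ η * ∑ x, c x * fluct K (ϱ x) (η x) =
      ∑ η, μ η * ∑ x, e x * fluct K (ϱ x) (η x) +
      ∑ i, ∑ η, μ η * ∑ x, a i x * (fluct K (ϱ x) (η x) *
        fluct K (ϱ (x + unitSite i)) (η (x + unitSite i))) := by
    rw [sum_prodBinom_genL hN2 h0' h1', Finset.mul_sum, ← Finset.sum_add_distrib, Finset.sum_comm,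
      ← Finset.sum_add_distrib]
    refine Finset.sum_congr rfl fun η _ => ?_
    rw [← Finset.mul_sum, ← mul_add, ← hdecomp]
    ring
  have hdir : ∑ _i : Fin d, Γ / d * ∑ j, ∑ b, ∑ x, p j b * bondForm ϱ μ x (siteMove x j b) =
      Γ * dirichletForm p (fun η => μ η / prodBinom ϱ η) (prodBinom ϱ) := by
    rw [dirichletForm_eq, Finset.sum_const, Finset.card_univ, Fintype.card_fin, nsmul_eq_mul]
    field_simp
  rw [mul_sub, sub_add_eq_add_sub, hLHS]
  simp only [add_assoc, Finset.sum_add_distrib] at hquad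
  rw [hdir] at hquad
  simp only [Finset.sum_const, Finset.card_univ, Fintype.card_fin, nsmul_eq_mul] at hquad
  have er : relEnt μ (prodBinom ϱ) = relEnt μ fun η => ∏ i, binomW K (ϱ i) (η i).val := rfl
  rw [← er] at hlin
  linarith

end Static

section EntropyDerivative

variable {N d K : ℕ}

theorem hasDerivAt_binomW {g : ℝ → ℝ} {g' t : ℝ} (hg : HasDerivAt g g' t) (h0 : 0 < g t)
    (h1 : g t < K) (k : Fin (K + 1)) :
    HasDerivAt (fun s => binomW K (g s) k.val)
      (binomW K (g t) k.val * (K * g' * fluct K (g t) k)) t := by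
  unfold binomW
  have hK : (0 : ℝ) < K := h0.trans h1
  have hne : (g t / K) ≠ 0 := (div_pos h0 hK).ne'
  have hne' : 1 - g t / K ≠ 0 := by
    rw [sub_ne_zero]; exact ((div_lt_one hK).2 h1).ne'
  have hkK : k.val ≤ K := Nat.lt_succ_iff.1 k.isLt
  have hpow : ∀ (n : ℕ) (x : ℝ), x ≠ 0 → (n : ℝ) * x ^ (n - 1) = n * x ^ n / x := by
    intro n x hx
    cases n with
    | zero => simp
    | succ n => rw [Nat.add_sub_cancel, pow_succ]; field_simp
  have d1 := (hg.div_const (K : ℝ)).pow k.val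
  have d2 := ((hg.div_const (K : ℝ)).const_sub 1).pow (K - k.val)
  have d3 := (d1.const_mul (K.choose k.val : ℝ)).mul d2
  refine d3.congr_deriv ?_
  simp only [Pi.pow_apply]
  rw [hpow _ _ hne, hpow _ _ hne', Nat.cast_sub hkK]
  unfold fluct
  have hne2 : (K : ℝ) - g t ≠ 0 := (sub_pos.2 h1).ne'
  have e : 1 - g t / K = (K - g t) / K := by field_simp
  generalize (1 - g t / K) ^ (K - k.val) = X at *
  generalize (g t / K) ^ k.val = Y at *
  rw [e]
  have := h0.ne'
  field_simp
  ring

theorem hasDerivAt_prodBinom {ϱ : ℝ → Site N d → ℝ} {ϱ' : Site N d → ℝ} {t : ℝ}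
    (hϱ : ∀ x, HasDerivAt (fun s => ϱ s x) (ϱ' x) t) (h0 : ∀ x, 0 < ϱ t x)
    (h1 : ∀ x, ϱ t x < K) (η : GCfg N d K) :
    HasDerivAt (fun s => prodBinom (ϱ s) η)
      (prodBinom (ϱ t) η * ∑ x, K * ϱ' x * fluct K (ϱ t x) (η x)) t := by
  unfold prodBinom
  have := HasDerivAt.fun_finsetProd (u := Finset.univ) fun x _ =>
    hasDerivAt_binomW (hϱ x) (h0 x) (h1 x) (η x)
  refine this.congr_deriv ?_
  rw [Finset.mul_sum]
  refine Finset.sum_congr rfl fun x _ => ?_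
  rw [smul_eq_mul, ← mul_assoc, Finset.prod_erase_mul _ _ (Finset.mem_univ x)]

theorem hasDerivAt_relEnt {ϱ : ℝ → Site N d → ℝ} {ϱ' : Site N d → ℝ} {t : ℝ}
    (hϱ : ∀ x, HasDerivAt (fun s => ϱ s x) (ϱ' x) t) (h0 : ∀ x, 0 < ϱ t x)
    (h1 : ∀ x, ϱ t x < K) {m : ℝ → GCfg N d K → ℝ} {m' : GCfg N d K → ℝ}
    (hm : ∀ η, HasDerivAt (fun s => m s η) (m' η) t) (hpos : ∀ η, 0 < m t η)
    (hm' : ∑ η, m' η = 0) :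
    HasDerivAt (fun s => relEnt (m s) (prodBinom (ϱ s)))
      (∑ η, m' η * Real.log (m t η / prodBinom (ϱ t) η) +
        ∑ η, m t η * ∑ x, -(K * ϱ' x) * fluct K (ϱ t x) (η x)) t := by
  unfold relEnt
  have hν := prodBinom_pos (K := K) h0 h1
  have hterm : ∀ η, HasDerivAt (fun s => (m s η / prodBinom (ϱ s) η) *
      Real.log (m s η / prodBinom (ϱ s) η) * prodBinom (ϱ s) η)
      (m' η * Real.log (m t η / prodBinom (ϱ t) η) + m' η -
        m t η * ∑ x, K * ϱ' x * fluct K (ϱ t x) (η x)) t := fun η => by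
    have dν := hasDerivAt_prodBinom hϱ h0 h1 η
    have df := (hm η).div dν (hν η).ne'
    have dl := df.log (div_pos (hpos η) (hν η)).ne'
    refine ((df.mul dl).mul dν).congr_deriv ?_
    simp only [Pi.div_apply, Pi.mul_apply]
    have a1 := (hν η).ne'
    have a2 := (hpos η).ne'
    field_simp
    ring
  refine (HasDerivAt.fun_sum fun η _ => hterm η).congr_deriv ?_
  rw [Finset.sum_sub_distrib, Finset.sum_add_distrib, hm', add_zero, sub_eq_add_neg,
    ← Finset.sum_neg_distrib]
  congr 1
  refine Finset.sum_congr rfl fun η _ => ?_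
  rw [← mul_neg, ← Finset.sum_neg_distrib]
  congr 1
  exact Finset.sum_congr rfl fun x _ => by ring

theorem mul_log_sub_log_le {a b : ℝ} (ha : 0 < a) (hb : 0 < b) :
    a * (Real.log b - Real.log a) ≤ -(√b - √a) ^ 2 + (b - a) := by
  obtain ⟨s, hs, rfl⟩ : ∃ s, 0 < s ∧ a = s ^ 2 := ⟨√a, Real.sqrt_pos.2 ha, (Real.sq_sqrt ha.le).symm⟩
  obtain ⟨t, ht, rfl⟩ : ∃ t, 0 < t ∧ b = t ^ 2 := ⟨√b, Real.sqrt_pos.2 hb, (Real.sq_sqrt hb.le).symm⟩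
  rw [Real.sqrt_sq hs.le, Real.sqrt_sq ht.le, Real.log_pow, Real.log_pow]
  have h := Real.log_le_sub_one_of_pos (div_pos ht hs)
  rw [Real.log_div ht.ne' hs.ne'] at h
  have h2 := mul_le_mul_of_nonneg_left h (by positivity : 0 ≤ 2 * s ^ 2)
  have h3 : 2 * s ^ 2 * (t / s - 1) = 2 * s * t - 2 * s ^ 2 := by field_simp
  push_cast
  linarith

/-- The entropy production bound. -/
theorem sum_genL_log_le {p : Fin d → Bool → ℝ} (hp : ∀ i b, 0 ≤ p i b) {μ ν : GCfg N d K → ℝ}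
    (hμ : ∀ η, 0 < μ η) (hν : ∀ η, 0 < ν η) :
    ∑ η, genL p (fun η => Real.log (μ η / ν η)) η * μ η ≤
      ∑ η, ν η * genL p (fun η => μ η / ν η) η - dirichletForm p (fun η => μ η / ν η) ν := by
  have swap : ∀ F : Fin d → Bool → Site N d → GCfg N d K → ℝ,
      ∑ i, ∑ b, ∑ x, ∑ η, F i b x η = ∑ η, ∑ i, ∑ b, ∑ x, F i b x η := fun F => by
    rw [Finset.sum_comm (s := (Finset.univ : Finset (GCfg N d K)))]
    refine Finset.sum_congr rfl fun i _ => ?_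
    rw [Finset.sum_comm (s := (Finset.univ : Finset (GCfg N d K)))]
    refine Finset.sum_congr rfl fun b _ => ?_
    rw [Finset.sum_comm (s := (Finset.univ : Finset (GCfg N d K)))]
  unfold dirichletForm
  rw [swap, ← Finset.sum_sub_distrib]
  refine Finset.sum_le_sum fun η _ => ?_
  unfold genL
  simp only [Finset.sum_mul, Finset.mul_sum, ← Finset.sum_sub_distrib]
  refine Finset.sum_le_sum fun i _ => Finset.sum_le_sum fun b _ => Finset.sum_le_sum fun x _ => ?_
  have hc : 0 ≤ jumpRate p η x i b * ν η := by
    have := mul_nonneg (hp i b) (pairRate_nonneg (x := x) (y := siteMove x i b) η)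
    unfold pairRate at this
    unfold jumpRate
    rw [mul_assoc (p i b)]
    exact mul_nonneg this (hν η).le
  have key := mul_le_mul_of_nonneg_left
    (mul_log_sub_log_le (div_pos (hμ η) (hν η))
    (div_pos (hμ (cfgJump η x (siteMove x i b))) (hν (cfgJump η x (siteMove x i b))))) hc
  have e : μ η = ν η * (μ η / ν η) := (mul_div_cancel₀ _ (hν η).ne').symm
  calc _ = jumpRate p η x i b * ν η * (μ η / ν η * (Real.log
          (μ (cfgJump η x (siteMove x i b)) / ν (cfgJump η x (siteMove x i b))) -
          Real.log (μ η / ν η))) := by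
        linear_combination (jumpRate p η x i b * (Real.log
          (μ (cfgJump η x (siteMove x i b)) / ν (cfgJump η x (siteMove x i b))) -
          Real.log (μ η / ν η))) * e
    _ ≤ _ := key
    _ = _ := by ring

theorem genL_const (p : Fin d → Bool → ℝ) (c : ℝ) (η : GCfg N d K) :
    genL p (fun _ => c) η = 0 := by simp [genL]

/-- Product binomial measures with constant density are invariant. -/
theorem sum_prodBinom_const_genL [NeZero N] (hN : 2 ≤ N) {c : ℝ} (h0 : 0 < c) (h1 : c < K)
    (p : Fin d → Bool → ℝ) (F : GCfg N d K → ℝ) :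
    ∑ η, genL p F η * prodBinom (fun _ : Site N d => c) η = 0 := by
  have hν := prodBinom_pos (N := N) (d := d) (K := K) (ϱ := fun _ => c) (fun _ => h0) (fun _ => h1)
  have h := sum_prodBinom_genL (μ := fun η => F η * prodBinom (fun _ : Site N d => c) η) (p := p) hN
    (ϱ := fun _ : Site N d => c) (fun _ => h0) (fun _ => h1)
  simp only [mul_div_cancel_right₀ _ (hν _).ne'] at h
  rw [Finset.sum_congr rfl fun η _ => mul_comm _ _, h]
  refine Finset.sum_eq_zero fun η _ => mul_eq_zero_of_right _ (Finset.sum_eq_zero fun i _ => ?_)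
  simp only [sub_self, zero_mul, add_zero, meanCurrent, ← Finset.mul_sum, Finset.sum_sub_distrib]
  have := Equiv.sum_comp (Equiv.addRight (unitSite (N := N) i)) (fun x => fluct K c (η x))
  simp only [Equiv.coe_addRight] at this
  rw [this, sub_self, mul_zero]

end EntropyDerivative

section EntropyGronwall

variable {N d K : ℕ} {p : Fin d → Bool → ℝ} {Γ T a b : ℝ} {ϱ ϱ' : ℝ → Site N d → ℝ}
  {m : ℝ → GCfg N d K → ℝ}

theorem relEnt_gronwall_of_pos (hp : ∀ i b, 0 ≤ p i b) (hΓ : 0 < Γ) (ha : 0 ≤ a) (hb : 0 ≤ b)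
    (hϱ : ∀ s ∈ Set.Icc 0 T, ∀ x, HasDerivAt (fun s => ϱ s x) (ϱ' s x) s)
    (h0 : ∀ s ∈ Set.Icc 0 T, ∀ x, 0 < ϱ s x) (h1 : ∀ s ∈ Set.Icc 0 T, ∀ x, ϱ s x < K)
    (hpos : ∀ t, 0 ≤ t → ∀ η, 0 < m t η) (hprob : ∀ t, 0 ≤ t → ∑ η, m t η = 1)
    (hkolm : ∀ (f : GCfg N d K → ℝ) (t : ℝ), 0 ≤ t →
      HasDerivAt (fun s => ∑ η, f η * m s η) (Γ * ∑ η, genL p f η * m t η) t)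
    (hest : ∀ s ∈ Set.Icc 0 T, ∀ σ : GCfg N d K → ℝ, (∀ η, 0 < σ η) → ∑ η, σ η = 1 →
      Γ * (∑ η, prodBinom (ϱ s) η * genL p (fun η => σ η / prodBinom (ϱ s) η) η -
        dirichletForm p (fun η => σ η / prodBinom (ϱ s) η) (prodBinom (ϱ s))) +
      ∑ η, σ η * ∑ x, -(K * ϱ' s x) * fluct K (ϱ s x) (η x) ≤
        a * relEnt σ (prodBinom (ϱ s)) + b) {t : ℝ} (ht : t ∈ Set.Icc 0 T) :
    relEnt (m t) (prodBinom (ϱ t)) ≤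
      Real.exp (a * t) * (relEnt (m 0) (prodBinom (ϱ 0)) + b * t) := by
  classical
  set H : ℝ → ℝ := fun s => relEnt (m s) (prodBinom (ϱ s)) with hH
  set m' : ℝ → GCfg N d K → ℝ := fun s η =>
    Γ * ∑ ζ, genL p (fun ξ => if ξ = η then 1 else 0) ζ * m s ζ with hm'
  have dm : ∀ s, 0 ≤ s → ∀ η, HasDerivAt (fun s => m s η) (m' s η) s := fun s hs η => by
    have := hkolm (fun ξ => if ξ = η then 1 else 0) s hs
    simpa using this
  have dsum : ∀ s, 0 ≤ s → ∀ F : GCfg N d K → ℝ,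
      ∑ η, m' s η * F η = Γ * ∑ η, genL p F η * m s η := fun s hs F => by
    have e1 := HasDerivAt.fun_sum (u := Finset.univ) fun η (_ : η ∈ Finset.univ) =>
      (dm s hs η).const_mul (F η)
    rw [← e1.unique (hkolm F s hs)]
    exact Finset.sum_congr rfl fun η _ => mul_comm _ _
  have hex : ∀ s ∈ Set.Icc 0 T, ∃ D, HasDerivAt H D s ∧ D ≤ a * H s + b := fun s hs => by
    have hz : ∑ η, m' s η = 0 := by
      have := dsum s hs.1 fun _ => 1
      simpa [genL_const] using this
    refine ⟨_, hasDerivAt_relEnt (hϱ s hs) (h0 s hs) (h1 s hs) (dm s hs.1) (hpos s hs.1) hz, ?_⟩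
    rw [dsum s hs.1 fun η => Real.log (m s η / prodBinom (ϱ s) η)]
    refine le_trans ?_ (hest s hs (m s) (hpos s hs.1) (hprob s hs.1))
    have := mul_le_mul_of_nonneg_left (sum_genL_log_le hp (hpos s hs.1)
      (prodBinom_pos (h0 s hs) (h1 s hs))) hΓ.le
    linarith
  choose! D hD hDle using hex
  set g : ℝ → ℝ := fun s => Real.exp (-a * s) * H s - b * s with hg
  have dg : ∀ s ∈ Set.Icc 0 T, HasDerivAt g
      (Real.exp (-a * s) * (D s - a * H s) - b) s := fun s hs => by
    have d1 : HasDerivAt (fun s => Real.exp (-a * s)) (Real.exp (-a * s) * (-a)) s := by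
      simpa using ((hasDerivAt_id s).const_mul (-a)).exp
    refine ((d1.mul (hD s hs)).sub ((hasDerivAt_id s).const_mul b)).congr_deriv ?_
    ring
  have hanti : AntitoneOn g (Set.Icc 0 T) := by
    refine antitoneOn_of_deriv_nonpos (convex_Icc 0 T)
      (fun s hs => (dg s hs).continuousAt.continuousWithinAt)
      (fun s hs => (dg s (interior_subset hs)).differentiableAt.differentiableWithinAt)
      fun s hs => ?_
    have hs' := interior_subset hs
    rw [(dg s hs').deriv]
    have h2 := hDle s hs'
    have h3 : Real.exp (-a * s) ≤ 1 := Real.exp_le_one_iff.2 (by nlinarith [hs'.1])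
    have h4 := Real.exp_pos (-a * s)
    nlinarith [mul_le_mul_of_nonneg_left (show D s - a * H s ≤ b by linarith) h4.le]
  have hfin := hanti ⟨le_rfl, ht.1.trans ht.2⟩ ht ht.1
  simp only [hg, mul_zero, Real.exp_zero, one_mul, sub_zero] at hfin
  have h5 : H t = Real.exp (a * t) * (Real.exp (-a * t) * H t) := by
    rw [← mul_assoc, ← Real.exp_add]; simp
  change H t ≤ _
  rw [h5]
  exact mul_le_mul_of_nonneg_left (by linarith) (Real.exp_pos _).le

theorem continuous_relEnt {Ω : Type*} [Fintype Ω] (ν : Ω → ℝ) :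
    Continuous fun μ : Ω → ℝ => relEnt μ ν := by
  unfold relEnt
  refine continuous_finsetSum _ fun η _ => Continuous.mul ?_ continuous_const
  exact Real.continuous_mul_log.comp ((continuous_apply η).div_const _)

theorem genL_add_mul_sum (f : GCfg N d K → ℝ) (μ ν : GCfg N d K → ℝ) (c e : ℝ) :
    ∑ η, genL p f η * (c * μ η + e * ν η) =
      c * ∑ η, genL p f η * μ η + e * ∑ η, genL p f η * ν η := by
  rw [Finset.mul_sum, Finset.mul_sum, ← Finset.sum_add_distrib]
  exact Finset.sum_congr rfl fun η _ => by ring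

/-- Gronwall bound for the relative entropy along the Kolmogorov equation. -/
theorem relEnt_gronwall [NeZero N] (hN : 2 ≤ N) (hp : ∀ i b, 0 ≤ p i b) (hΓ : 0 < Γ)
    (ha : 0 ≤ a) (hb : 0 ≤ b) {c : ℝ} (hc0 : 0 < c) (hc1 : c < K)
    (hϱ : ∀ s ∈ Set.Icc 0 T, ∀ x, HasDerivAt (fun s => ϱ s x) (ϱ' s x) s)
    (h0 : ∀ s ∈ Set.Icc 0 T, ∀ x, 0 < ϱ s x) (h1 : ∀ s ∈ Set.Icc 0 T, ∀ x, ϱ s x < K)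
    (hprob : ∀ t, 0 ≤ t → (∀ η, 0 ≤ m t η) ∧ ∑ η, m t η = 1)
    (hkolm : ∀ (f : GCfg N d K → ℝ) (t : ℝ), 0 ≤ t →
      HasDerivAt (fun s => ∑ η, f η * m s η) (Γ * ∑ η, genL p f η * m t η) t)
    (hest : ∀ s ∈ Set.Icc 0 T, ∀ σ : GCfg N d K → ℝ, (∀ η, 0 < σ η) → ∑ η, σ η = 1 →
      Γ * (∑ η, prodBinom (ϱ s) η * genL p (fun η => σ η / prodBinom (ϱ s) η) η -
        dirichletForm p (fun η => σ η / prodBinom (ϱ s) η) (prodBinom (ϱ s))) +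
      ∑ η, σ η * ∑ x, -(K * ϱ' s x) * fluct K (ϱ s x) (η x) ≤
        a * relEnt σ (prodBinom (ϱ s)) + b) {t : ℝ} (ht : t ∈ Set.Icc 0 T) :
    0 ≤ relEnt (m t) (prodBinom (ϱ t)) ∧ relEnt (m t) (prodBinom (ϱ t)) ≤
      Real.exp (a * t) * (relEnt (m 0) (prodBinom (ϱ 0)) + b * t) := by
  set ν : GCfg N d K → ℝ := prodBinom fun _ => c with hν
  have hνpos : ∀ η, 0 < ν η := prodBinom_pos (fun _ => hc0) (fun _ => hc1)
  have hνsum : ∑ η, ν η = 1 := by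
    have h := Finset.prod_univ_sum (fun _ : Site N d => (Finset.univ : Finset (Fin (K + 1))))
      (fun _ k => binomW K c k.val)
    rw [Fintype.piFinset_univ] at h
    change ∑ η : Site N d → Fin (K + 1), ∏ x, binomW K c (η x).val = 1
    rw [← h]
    exact Finset.prod_eq_one fun x _ => sum_binomW
  set me : ℝ → ℝ → GCfg N d K → ℝ := fun ε s η => (1 - ε) * m s η + ε * ν η with hme
  have hmepos : ∀ ε ∈ Set.Ioo (0 : ℝ) 1, ∀ s, 0 ≤ s → ∀ η, 0 < me ε s η := fun ε hε s hs η =>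
    add_pos_of_nonneg_of_pos (mul_nonneg (by linarith [hε.2]) ((hprob s hs).1 η))
      (mul_pos hε.1 (hνpos η))
  have hmesum : ∀ ε s, 0 ≤ s → ∑ η, me ε s η = 1 := fun ε s hs => by
    simp only [hme, Finset.sum_add_distrib, ← Finset.mul_sum, hνsum, (hprob s hs).2]
    ring
  have hmekolm : ∀ (ε : ℝ) (f : GCfg N d K → ℝ) (t : ℝ), 0 ≤ t →
      HasDerivAt (fun s => ∑ η, f η * me ε s η) (Γ * ∑ η, genL p f η * me ε t η) t := by
    intro ε f t ht
    have e1 : (fun s => ∑ η, f η * me ε s η) =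
        fun s => (1 - ε) * ∑ η, f η * m s η + ε * ∑ η, f η * ν η := by
      funext s
      rw [Finset.mul_sum, Finset.mul_sum, ← Finset.sum_add_distrib]
      exact Finset.sum_congr rfl fun η _ => by simp only [hme]; ring
    rw [e1]
    refine (((hkolm f t ht).const_mul (1 - ε)).add_const _).congr_deriv ?_
    simp only [hme, genL_add_mul_sum]
    rw [hν, sum_prodBinom_const_genL hN hc0 hc1]
    ring
  have hcont : ∀ s, Tendsto (fun ε => relEnt (me ε s) (prodBinom (ϱ s)))
      (nhdsWithin 0 (Set.Ioi 0)) (nhds (relEnt (m s) (prodBinom (ϱ s)))) := fun s => by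
    have h2 : Continuous fun ε => relEnt (me ε s) (prodBinom (ϱ s)) :=
      (continuous_relEnt _).comp (continuous_pi fun η => by simp only [hme]; fun_prop)
    have h3 := (h2.tendsto 0).mono_left (nhdsWithin_le_nhds (s := Set.Ioi 0))
    have h4 : me 0 s = m s := by funext η; simp [hme]
    rwa [h4] at h3
  have hev : ∀ᶠ ε : ℝ in nhdsWithin 0 (Set.Ioi 0), ε ∈ Set.Ioo (0 : ℝ) 1 :=
    Ioo_mem_nhdsGT one_pos
  constructor
  · refine ge_of_tendsto (hcont t) (hev.mono fun ε hε => ?_)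
    exact relEnt_prodBinom_nonneg (h0 t ht) (h1 t ht) (hmepos ε hε t ht.1) (hmesum ε t ht.1)
  · refine le_of_tendsto_of_tendsto (hcont t) (((hcont 0).add_const (b * t)).const_mul _)
      (hev.mono fun ε hε => ?_)
    exact relEnt_gronwall_of_pos hp hΓ ha hb hϱ h0 h1 (hmepos ε hε) (hmesum ε) (hmekolm ε) hest ht

end EntropyGronwall

section Profile

variable {d : ℕ}

theorem exists_abs_le_of_periodic {f : ℝ × (Fin d → ℝ) → ℝ} (hf : Continuous f)
    (hper : ∀ (q : ℝ × (Fin d → ℝ)) (z : Fin d → ℤ), f (q + (0, fun j => (z j : ℝ))) = f q)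
    (T : ℝ) : ∃ C, ∀ s ∈ Set.Icc 0 T, ∀ u, |f (s, u)| ≤ C := by
  have hc : IsCompact (Set.Icc (0 : ℝ) T ×ˢ Set.Icc (0 : Fin d → ℝ) 1) :=
    isCompact_Icc.prod isCompact_Icc
  obtain ⟨C, hC⟩ := hc.exists_bound_of_continuousOn hf.continuousOn
  refine ⟨C, fun s hs u => ?_⟩
  have h1 := hper (s, fun j => Int.fract (u j)) fun j => ⌊u j⌋
  have h2 : ((s, fun j => Int.fract (u j)) + ((0 : ℝ), fun j => ((⌊u j⌋ : ℤ) : ℝ)) :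
      ℝ × (Fin d → ℝ)) = (s, u) := by
    ext j
    · simp
    · simp
  rw [h2] at h1
  rw [h1]
  refine hC _ ⟨hs, ?_, ?_⟩
  · exact fun j => Int.fract_nonneg _
  · exact fun j => (Int.fract_lt_one _).le

theorem fderiv_add_period {f : ℝ × (Fin d → ℝ) → ℝ}
    (hper : ∀ (q : ℝ × (Fin d → ℝ)) (z : Fin d → ℤ), f (q + (0, fun j => (z j : ℝ))) = f q)
    (v q : ℝ × (Fin d → ℝ)) (z : Fin d → ℤ) :
    fderiv ℝ f (q + (0, fun j => (z j : ℝ))) v = fderiv ℝ f q v := by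
  rw [← fderiv_comp_add_right]
  congr 2
  exact funext fun q => hper q z

theorem abs_taylor_two_le {g g' g'' : ℝ → ℝ} {C : ℝ} (h1 : ∀ h, HasDerivAt g (g' h) h)
    (h2 : ∀ h, HasDerivAt g' (g'' h) h) (hC : ∀ h, |g'' h| ≤ C) (h : ℝ) :
    |g h - g 0 - h * g' 0| ≤ C * h ^ 2 := by
  have hb : ∀ y, |g' y - g' 0| ≤ C * |y| := fun y => by
    have := Convex.norm_image_sub_le_of_norm_hasDerivWithin_le (f := g') (s := Set.univ)
      (fun x _ => (h2 x).hasDerivWithinAt) (fun x _ => hC x) convex_univ (Set.mem_univ 0)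
      (Set.mem_univ y)
    simpa using this
  have hC0 : 0 ≤ C := (abs_nonneg _).trans (hC 0)
  have := Convex.norm_image_sub_le_of_norm_hasDerivWithin_le (f := fun y => g y - y * g' 0)
    (f' := fun y => g' y - 1 * g' 0) (s := Set.uIcc 0 h) (C := C * |h|)
    (fun x _ => ((h1 x).sub ((hasDerivAt_id x).mul_const (g' 0))).hasDerivWithinAt)
    (fun x hx => by
      rw [one_mul]
      refine (hb x).trans (mul_le_mul_of_nonneg_left ?_ hC0)
      simpa using Set.abs_sub_left_of_mem_uIcc hx) (convex_uIcc 0 h) Set.left_mem_uIcc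
    Set.right_mem_uIcc
  simp only [Real.norm_eq_abs, sub_zero, zero_mul] at this
  rw [mul_assoc, ← sq, sq_abs] at this
  rwa [sub_right_comm] at this

/-- The directional derivative in the space coordinate `i` of a function of time and space. -/
noncomputable def spaceDeriv (F : ℝ × (Fin d → ℝ) → ℝ) (i : Fin d) (q : ℝ × (Fin d → ℝ)) : ℝ :=
  fderiv ℝ F q (0, Pi.single i 1)

theorem hasDerivAt_add_single {F : ℝ × (Fin d → ℝ) → ℝ} (hF : Differentiable ℝ F) (s : ℝ)
    (u : Fin d → ℝ) (i : Fin d) (h : ℝ) :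
    HasDerivAt (fun h => F (s, u + Pi.single i h)) (spaceDeriv F i (s, u + Pi.single i h)) h := by
  have h1 : HasDerivAt (fun h : ℝ => ((s, u + Pi.single i h) : ℝ × (Fin d → ℝ)))
      (0, Pi.single i 1) h := by
    refine (hasDerivAt_const h s).prodMk (HasDerivAt.const_add u ?_)
    rw [hasDerivAt_pi]
    intro j
    by_cases hj : j = i
    · subst hj; simpa using hasDerivAt_id' h
    · simpa [Pi.single_eq_of_ne hj] using hasDerivAt_const h (0 : ℝ)
  exact (hF _).hasFDerivAt.comp_hasDerivAt h h1

theorem contDiff_spaceDeriv {F : ℝ × (Fin d → ℝ) → ℝ} (hF : ContDiff ℝ (⊤ : ℕ∞) F) (i : Fin d) :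
    ContDiff ℝ (⊤ : ℕ∞) (spaceDeriv F i) :=
  (hF.fderiv_right (m := (⊤ : ℕ∞)) (by simp)).clm_apply contDiff_const

theorem exists_space_bounds {F : ℝ × (Fin d → ℝ) → ℝ} (hF : ContDiff ℝ (⊤ : ℕ∞) F)
    (hper : ∀ (q : ℝ × (Fin d → ℝ)) (z : Fin d → ℤ), F (q + (0, fun j => (z j : ℝ))) = F q)
    (T : ℝ) : ∃ C, 0 ≤ C ∧ ∀ s ∈ Set.Icc 0 T, ∀ u, |F (s, u)| ≤ C ∧
      (∀ i, |spaceDeriv F i (s, u)| ≤ C) ∧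
      ∀ i h, |F (s, u + Pi.single i h) - F (s, u) - h * spaceDeriv F i (s, u)| ≤ C * h ^ 2 := by
  obtain ⟨C₀, hC₀⟩ := exists_abs_le_of_periodic hF.continuous hper T
  have per1 : ∀ (i : Fin d) (q : ℝ × (Fin d → ℝ)) (z : Fin d → ℤ),
      spaceDeriv F i (q + (0, fun j => (z j : ℝ))) = spaceDeriv F i q :=
    fun i q z => fderiv_add_period hper (0, Pi.single i 1) q z
  have c1 := fun i => contDiff_spaceDeriv hF i
  choose C₁ hC₁ using fun i => exists_abs_le_of_periodic (c1 i).continuous (per1 i) T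
  have per2 : ∀ (i : Fin d) (q : ℝ × (Fin d → ℝ)) (z : Fin d → ℤ),
      spaceDeriv (spaceDeriv F i) i (q + (0, fun j => (z j : ℝ))) =
        spaceDeriv (spaceDeriv F i) i q :=
    fun i q z => fderiv_add_period (per1 i) (0, Pi.single i 1) q z
  choose C₂ hC₂ using fun i =>
    exists_abs_le_of_periodic (contDiff_spaceDeriv (c1 i) i).continuous (per2 i) T
  have l1 : ∀ i, C₁ i ≤ ∑ j, |C₁ j| := fun i => (le_abs_self _).trans
    (Finset.single_le_sum (f := fun j => |C₁ j|) (fun _ _ => abs_nonneg _) (Finset.mem_univ i))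
  have l2 : ∀ i, C₂ i ≤ ∑ j, |C₂ j| := fun i => (le_abs_self _).trans
    (Finset.single_le_sum (f := fun j => |C₂ j|) (fun _ _ => abs_nonneg _) (Finset.mem_univ i))
  have n1 : 0 ≤ ∑ j, |C₁ j| := Finset.sum_nonneg fun _ _ => abs_nonneg _
  have n2 : 0 ≤ ∑ j, |C₂ j| := Finset.sum_nonneg fun _ _ => abs_nonneg _
  have n0 := abs_nonneg C₀
  have l0 := le_abs_self C₀
  refine ⟨|C₀| + ∑ j, |C₁ j| + ∑ j, |C₂ j|, by positivity, fun s hs u => ⟨?_, fun i => ?_,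
    fun i h => ?_⟩⟩
  · exact (hC₀ s hs u).trans (by linarith)
  · exact (hC₁ i s hs u).trans (by linarith [l1 i])
  · have := abs_taylor_two_le (g := fun h => F (s, u + Pi.single i h))
      (hasDerivAt_add_single (hF.differentiable (by simp)) s u i)
      (hasDerivAt_add_single ((c1 i).differentiable (by simp)) s u i)
      (fun h => hC₂ i s hs (u + Pi.single i h)) h
    simp only [Pi.single_zero, add_zero] at this
    exact this.trans (mul_le_mul_of_nonneg_right (by linarith [l2 i]) (sq_nonneg h))

theorem fderiv_prod_apply {F : ℝ × (Fin d → ℝ) → ℝ} (q : ℝ × (Fin d → ℝ)) (a : ℝ)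
    (v : Fin d → ℝ) :
    fderiv ℝ F q (a, v) = a * fderiv ℝ F q (1, 0) + ∑ i, v i * spaceDeriv F i q := by
  have h : ((a, v) : ℝ × (Fin d → ℝ)) = a • ((1, 0) : ℝ × (Fin d → ℝ)) +
      ∑ i, v i • ((0, Pi.single i 1) : ℝ × (Fin d → ℝ)) := by
    ext j
    · simp [Prod.fst_sum]
    · simp [Prod.snd_sum, Finset.sum_apply, Pi.single_apply]
  rw [h, map_add, map_sum, map_smul]
  simp only [map_smul, smul_eq_mul, spaceDeriv]

end Profile

section LatticeProfile

variable {d : ℕ}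

theorem siteCoord_add_unitSite {N : ℕ} [NeZero N] (x : Site N d) (i : Fin d) :
    ∃ z : Fin d → ℤ, siteCoord (x + unitSite i) =
      siteCoord x + Pi.single i (N : ℝ)⁻¹ + fun j => (z j : ℝ) := by
  have hN : (N : ℝ) ≠ 0 := Nat.cast_ne_zero.2 (NeZero.ne N)
  obtain ⟨q, hq⟩ : ∃ q : ℕ, ((x + unitSite i : Site N d) i).val + N * q = (x i).val + 1 := by
    refine ⟨((x i).val + 1) / N, ?_⟩
    have h1 : ((x + unitSite i : Site N d) i).val = ((x i).val + 1) % N := by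
      simp [unitSite, Fin.val_add, Nat.add_mod_mod]
    rw [h1]
    exact Nat.mod_add_div _ N
  have h3 : (((x + unitSite i : Site N d) i).val : ℝ) + N * q = (x i).val + 1 := by
    exact_mod_cast hq
  refine ⟨Pi.single i (-(q : ℤ)), funext fun j => ?_⟩
  by_cases hj : j = i
  · subst hj
    simp only [siteCoord, Pi.add_apply, Pi.single_eq_same, Int.cast_neg, Int.cast_natCast] at h3 ⊢
    field_simp
    linarith
  · simp [siteCoord, unitSite, Pi.single_eq_of_ne hj]

theorem abs_current_sub_le {K v₀ v₁ v₂ D ε B P a b : ℝ} (hK : 0 ≤ K) (h0 : |v₀ - v₁ + D| ≤ ε)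
    (h2 : |v₂ - v₁ - D| ≤ ε) (h1 : |v₁| ≤ B) (ha : |a| ≤ P) (hb : |b| ≤ P) :
    |(a * (K * v₀ * (K - v₁)) - b * (K * v₁ * (K - v₀))) -
      (a * (K * v₁ * (K - v₂)) - b * (K * v₂ * (K - v₁))) -
      K * ((a - b) * (D * (2 * v₁ - K)))| ≤ K * (2 * P * (K + 2 * B)) * ε := by
  set ε₀ := v₀ - v₁ + D
  set ε₂ := v₂ - v₁ - D
  have key : (a * (K * v₀ * (K - v₁)) - b * (K * v₁ * (K - v₀))) -
      (a * (K * v₁ * (K - v₂)) - b * (K * v₂ * (K - v₁))) -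
      K * ((a - b) * (D * (2 * v₁ - K))) =
      K * (a * (K * ε₀ - v₁ * (ε₀ - ε₂)) - b * (-K * ε₂ - v₁ * (ε₀ - ε₂))) := by
    simp only [ε₀, ε₂]; ring
  have hε : 0 ≤ ε := (abs_nonneg _).trans h0
  have hB : 0 ≤ B := (abs_nonneg _).trans h1
  have hP : 0 ≤ P := (abs_nonneg _).trans ha
  have e02 : |v₁ * (ε₀ - ε₂)| ≤ B * (2 * ε) := by
    rw [abs_mul]
    refine mul_le_mul h1 ?_ (abs_nonneg _) hB
    have := abs_sub ε₀ ε₂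
    linarith
  have m0 : |K * ε₀ - v₁ * (ε₀ - ε₂)| ≤ (K + 2 * B) * ε := by
    have := abs_sub (K * ε₀) (v₁ * (ε₀ - ε₂))
    rw [abs_mul K, abs_of_nonneg hK] at this
    nlinarith [mul_le_mul_of_nonneg_left h0 hK]
  have m2 : |-K * ε₂ - v₁ * (ε₀ - ε₂)| ≤ (K + 2 * B) * ε := by
    have := abs_sub (-K * ε₂) (v₁ * (ε₀ - ε₂))
    rw [abs_mul (-K), abs_neg, abs_of_nonneg hK] at this
    nlinarith [mul_le_mul_of_nonneg_left h2 hK]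
  have hnn : 0 ≤ (K + 2 * B) * ε := by positivity
  rw [key, abs_mul, abs_of_nonneg hK, mul_assoc]
  refine mul_le_mul_of_nonneg_left ((abs_sub _ _).trans ?_) hK
  rw [abs_mul, abs_mul]
  nlinarith [mul_le_mul ha m0 (abs_nonneg _) hP, mul_le_mul hb m2 (abs_nonneg _) hP]

theorem deriv_sq_update {F : ℝ × (Fin d → ℝ) → ℝ} (hF : Differentiable ℝ F) (s : ℝ)
    (u : Fin d → ℝ) (i : Fin d) :
    deriv (fun h => F (s, Function.update u i h) ^ 2) (u i) =
      2 * F (s, u) * spaceDeriv F i (s, u) := by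
  have h1 : HasDerivAt (fun h => F (s, Function.update u i h)) (spaceDeriv F i (s, u)) (u i) := by
    have h2 : HasDerivAt (fun h : ℝ => ((s, Function.update u i h) : ℝ × (Fin d → ℝ)))
        (0, Pi.single i 1) (u i) :=
      (hasDerivAt_const _ s).prodMk (hasDerivAt_update u i (u i))
    have h3 := (hF (s, Function.update u i (u i))).hasFDerivAt.comp_hasDerivAt (u i) h2
    rw [Function.update_eq_self] at h3
    exact h3
  have := (h1.fun_pow 2).deriv
  simp only [Function.update_eq_self] at this
  simpa using this

theorem deriv_time {F : ℝ × (Fin d → ℝ) → ℝ} (hF : Differentiable ℝ F) (s : ℝ)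
    (u : Fin d → ℝ) : deriv (fun s' => F (s', u)) s = fderiv ℝ F (s, u) (1, 0) := by
  have h2 : HasDerivAt (fun s' : ℝ => ((s', u) : ℝ × (Fin d → ℝ))) (1, 0) s :=
    (hasDerivAt_id' s).prodMk (hasDerivAt_const s u)
  exact ((hF (s, u)).hasFDerivAt.comp_hasDerivAt s h2).deriv

end LatticeProfile

section ProfileEstimates

variable {d K : ℕ}

theorem exists_profile_estimates {p : Fin d → Bool → ℝ} {ϱs α κ T : ℝ}
    (hϱs : ϱs ∈ Set.Ioo (0 : ℝ) K) (hα : 0 < α) (hκα : κ ≤ α) {ρ : ℝ → (Fin d → ℝ) → ℝ}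
    (hρsmooth : ContDiff ℝ (⊤ : ℕ∞) (fun q : ℝ × (Fin d → ℝ) => ρ q.1 q.2))
    (hρper : ∀ (s : ℝ) (u : Fin d → ℝ) (z : Fin d → ℤ), ρ s (fun j => u j + z j) = ρ s u)
    (hρpde : ∀ s ∈ Set.Icc (0 : ℝ) T, ∀ u : Fin d → ℝ,
      deriv (fun s' => ρ s' u) s = ∑ i, (p i true - p i false) *
        deriv (fun h => ρ s (Function.update u i h) ^ 2) (u i)) :
    ∃ C, 0 ≤ C ∧ ∀ (N : ℕ) [NeZero N], ∀ R : ℝ → Site N d → ℝ,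
      (∀ t x, R t x = profileGE d K ϱs α κ (fun i => p i true - p i false) ρ N t (siteCoord x)) →
      ∀ t ∈ Set.Icc 0 T, (∀ x, |R t x - ϱs| ≤ C * (N : ℝ) ^ (-α)) ∧
        (∀ i x, |R t (x + unitSite i) - R t x| ≤ C * (N : ℝ) ^ (-1 - α)) ∧
        ∀ x, DifferentiableAt ℝ (fun s => R s x) t ∧
          |-(K * deriv (fun s => R s x) t) + (N : ℝ) ^ (1 + κ) *
            ∑ i, (meanCurrent K p (R t) i (x - unitSite i) - meanCurrent K p (R t) i x)| ≤
              C * (N : ℝ) ^ (κ - 1 - α) := by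
  set F : ℝ × (Fin d → ℝ) → ℝ := fun q => ρ q.1 q.2 with hF
  have hdiff : Differentiable ℝ F := hρsmooth.differentiable (by simp)
  have hper : ∀ (q : ℝ × (Fin d → ℝ)) (z : Fin d → ℤ), F (q + (0, fun j => (z j : ℝ))) = F q :=
    fun q z => by
      simp only [hF, Prod.fst_add, Prod.snd_add, add_zero]
      exact hρper q.1 q.2 z
  obtain ⟨C, hC0, hC⟩ := exists_space_bounds hρsmooth hper T
  set P : ℝ := ∑ i, ∑ b, |p i b| with hPdef
  have hP : ∀ i b, |p i b| ≤ P := fun i b =>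
    (Finset.single_le_sum (f := fun b => |p i b|) (fun _ _ => abs_nonneg _)
      (Finset.mem_univ b)).trans (Finset.single_le_sum (f := fun i => ∑ b, |p i b|)
        (fun _ _ => Finset.sum_nonneg fun _ _ => abs_nonneg _) (Finset.mem_univ i))
  have hP0 : 0 ≤ P := Finset.sum_nonneg fun _ _ => Finset.sum_nonneg fun _ _ => abs_nonneg _
  set C' : ℝ := d * (K * (2 * P * (K + 2 * (K + C))) * C) with hC'
  have hC'0 : 0 ≤ C' := by positivity
  refine ⟨2 * C + C', by positivity, fun N _ R hR t ht => ?_⟩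
  have hN0 : (N : ℝ) ≠ 0 := Nat.cast_ne_zero.2 (NeZero.ne N)
  have hN1 : (1 : ℝ) ≤ N := by exact_mod_cast NeZero.one_le
  have hNpos : (0 : ℝ) < N := by linarith
  set A : ℝ := (N : ℝ) ^ (-α) with hA
  set k : ℝ := (N : ℝ) ^ κ with hk
  have hApos : 0 < A := Real.rpow_pos_of_pos hNpos _
  have hkpos : 0 < k := Real.rpow_pos_of_pos hNpos _
  have hA1 : A ≤ 1 := Real.rpow_le_one_of_one_le_of_nonpos hN1 (by linarith)
  have ekA : (N : ℝ) ^ (κ - α) = k * A := by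
    rw [sub_eq_add_neg, Real.rpow_add hNpos]
  have enk : (N : ℝ) ^ (1 + κ) = N * k := by rw [Real.rpow_add hNpos, Real.rpow_one]
  have eG : (N : ℝ) ^ (-1 - α) = (N : ℝ)⁻¹ * A := by
    rw [sub_eq_add_neg, Real.rpow_add hNpos, Real.rpow_neg_one]
  have eE : (N : ℝ) ^ (κ - 1 - α) = k * (N : ℝ)⁻¹ * A := by
    rw [sub_eq_add_neg, Real.rpow_add hNpos, sub_eq_add_neg, Real.rpow_add hNpos,
      Real.rpow_neg_one]
  have hkA1 : k * A ≤ 1 := by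
    rw [← ekA]; exact Real.rpow_le_one_of_one_le_of_nonpos hN1 (by linarith)
  set s : ℝ := k * A * t with hs
  have hsT : s ∈ Set.Icc 0 T :=
    ⟨mul_nonneg (by positivity) ht.1, (mul_le_of_le_one_left ht.1 hkA1).trans ht.2⟩
  set w : Site N d → Fin d → ℝ := fun x j =>
    siteCoord x j - k * ((K : ℝ) - 2 * ϱs) * t * (p j true - p j false) with hw
  have hRF : ∀ x, R t x = ϱs + A * F (s, w x) := fun x => by
    rw [hR, profileGE, ekA]
  have hplus : ∀ x i, F (s, w (x + unitSite i)) = F (s, w x + Pi.single i (N : ℝ)⁻¹) :=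
    fun x i => by
      obtain ⟨z, hz⟩ := siteCoord_add_unitSite x i
      refine (congrArg F ?_).trans (hper _ z)
      ext j
      · simp
      · simp only [hw, hz, Pi.add_apply, Prod.snd_add]; ring
  have hminus : ∀ x i, F (s, w (x - unitSite i)) = F (s, w x + Pi.single i (-(N : ℝ)⁻¹)) :=
    fun x i => by
      obtain ⟨z, hz⟩ := siteCoord_add_unitSite (x - unitSite i) i
      rw [sub_add_cancel] at hz
      refine ((congrArg F ?_).trans (hper _ z)).symm
      ext j
      · simp
      · simp only [hw, hz, Pi.add_apply, Prod.snd_add, Pi.single_neg, Pi.neg_apply]; ring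
  have hF1 : ∀ x, |F (s, w x)| ≤ C := fun x => (hC s hsT _).1
  set δ : Fin d → Site N d → ℝ := fun i x => spaceDeriv F i (s, w x) with hδ
  have hδC : ∀ i x, |δ i x| ≤ C := fun i x => (hC s hsT _).2.1 i
  have hNinv : 0 < (N : ℝ)⁻¹ := inv_pos.2 hNpos
  have hNinv1 : (N : ℝ)⁻¹ ≤ 1 := inv_le_one_of_one_le₀ hN1
  set ε : ℝ := A * (C * ((N : ℝ)⁻¹) ^ 2) with hε
  have hstep : ∀ i x, |R t (x + unitSite i) - R t x - (N : ℝ)⁻¹ * A * δ i x| ≤ ε := fun i x => by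
    have := (hC s hsT (w x)).2.2 i (N : ℝ)⁻¹
    rw [hRF, hRF, hplus, show ϱs + A * F (s, w x + Pi.single i (N : ℝ)⁻¹) - (ϱs + A * F (s, w x)) -
      (N : ℝ)⁻¹ * A * δ i x = A * (F (s, w x + Pi.single i (N : ℝ)⁻¹) - F (s, w x) -
        (N : ℝ)⁻¹ * δ i x) by ring, abs_mul, abs_of_pos hApos]
    exact mul_le_mul_of_nonneg_left this hApos.le
  have hstep' : ∀ i x, |R t (x - unitSite i) - R t x + (N : ℝ)⁻¹ * A * δ i x| ≤ ε := fun i x => by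
    have := (hC s hsT (w x)).2.2 i (-(N : ℝ)⁻¹)
    rw [hRF, hRF, hminus, show ϱs + A * F (s, w x + Pi.single i (-(N : ℝ)⁻¹)) -
      (ϱs + A * F (s, w x)) + (N : ℝ)⁻¹ * A * δ i x =
        A * (F (s, w x + Pi.single i (-(N : ℝ)⁻¹)) - F (s, w x) -
        -(N : ℝ)⁻¹ * δ i x) by ring, abs_mul, abs_of_pos hApos]
    rw [neg_sq] at this
    exact mul_le_mul_of_nonneg_left this hApos.le
  refine ⟨fun x => ?_, fun i x => ?_, fun x => ?_⟩
  · rw [hRF, add_sub_cancel_left, abs_mul, abs_of_pos hApos, mul_comm]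
    exact mul_le_mul_of_nonneg_right ((hF1 x).trans (by linarith)) hApos.le
  · rw [eG]
    have h1 : |(N : ℝ)⁻¹ * A * δ i x| ≤ (N : ℝ)⁻¹ * A * C := by
      rw [abs_mul, abs_of_pos (by positivity)]
      exact mul_le_mul_of_nonneg_left (hδC i x) (by positivity)
    have h2 : ε ≤ (N : ℝ)⁻¹ * A * C := by
      rw [hε, sq]
      calc A * (C * ((N : ℝ)⁻¹ * (N : ℝ)⁻¹)) = (N : ℝ)⁻¹ * A * C * (N : ℝ)⁻¹ := by ring
        _ ≤ _ := mul_le_of_le_one_right (by positivity) hNinv1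
    have h3 := abs_add_le (R t (x + unitSite i) - R t x - (N : ℝ)⁻¹ * A * δ i x)
      ((N : ℝ)⁻¹ * A * δ i x)
    rw [sub_add_cancel] at h3
    have h4 := hstep i x
    have h5 : 0 ≤ C' * ((N : ℝ)⁻¹ * A) := by positivity
    nlinarith
  · have hd1 : HasDerivAt (fun t => R t x) (A * (k * A * fderiv ℝ F (s, w x) (1, 0) +
        ∑ i, -(k * ((K : ℝ) - 2 * ϱs) * (p i true - p i false)) * δ i x)) t := by
      rw [hδ, ← fderiv_prod_apply]
      have h1 : HasDerivAt (fun t : ℝ => ((k * A * t, fun j =>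
          siteCoord x j - k * ((K : ℝ) - 2 * ϱs) * t * (p j true - p j false)) :
            ℝ × (Fin d → ℝ)))
          (k * A, fun i => -(k * ((K : ℝ) - 2 * ϱs) * (p i true - p i false))) t := by
        refine HasDerivAt.prodMk ?_ ?_
        · simpa using (hasDerivAt_id' t).const_mul (k * A)
        · rw [hasDerivAt_pi]
          intro j
          have := (((hasDerivAt_id' t).const_mul (k * ((K : ℝ) - 2 * ϱs))).mul_const
            (p j true - p j false)).const_sub (siteCoord x j)
          simpa using this
      have h2 := (((hdiff (s, w x)).hasFDerivAt.comp_hasDerivAt t h1).const_mul A).const_add ϱs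
      refine h2.congr_of_eventuallyEq (Eventually.of_forall fun t' => ?_)
      simp only [hR, profileGE, ekA]
      rfl
    have htime : fderiv ℝ F (s, w x) (1, 0) =
        ∑ i, (p i true - p i false) * (2 * F (s, w x) * δ i x) := by
      rw [← deriv_time hdiff]
      refine (hρpde s hsT (w x)).trans (Finset.sum_congr rfl fun i _ => ?_)
      rw [hδ, ← deriv_sq_update hdiff]
    refine ⟨hd1.differentiableAt, ?_⟩
    have hmain : -(K * deriv (fun s => R s x) t) + (N : ℝ) ^ (1 + κ) *
        ∑ i, (meanCurrent K p (R t) i (x - unitSite i) - meanCurrent K p (R t) i x) =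
        N * k * ∑ i, (meanCurrent K p (R t) i (x - unitSite i) - meanCurrent K p (R t) i x -
          K * ((p i true - p i false) * ((N : ℝ)⁻¹ * A * δ i x * (2 * R t x - K)))) := by
      have hdrift : K * (A * (k * A * ∑ i, (p i true - p i false) * (2 * F (s, w x) * δ i x) +
          ∑ i, -(k * ((K : ℝ) - 2 * ϱs) * (p i true - p i false)) * δ i x)) = N * k * ∑ i,
          K * ((p i true - p i false) * ((N : ℝ)⁻¹ * A * δ i x * (2 * R t x - K))) := by
        simp only [Finset.mul_sum, mul_add, ← Finset.sum_add_distrib]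
        refine Finset.sum_congr rfl fun i _ => ?_
        rw [hRF]
        field_simp
        ring
      rw [hd1.deriv, htime, enk, hdrift]
      simp only [Finset.sum_sub_distrib]
      ring
    have hB : |R t x| ≤ K + C := by
      rw [hRF]
      have h1 := abs_add_le ϱs (A * F (s, w x))
      rw [abs_mul, abs_of_pos hApos, abs_of_pos hϱs.1] at h1
      have h2 : A * |F (s, w x)| ≤ 1 * C := mul_le_mul hA1 (hF1 x) (abs_nonneg _) zero_le_one
      linarith [hϱs.2]
    rw [hmain, eE, abs_mul, abs_of_pos (by positivity)]
    have hsum : |∑ i, (meanCurrent K p (R t) i (x - unitSite i) - meanCurrent K p (R t) i x -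
          K * ((p i true - p i false) * ((N : ℝ)⁻¹ * A * δ i x * (2 * R t x - K))))| ≤
        d * (K * (2 * P * (K + 2 * (K + C))) * ε) := by
      refine (Finset.abs_sum_le_sum_abs _ _).trans ((Finset.sum_le_card_nsmul _ _ _
        fun i _ => ?_).trans_eq (by rw [Finset.card_univ, Fintype.card_fin, nsmul_eq_mul]))
      unfold meanCurrent
      rw [sub_add_cancel]
      exact abs_current_sub_le (Nat.cast_nonneg K) (hstep' i x) (hstep i x) hB (hP i true)
        (hP i false)
    calc _ ≤ N * k * (d * (K * (2 * P * (K + 2 * (K + C))) * ε)) :=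
          mul_le_mul_of_nonneg_left hsum (by positivity)
      _ = C' * (k * (N : ℝ)⁻¹ * A) := by rw [hC', hε]; field_simp
      _ ≤ _ := mul_le_mul_of_nonneg_right (by linarith) (by positivity)

end ProfileEstimates

section Scale

theorem tendsto_natCast_rpow_neg {s : ℝ} (hs : s < 0) :
    Tendsto (fun N : ℕ => (N : ℝ) ^ s) atTop (nhds 0) := by
  have := (tendsto_rpow_neg_atTop (neg_pos.2 hs)).comp (tendsto_natCast_atTop_atTop (R := ℝ))
  simpa [Function.comp_def] using this

theorem tendsto_natCast_rpow_pos {s : ℝ} (hs : 0 < s) :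
    Tendsto (fun N : ℕ => (N : ℝ) ^ s) atTop atTop :=
  (tendsto_rpow_atTop hs).comp tendsto_natCast_atTop_atTop

/-- A dyadic mesoscopic scale comparable with `N ^ β`. -/
theorem exists_dyadic_scale {β : ℝ} (hβ0 : 0 < β) (hβ1 : β < 1) :
    ∃ L : ℕ → ℕ, (∀ᶠ N in atTop, 1 ≤ L N ∧ 2 ^ (L N + 1) + 2 ≤ N ∧ (2 : ℝ) ^ L N ≤ (N : ℝ) ^ β ∧
      (N : ℝ) ^ β ≤ 2 * 2 ^ L N) ∧
      ∀ ε > 0, ∀ᶠ N in atTop, (L N : ℝ) ^ 2 ≤ (4 / ε) ^ 2 * (N : ℝ) ^ ε := by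
  have hlow : ∀ᶠ N : ℕ in atTop, (2 : ℝ) ^ Nat.log 2 ⌊(N : ℝ) ^ β⌋₊ ≤ (N : ℝ) ^ β := by
    filter_upwards [(tendsto_natCast_rpow_pos hβ0).eventually_ge_atTop 2] with N hN
    have h1 : ⌊(N : ℝ) ^ β⌋₊ ≠ 0 := by
      have : 2 ≤ ⌊(N : ℝ) ^ β⌋₊ := Nat.le_floor (by simpa using hN)
      omega
    have h2 : ((2 ^ Nat.log 2 ⌊(N : ℝ) ^ β⌋₊ : ℕ) : ℝ) ≤ (⌊(N : ℝ) ^ β⌋₊ : ℝ) := by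
      exact_mod_cast Nat.pow_log_le_self 2 h1
    push_cast at h2
    exact h2.trans (Nat.floor_le (by positivity))
  refine ⟨fun N => Nat.log 2 ⌊(N : ℝ) ^ β⌋₊, ?_, fun ε hε => ?_⟩
  · filter_upwards [hlow, (tendsto_natCast_rpow_pos hβ0).eventually_ge_atTop 2,
      (tendsto_natCast_rpow_pos (sub_pos.2 hβ1)).eventually_ge_atTop 4,
      eventually_ge_atTop 1] with N hl h2 h4 hN
    have hNpos : (0 : ℝ) < N := by exact_mod_cast hN
    refine ⟨?_, ?_, hl, ?_⟩
    · exact Nat.log_pos one_lt_two (Nat.le_floor (by simpa using h2))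
    · have h5 : (N : ℝ) ^ (1 - β) * (N : ℝ) ^ β = N := by
        rw [← Real.rpow_add hNpos, sub_add_cancel, Real.rpow_one]
      have h6 : ((2 ^ (Nat.log 2 ⌊(N : ℝ) ^ β⌋₊ + 1) + 2 : ℕ) : ℝ) ≤ N := by
        push_cast
        rw [pow_succ]
        nlinarith
      exact_mod_cast h6
    · have h5 := Nat.lt_pow_succ_log_self one_lt_two ⌊(N : ℝ) ^ β⌋₊
      have h6 : ((⌊(N : ℝ) ^ β⌋₊ + 1 : ℕ) : ℝ) ≤ ((2 ^ (Nat.log 2 ⌊(N : ℝ) ^ β⌋₊ + 1) : ℕ) : ℝ) := by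
        exact_mod_cast h5
      push_cast at h6
      rw [pow_succ] at h6
      linarith [Nat.lt_floor_add_one ((N : ℝ) ^ β)]
  · filter_upwards [hlow, eventually_ge_atTop 1] with N hl hN
    have hN1 : (1 : ℝ) ≤ N := by exact_mod_cast hN
    have hNpos : (0 : ℝ) < N := by linarith
    set l := Nat.log 2 ⌊(N : ℝ) ^ β⌋₊
    have h1 : (l : ℝ) * Real.log 2 ≤ β * Real.log N := by
      rw [← Real.log_pow, ← Real.log_rpow hNpos]
      exact Real.log_le_log (by positivity) hl
    have h2 := Real.log_le_rpow_div hNpos.le (show 0 < ε / 2 by positivity)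
    have h3 : (1 : ℝ) / 2 < Real.log 2 := by linarith [Real.log_two_gt_d9]
    have hlog : 0 ≤ Real.log N := Real.log_nonneg hN1
    have h4 : (l : ℝ) ≤ 4 / ε * (N : ℝ) ^ (ε / 2) := by
      have h5 : (N : ℝ) ^ (ε / 2) / (ε / 2) = 2 / ε * (N : ℝ) ^ (ε / 2) := by field_simp
      rw [h5] at h2
      have h6 : 4 / ε * (N : ℝ) ^ (ε / 2) = 2 * (2 / ε * (N : ℝ) ^ (ε / 2)) := by ring
      nlinarith [Nat.cast_nonneg (α := ℝ) l]
    calc (l : ℝ) ^ 2 ≤ (4 / ε * (N : ℝ) ^ (ε / 2)) ^ 2 := pow_le_pow_left₀ (Nat.cast_nonneg l) h4 2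
      _ = _ := by rw [mul_pow, ← Real.rpow_mul_natCast hNpos.le]; norm_num

theorem exists_mesoscopic_scale {d : ℕ} {κ : ℝ} (hκ0 : 0 < κ) (hκ1 : κ < 1)
    (hdκ : (d = 1 ∧ 3 * κ < 1) ∨ 2 ≤ d) :
    ∃ (L : ℕ → ℕ) (Q : ℕ → ℝ), (∀ᶠ N in atTop, 1 ≤ L N ∧ 2 ^ (L N + 1) + 2 ≤ N ∧
        ∀ k < L N, (4 : ℝ) ^ k * ((2 : ℝ) ^ (k * d))⁻¹ ≤ Q N) ∧
      (∀ᶠ N in atTop, (L N : ℝ) ^ 2 * 4 ^ L N * (N : ℝ) ^ (-(1 + κ)) ≤ 1) ∧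
      Tendsto (fun N : ℕ => (N : ℝ) ^ (2 * κ) * ((2 : ℝ) ^ (L N * d))⁻¹) atTop (nhds 0) ∧
      Tendsto (fun N : ℕ => (L N : ℝ) ^ 2 * (N : ℝ) ^ (κ - 1) * Q N) atTop (nhds 0) := by
  obtain ⟨β, γ, hβ0, hβ1, hβd, hβκ, hγ, hQ⟩ : ∃ β γ : ℝ, 0 < β ∧ β < 1 ∧ 2 * κ < β * d ∧
      2 * β < 1 + κ ∧ κ + γ < 1 ∧ (d = 1 ∧ γ = β ∨ 2 ≤ d ∧ γ = 0) := by
    rcases hdκ with ⟨rfl, h⟩ | h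
    · exact ⟨(1 + 5 * κ) / 4, (1 + 5 * κ) / 4, by linarith, by linarith, by push_cast; linarith,
        by linarith, by linarith, Or.inl ⟨rfl, rfl⟩⟩
    · have h2 : (2 : ℝ) ≤ d := by exact_mod_cast h
      exact ⟨(1 + 3 * κ) / 4, 0, by linarith, by linarith, by nlinarith, by linarith, by linarith,
        Or.inr ⟨h, rfl⟩⟩
  obtain ⟨L, hL, hlog⟩ := exists_dyadic_scale hβ0 hβ1
  refine ⟨L, fun N => (N : ℝ) ^ γ, ?_, ?_, ?_, ?_⟩
  · filter_upwards [hL] with N hN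
    refine ⟨hN.1, hN.2.1, fun k hk => ?_⟩
    have e4 : (4 : ℝ) ^ k = 2 ^ k * 2 ^ k := by rw [← mul_pow]; norm_num
    rcases hQ with ⟨rfl, rfl⟩ | ⟨h2, rfl⟩
    · rw [mul_one, e4, mul_inv_cancel_right₀ (by positivity)]
      exact (pow_le_pow_right₀ one_le_two hk.le).trans hN.2.2.1
    · rw [Real.rpow_zero, ← div_eq_mul_inv, div_le_one (by positivity), e4, ← pow_add]
      exact pow_le_pow_right₀ one_le_two (by nlinarith)
  · set ε := (1 + κ - 2 * β) / 2 with hε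
    have hε0 : 0 < ε := by rw [hε]; linarith
    have h0 := (tendsto_natCast_rpow_neg (s := ε + 2 * β + -(1 + κ)) (by linarith)).const_mul
      ((4 / ε) ^ 2)
    rw [mul_zero] at h0
    filter_upwards [hL, hlog ε hε0, h0.eventually_le_const zero_lt_one, eventually_ge_atTop 1]
      with N hN hl h1 hN1
    have hNpos : (0 : ℝ) < N := by exact_mod_cast hN1
    have e4 : (4 : ℝ) ^ L N ≤ (N : ℝ) ^ (2 * β) := by
      rw [show (4 : ℝ) = 2 ^ 2 by norm_num, ← pow_mul, mul_comm 2 (L N), pow_mul, mul_comm 2 β,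
        Real.rpow_mul hNpos.le, Real.rpow_two]
      exact pow_le_pow_left₀ (by positivity) hN.2.2.1 2
    refine le_trans ?_ h1
    rw [Real.rpow_add hNpos, Real.rpow_add hNpos, ← mul_assoc, ← mul_assoc]
    exact mul_le_mul_of_nonneg_right (mul_le_mul hl e4 (by positivity) (by positivity))
      (by positivity)
  · have h0 := (tendsto_natCast_rpow_neg (s := 2 * κ + -(β * d)) (by linarith)).const_mul
      ((2 : ℝ) ^ d)
    rw [mul_zero] at h0
    refine tendsto_of_tendsto_of_tendsto_of_le_of_le' tendsto_const_nhds h0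
      (Eventually.of_forall fun N => by positivity) ?_
    filter_upwards [hL, eventually_ge_atTop 1] with N hN hN1
    have hNpos : (0 : ℝ) < N := by exact_mod_cast hN1
    rw [Real.rpow_add hNpos, mul_left_comm]
    refine mul_le_mul_of_nonneg_left ?_ (by positivity)
    rw [Real.rpow_neg hNpos.le, Real.rpow_mul_natCast hNpos.le, pow_mul, ← div_eq_mul_inv,
      inv_eq_one_div, div_le_div_iff₀ (by positivity) (by positivity), one_mul, ← mul_pow]
    exact pow_le_pow_left₀ (by positivity) hN.2.2.2 d
  · set ε := (1 - κ - γ) / 2 with hε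
    have hε0 : 0 < ε := by rw [hε]; linarith
    have h0 := (tendsto_natCast_rpow_neg (s := ε + (κ - 1) + γ) (by linarith)).const_mul
      ((4 / ε) ^ 2)
    rw [mul_zero] at h0
    refine tendsto_of_tendsto_of_tendsto_of_le_of_le' tendsto_const_nhds h0
      (Eventually.of_forall fun N => by positivity) ?_
    filter_upwards [hlog ε hε0, eventually_ge_atTop 1] with N hl hN1
    have hNpos : (0 : ℝ) < N := by exact_mod_cast hN1
    rw [Real.rpow_add hNpos, Real.rpow_add hNpos, ← mul_assoc, ← mul_assoc]
    exact mul_le_mul_of_nonneg_right (mul_le_mul_of_nonneg_right hl (by positivity))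
      (by positivity)

end Scale

section Assembly

theorem relEnt_le_of_profile {N d K : ℕ} [NeZero N] {p : Fin d → Bool → ℝ} {R : ℝ → Site N d → ℝ}
    {m : ℝ → GCfg N d K → ℝ} {r T p₀ P G E Q Γ A a : ℝ} {L : ℕ} (hr : 0 < r)
    (h0 : ∀ s ∈ Set.Icc 0 T, ∀ x, r ≤ R s x) (h1 : ∀ s ∈ Set.Icc 0 T, ∀ x, R s x ≤ K - r)
    (hd : 1 ≤ d) (hp : ∀ i b, 0 ≤ p i b) (hp₀ : 0 < p₀) (hP : ∀ i b, p i b ≤ P)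
    (hpj : ∀ j, ∃ b, p₀ ≤ p j b) (hL : 1 ≤ L) (hN : 2 ^ (L + 1) + 2 ≤ N)
    (hG : ∀ s ∈ Set.Icc 0 T, ∀ j x, |R s (x + unitSite j) - R s x| ≤ G) (hA : A = Γ * (P * K ^ 3) * G)
    (hΓ : 0 < Γ) (hQ : ∀ k < L, (4 : ℝ) ^ k * ((2 : ℝ) ^ (k * d))⁻¹ ≤ Q)
    (hE : ∀ s ∈ Set.Icc 0 T, ∀ x, DifferentiableAt ℝ (fun s => R s x) s ∧
      |-(K * deriv (fun s => R s x) s) + Γ *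
        ∑ i, (meanCurrent K p (R s) i (x - unitSite i) - meanCurrent K p (R s) i x)| ≤ E)
    (hprob : ∀ t, 0 ≤ t → (∀ η, 0 ≤ m t η) ∧ ∑ η, m t η = 1)
    (hkolm : ∀ (f : GCfg N d K → ℝ) (t : ℝ), 0 ≤ t →
      HasDerivAt (fun s => ∑ η, f η * m s η) (Γ * ∑ η, genL p f η * m t η) t)
    (ha : 4 * (K / r ^ 2) ^ 2 + d * (4 * (K / r ^ 2) ^ 2 * (A + 1)) +
      d * (bondConst K r * d ^ 2 / p₀ * (L ^ 2 / Γ) * (2 * (K / r ^ 2) ^ 2 * A ^ 2 * 4 ^ L)) ≤ a)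
    {t : ℝ} (ht : t ∈ Set.Icc 0 T) :
    0 ≤ relEnt (m t) (prodBinom (R t)) ∧ relEnt (m t) (prodBinom (R t)) ≤
      Real.exp (a * t) * (relEnt (m 0) (prodBinom (R 0)) +
        ((N : ℝ) ^ d * E ^ 2 + d * ((K / r ^ 2) ^ 2 * ((N : ℝ) ^ d * (A ^ 2 * ((2 : ℝ) ^ (L * d))⁻¹))) +
        d * (bondConst K r * d ^ 2 / p₀ * (L ^ 2 / Γ) * ((K / r ^ 2) ^ 2 * A ^ 2 * ((N : ℝ) ^ d * Q)) +
          Γ * p₀ * ((N : ℝ) ^ d * G ^ 2))) * t) := by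
  have hN2 : 2 ≤ N := by
    have : 0 < 2 ^ (L + 1) := by positivity
    omega
  have hB := bondConst_nonneg (K := K) (r := r)
  have hQ0 : 0 ≤ Q := by
    have := hQ 0 hL
    simp only [pow_zero, zero_mul, inv_one, mul_one] at this
    linarith
  have hG0 : 0 ≤ G := (abs_nonneg _).trans (hG t ht ⟨0, hd⟩ 0)
  have hP0 : 0 ≤ P := (hp ⟨0, hd⟩ true).trans (hP _ _)
  have hA0 : 0 ≤ A := by rw [hA]; positivity
  have hcard : (Fintype.card (Site N d) : ℝ) = (N : ℝ) ^ d := by simp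
  have hrK : r ≤ K - r := (h0 t ht 0).trans (h1 t ht 0)
  refine relEnt_gronwall hN2 hp hΓ (le_trans (by positivity) ha) (by positivity) hr (by linarith)
    (fun s hs x => (hE s hs x).1.hasDerivAt) (fun s hs x => hr.trans_le (h0 s hs x))
    (fun s hs x => (h1 s hs x).trans_lt (by linarith)) hprob hkolm
    (fun s hs σ hσ hσs => ?_) ht
  have hH := relEnt_prodBinom_nonneg (fun x => hr.trans_le (h0 s hs x))
    (fun x => (h1 s hs x).trans_lt (by linarith)) hσ hσs
  refine (static_estimate hr (h0 s hs) (h1 s hs) hσ hσs hd hp hp₀ hP hpj hL hN (hG s hs) hA hΓ hQ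
    fun x => -(K * deriv (fun s => R s x) s)).trans ?_
  have hsum : ∑ x, (-(K * deriv (fun s => R s x) s) + Γ * ∑ i,
      (meanCurrent K p (R s) i (x - unitSite i) - meanCurrent K p (R s) i x)) ^ 2 ≤
      (N : ℝ) ^ d * E ^ 2 := by
    refine (Finset.sum_le_card_nsmul _ _ (E ^ 2) fun x _ => ?_).trans_eq
      (by rw [Finset.card_univ, nsmul_eq_mul, hcard])
    exact sq_le_sq' (abs_le.1 (hE s hs x).2).1 (abs_le.1 (hE s hs x).2).2
  rw [hcard]
  have := mul_le_mul_of_nonneg_right ha hH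
  linarith

theorem tendsto_error {d : ℕ} {α κ c₁ c₂ c₃ c₄ : ℝ} (hκ : κ < 1) {q : ℕ → ℝ} {l Q : ℕ → ℝ}
    (hq : Tendsto (fun N : ℕ => (N : ℝ) ^ (2 * κ) * q N) atTop (nhds 0))
    (hQ : Tendsto (fun N : ℕ => l N ^ 2 * (N : ℝ) ^ (κ - 1) * Q N) atTop (nhds 0)) :
    Tendsto (fun N : ℕ => (N : ℝ) ^ (2 * α - (d : ℝ)) *
      ((N : ℝ) ^ d * (c₁ * (N : ℝ) ^ (κ - 1 - α)) ^ 2 +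
        c₂ * ((N : ℝ) ^ d * (((N : ℝ) ^ (κ - α)) ^ 2 * q N)) +
        c₃ * (l N ^ 2 / (N : ℝ) ^ (1 + κ) * (((N : ℝ) ^ (κ - α)) ^ 2 * ((N : ℝ) ^ d * Q N))) +
        c₄ * ((N : ℝ) ^ (1 + κ) * ((N : ℝ) ^ d * ((N : ℝ) ^ (-1 - α)) ^ 2)))) atTop (nhds 0) := by
  have hlim := ((((tendsto_natCast_rpow_neg (s := κ - 1) (by linarith)).pow 2).const_mul
    (c₁ ^ 2)).add (hq.const_mul c₂)).add ((hQ.const_mul c₃).add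
    ((tendsto_natCast_rpow_neg (s := κ - 1) (by linarith)).const_mul c₄))
  simp only [ne_eq, OfNat.ofNat_ne_zero, not_false_eq_true, zero_pow, mul_zero, add_zero] at hlim
  refine hlim.congr' ?_
  filter_upwards [eventually_ge_atTop 1] with N hN
  have hNpos : (0 : ℝ) < N := by exact_mod_cast hN
  have e1 : (N : ℝ) ^ (2 * α - (d : ℝ)) = ((N : ℝ) ^ α) ^ 2 / (N : ℝ) ^ d := by
    rw [Real.rpow_sub hNpos, Real.rpow_natCast, mul_comm 2 α, Real.rpow_mul hNpos.le,
      Real.rpow_two]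
  have e2 : (N : ℝ) ^ (κ - 1 - α) = (N : ℝ) ^ κ / N / (N : ℝ) ^ α := by
    rw [Real.rpow_sub hNpos, Real.rpow_sub hNpos, Real.rpow_one]
  have e3 : (N : ℝ) ^ (κ - α) = (N : ℝ) ^ κ / (N : ℝ) ^ α := Real.rpow_sub hNpos _ _
  have e4 : (N : ℝ) ^ (1 + κ) = N * (N : ℝ) ^ κ := by rw [Real.rpow_add hNpos, Real.rpow_one]
  have e5 : (N : ℝ) ^ (-1 - α) = (N : ℝ)⁻¹ / (N : ℝ) ^ α := by
    rw [Real.rpow_sub hNpos, Real.rpow_neg_one]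
  have e6 : (N : ℝ) ^ (κ - 1) = (N : ℝ) ^ κ / N := by
    rw [Real.rpow_sub hNpos, Real.rpow_one]
  have e7 : (N : ℝ) ^ (2 * κ) = ((N : ℝ) ^ κ) ^ 2 := by
    rw [mul_comm 2 κ, Real.rpow_mul hNpos.le, Real.rpow_two]
  have hA : (N : ℝ) ^ α ≠ 0 := (Real.rpow_pos_of_pos hNpos _).ne'
  have hk : (N : ℝ) ^ κ ≠ 0 := (Real.rpow_pos_of_pos hNpos _).ne'
  rw [e1, e2, e3, e4, e5, e6, e7]
  field_simp
  ring

end Assembly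

/-- Relative entropy estimate for the equilibrium perturbation of the asymmetric
generalized exclusion process (Theorem `thm1`): if `H_N(0) = o(N^{d−2α})`, then
(i) for `d = 1`, `α ∈ (0,1/2)` and `0 < κ ≤ α` with `κ < 1 − 2α`, and
(ii) for `d ≥ 2`, `α > 0` and `0 < κ ≤ α` with `κ < 1`,
one has `H_N(t) = o(N^{d−2α})` for every `t ∈ [0,T]`. -/
theorem statement0 (d K : ℕ) (hd : 1 ≤ d) (hK : 1 ≤ K)
    (p : Fin d → Bool → ℝ) (hp : ∀ i b, 0 ≤ p i b)
    (hpd : ∀ i, 0 < p i true + p i false)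
    (hm : (fun i => p i true - p i false) ≠ (0 : Fin d → ℝ))
    (ϱs : ℝ) (hϱs : ϱs ∈ Set.Ioo (0 : ℝ) (K : ℝ))
    (α κ T : ℝ) (hα : 0 < α) (hκ : 0 < κ) (hκα : κ ≤ α) (hT : 0 < T)
    (ρ : ℝ → (Fin d → ℝ) → ℝ)
    (hρsmooth : ContDiff ℝ (⊤ : ℕ∞) (fun q : ℝ × (Fin d → ℝ) => ρ q.1 q.2))
    (hρper : ∀ (s : ℝ) (u : Fin d → ℝ) (z : Fin d → ℤ),
      ρ s (fun j => u j + z j) = ρ s u)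
    (hρpde : ∀ s ∈ Set.Icc (0 : ℝ) T, ∀ u : Fin d → ℝ,
      deriv (fun s' => ρ s' u) s
        = ∑ i, (p i true - p i false)
            * deriv (fun h => ρ s (Function.update u i h) ^ 2) (u i))
    -- the law `μ_{N,t}` of the process accelerated by `N^{1+κ}`
    (μ : (N : ℕ) → ℝ → GCfg N d K → ℝ)
    (hμprob : ∀ (N : ℕ) (t : ℝ), 0 ≤ t → (∀ η, 0 ≤ μ N t η) ∧ ∑ η, μ N t η = 1)
    (hkolm : ∀ (N : ℕ), 1 ≤ N → ∀ (f : GCfg N d K → ℝ) (t : ℝ), 0 ≤ t →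
      HasDerivAt (fun s => ∑ η, f η * μ N s η)
        ((N : ℝ) ^ ((1 : ℝ) + κ) * ∑ η, genL p f η * μ N t η) t)
    -- `H_N(t)`, with reference measure the slowly varying binomial product measure
    (HN : ℕ → ℝ → ℝ)
    (hHN : ∀ (N : ℕ) (t : ℝ), HN N t = relEnt (μ N t)
      (prodBinom fun x : Site N d =>
        profileGE d K ϱs α κ (fun i => p i true - p i false) ρ N t (siteCoord x)))
    -- `H_N(0) = o(N^{d−2α})`
    (h0 : Tendsto (fun N : ℕ => (N : ℝ) ^ (2 * α - (d : ℝ)) * HN N 0) atTop (nhds 0))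
    -- the restrictions on `d`, `α`, `κ`
    (hcase : (d = 1 ∧ α < 1 / 2 ∧ κ < 1 - 2 * α) ∨ (2 ≤ d ∧ κ < 1)) :
    ∀ t ∈ Set.Icc (0 : ℝ) T,
      Tendsto (fun N : ℕ => (N : ℝ) ^ (2 * α - (d : ℝ)) * HN N t) atTop (nhds 0) := by
  intro t ht
  obtain ⟨C, hC0, hC⟩ := exists_profile_estimates hϱs hα hκα hρsmooth hρper hρpde
  have hκ1 : κ < 1 := by rcases hcase with h | h <;> linarith [h.2]
  obtain ⟨L, Q, hL, hLa, hLq, hLQ⟩ := exists_mesoscopic_scale (d := d) hκ hκ1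
    (hcase.imp (fun h => ⟨h.1, by linarith [h.2.2]⟩) fun h => h.1)
  set r : ℝ := min ϱs (K - ϱs) / 2 with hr
  have hr0 : 0 < r := half_pos (lt_min hϱs.1 (sub_pos.2 hϱs.2))
  have hr1 : 2 * r ≤ ϱs := by
    rw [hr]; linarith [min_le_left ϱs (K - ϱs)]
  have hr2 : 2 * r ≤ K - ϱs := by
    rw [hr]; linarith [min_le_right ϱs (K - ϱs)]
  have : Nonempty (Fin d) := ⟨⟨0, hd⟩⟩
  obtain ⟨i₀, hi₀⟩ := Finite.exists_min fun i => max (p i true) (p i false)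
  set p₀ : ℝ := max (p i₀ true) (p i₀ false) with hp₀def
  have hp₀ : 0 < p₀ := by
    rcases lt_or_ge 0 (p i₀ true) with h | h
    · exact h.trans_le (le_max_left _ _)
    · exact lt_of_lt_of_le (by linarith [hpd i₀]) (le_max_right _ _)
  have hpj : ∀ j, ∃ b, p₀ ≤ p j b := fun j =>
    (le_max_iff.1 (hi₀ j)).elim (fun h => ⟨true, h⟩) fun h => ⟨false, h⟩
  set P : ℝ := ∑ i, ∑ b, p i b with hPdef
  have hP : ∀ i b, p i b ≤ P := fun i b =>
    (Finset.single_le_sum (f := fun b => p i b) (fun _ _ => hp _ _)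
      (Finset.mem_univ b)).trans (Finset.single_le_sum (f := fun i => ∑ b, p i b)
        (fun _ _ => Finset.sum_nonneg fun _ _ => hp _ _) (Finset.mem_univ i))
  have hP0 : 0 ≤ P := (hp i₀ true).trans (hP i₀ true)
  set C₁ : ℝ := P * K ^ 3 * C with hC₁
  have hC₁0 : 0 ≤ C₁ := by positivity
  have hB := bondConst_nonneg (K := K) (r := r)
  set M : ℝ := K / r ^ 2 with hM
  set a : ℝ := 4 * M ^ 2 + d * (4 * M ^ 2 * (C₁ + 1)) +
    d * (bondConst K r * d ^ 2 / p₀ * (2 * M ^ 2 * C₁ ^ 2)) with ha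
  have herr := tendsto_error (d := d) (α := α) (κ := κ) (c₁ := C) (c₂ := d * (M ^ 2 * C₁ ^ 2))
    (c₃ := d * (bondConst K r * d ^ 2 / p₀ * (M ^ 2 * C₁ ^ 2))) (c₄ := d * (p₀ * C ^ 2)) hκ1 hLq hLQ
  have hlim := ((h0.add (herr.mul_const t)).const_mul (Real.exp (a * t)))
  simp only [zero_mul, add_zero, mul_zero] at hlim
  have hsmall := (tendsto_natCast_rpow_neg (s := -α) (by linarith)).const_mul C
  rw [mul_zero] at hsmall
  have hmain : ∀ᶠ N : ℕ in atTop, 0 ≤ HN N t ∧ HN N t ≤ Real.exp (a * t) * (HN N 0 +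
      ((N : ℝ) ^ d * (C * (N : ℝ) ^ (κ - 1 - α)) ^ 2 +
        d * (M ^ 2 * C₁ ^ 2) * ((N : ℝ) ^ d * (((N : ℝ) ^ (κ - α)) ^ 2 * ((2 : ℝ) ^ (L N * d))⁻¹)) +
        d * (bondConst K r * d ^ 2 / p₀ * (M ^ 2 * C₁ ^ 2)) * ((L N : ℝ) ^ 2 / (N : ℝ) ^ (1 + κ) *
          (((N : ℝ) ^ (κ - α)) ^ 2 * ((N : ℝ) ^ d * Q N))) +
        d * (p₀ * C ^ 2) * ((N : ℝ) ^ (1 + κ) *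
          ((N : ℝ) ^ d * ((N : ℝ) ^ (-1 - α)) ^ 2))) * t) := by
    filter_upwards [hL, hLa, hsmall.eventually_le_const hr0, eventually_ge_atTop 1]
      with N hLN hLaN hsN hN1
    have : NeZero N := ⟨by omega⟩
    have hN : (1 : ℝ) ≤ N := by exact_mod_cast hN1
    have hNpos : (0 : ℝ) < N := by linarith
    have hest := hC N (fun s x => profileGE d K ϱs α κ (fun i => p i true - p i false) ρ N s
      (siteCoord x)) fun _ _ => rfl
    have hΓ : 0 < (N : ℝ) ^ (1 + κ) := Real.rpow_pos_of_pos hNpos _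
    have hA : C₁ * (N : ℝ) ^ (κ - α) =
        (N : ℝ) ^ (1 + κ) * (P * K ^ 3) * (C * (N : ℝ) ^ (-1 - α)) := by
      rw [show κ - α = (1 + κ) + (-1 - α) by ring, Real.rpow_add hNpos, hC₁]
      ring
    have hA1 : (N : ℝ) ^ (κ - α) ≤ 1 :=
      Real.rpow_le_one_of_one_le_of_nonpos hN (by linarith)
    have hA0 : 0 < (N : ℝ) ^ (κ - α) := Real.rpow_pos_of_pos hNpos _
    have haN : 4 * M ^ 2 + d * (4 * M ^ 2 * (C₁ * (N : ℝ) ^ (κ - α) + 1)) +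
        d * (bondConst K r * d ^ 2 / p₀ * ((L N : ℝ) ^ 2 / (N : ℝ) ^ (1 + κ)) *
          (2 * M ^ 2 * (C₁ * (N : ℝ) ^ (κ - α)) ^ 2 * 4 ^ L N)) ≤ a := by
      have h1 : C₁ * (N : ℝ) ^ (κ - α) ≤ C₁ := mul_le_of_le_one_right hC₁0 hA1
      have h2 : (L N : ℝ) ^ 2 / (N : ℝ) ^ (1 + κ) * (((N : ℝ) ^ (κ - α)) ^ 2 * 4 ^ L N) ≤ 1 := by
        rw [Real.rpow_neg hNpos.le] at hLaN
        calc _ = ((L N : ℝ) ^ 2 * 4 ^ L N * ((N : ℝ) ^ (1 + κ))⁻¹) * ((N : ℝ) ^ (κ - α)) ^ 2 := by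
              rw [div_eq_mul_inv]; ring
          _ ≤ 1 * 1 := mul_le_mul hLaN (pow_le_one₀ hA0.le hA1) (by positivity) zero_le_one
          _ = 1 := one_mul 1
      have h3 : bondConst K r * d ^ 2 / p₀ * ((L N : ℝ) ^ 2 / (N : ℝ) ^ (1 + κ)) *
          (2 * M ^ 2 * (C₁ * (N : ℝ) ^ (κ - α)) ^ 2 * 4 ^ L N) ≤
          bondConst K r * d ^ 2 / p₀ * (2 * M ^ 2 * C₁ ^ 2) := by
        calc _ = bondConst K r * d ^ 2 / p₀ * (2 * M ^ 2 * C₁ ^ 2) *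
              ((L N : ℝ) ^ 2 / (N : ℝ) ^ (1 + κ) * (((N : ℝ) ^ (κ - α)) ^ 2 * 4 ^ L N)) := by ring
          _ ≤ _ := mul_le_of_le_one_right (by positivity) h2
      rw [ha]
      gcongr
    have hbase := relEnt_le_of_profile (T := T) hr0
      (fun s hs x => by linarith [abs_le.1 (((hest s hs).1 x).trans hsN)])
      (fun s hs x => by linarith [abs_le.1 (((hest s hs).1 x).trans hsN)])
      hd hp hp₀ hP hpj hLN.1 hLN.2.1 (fun s hs => (hest s hs).2.1) hA hΓ hLN.2.2
      (fun s hs => (hest s hs).2.2) (hμprob N) (hkolm N hN1) haN ht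
    rw [hHN N t, hHN N 0]
    refine ⟨hbase.1, hbase.2.trans_eq ?_⟩
    ring
  refine tendsto_of_tendsto_of_tendsto_of_le_of_le' tendsto_const_nhds hlim ?_ ?_
  · filter_upwards [hmain] with N hN
    exact mul_nonneg (by positivity) hN.1
  · filter_upwards [hmain] with N hN
    refine (mul_le_mul_of_nonneg_left hN.2 (by positivity)).trans_eq ?_
    ring
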